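/- arXiv:1905.07426 — 4 statements merged into one kernel-verified Lean document; each statement's English description precedes it below -/
import Mathlib

section
/- Let α ∈ (0,1) and let the temporal mesh be quasi-graded with parameter r ≥ 1 and constants c_0 ≤ C_0. Let u ∈ C([0,T]) ∩ C^2((0,T]) satisfy, for some constant C_u > 0, |u′(t)| ≤ C_u(1 + t^{α−1}) and |u″(t)| ≤ C_u(1 + t^{α−2}) for all t ∈ (0,T]. Let the discrete solution U^0,...,U^M be defined by U^0 = u(0) and δ_t^α U^m = D_t^α u(t_m) for m = 1,...,M (the L1 discretization of the initial-value problem D_t^α u = f with f(t_m) := D_t^α u(t_m)). Then there exists a constant C > 0, depending only on α, r, T, c_0, C_0, C_u, such that |u(t_m) − U^m| ≤ C ℰ^m for all m = 1,...,M. -/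
open Real MeasureTheory Set

/-- The L1 discrete fractional-derivative operator associated with the mesh `t`,
applied to the sequence `V`, at time level `m`. -/
noncomputable def deltaL1 (α : ℝ) (t : ℕ → ℝ) (V : ℕ → ℝ) (m : ℕ) : ℝ :=
  (1 / Real.Gamma (1 - α)) *
    ∑ j ∈ Finset.Icc 1 m,
      ((V j - V (j - 1)) / (t j - t (j - 1))) *
        ∫ s in (t (j - 1))..(t j), (t m - s) ^ (-α)

/-- `t 0 = 0 < t 1 < ... < t M = T` with `M ≥ 2`. -/
def IsMesh (T : ℝ) (M : ℕ) (t : ℕ → ℝ) : Prop :=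
  2 ≤ M ∧ t 0 = 0 ∧ (∀ j, j < M → t j < t (j + 1)) ∧ t M = T

/-- Quasi-graded mesh with parameter `r` and constants `c0 ≤ C0`. -/
def QuasiGraded (r c0 C0 : ℝ) (M : ℕ) (t : ℕ → ℝ) : Prop :=
  (c0 * (M : ℝ) ^ (-r) ≤ t 1 ∧ t 1 ≤ C0 * (M : ℝ) ^ (-r)) ∧
  (∀ j : ℕ, 1 ≤ j → j ≤ M →
    c0 * (t 1 * (j : ℝ) ^ r) ≤ t j ∧ t j ≤ C0 * (t 1 * (j : ℝ) ^ r)) ∧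
  (∀ j : ℕ, 1 ≤ j → j ≤ M →
    c0 * ((t 1) ^ (1 / r) * (t j) ^ (1 - 1 / r)) ≤ t j - t (j - 1) ∧
    t j - t (j - 1) ≤ C0 * ((t 1) ^ (1 / r) * (t j) ^ (1 - 1 / r)))

/-- The stability majorant `𝒱^j`. -/
noncomputable def Vcal (α γ τ tj : ℝ) : ℝ :=
  if 0 < γ then τ * tj ^ (α - 1)
  else if γ = 0 then τ * tj ^ (α - 1) * (1 + Real.log (tj / τ))
  else τ * tj ^ (α - 1) * (τ / tj) ^ γ

/-- The Caputo fractional derivative of order `α`. -/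
noncomputable def caputo (α : ℝ) (u : ℝ → ℝ) (t : ℝ) : ℝ :=
  (1 / Real.Gamma (1 - α)) * ∫ s in (0:ℝ)..t, (t - s) ^ (-α) * deriv u s

/-- The pointwise-in-time error majorant `ℰ^m` of (3.2). -/
noncomputable def EcalL1 (α r : ℝ) (M : ℕ) (τ tm : ℝ) : ℝ :=
  if r < 2 - α then (M : ℝ) ^ (-r) * tm ^ (α - 1)
  else if r = 2 - α then (M : ℝ) ^ (α - 2) * tm ^ (α - 1) * (1 + Real.log (tm / τ))
  else (M : ℝ) ^ (α - 2) * tm ^ (α - (2 - α) / r)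

/-- Tangent-line inequality for the convex function `x ↦ x ^ (-p)`. -/
theorem rpow_neg_tangent {p x y : ℝ} (hp : 0 ≤ p) (hx : 0 < x) (hy : 0 < y) :
    p * (x - y) * x ^ (-p - 1) ≤ y ^ (-p) - x ^ (-p) := by
  have h1 : y ^ (-p) = x ^ (-p) * (y / x) ^ (-p) := by
    rw [← mul_rpow hx.le (by positivity)]; congr 1; field_simp
  have h2 : 1 - p * (y / x - 1) ≤ (y / x) ^ (-p) := by
    rw [rpow_def_of_pos (by positivity)]
    have := add_one_le_exp (Real.log (y / x) * -p)
    have h3 := Real.log_le_sub_one_of_pos (show 0 < y / x by positivity)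
    nlinarith
  have h4 : x ^ (-p - 1) = x ^ (-p) / x := by rw [rpow_sub hx, rpow_one]
  have h5 : p * (x - y) * (x ^ (-p) / x) = x ^ (-p) * (- (p * (y / x - 1))) := by
    field_simp; ring
  rw [h1, h4, h5]
  nlinarith [rpow_pos_of_pos hx (-p)]

/-- Tangent-line inequality for the concave function `x ↦ x ^ β`. -/
theorem rpow_pos_tangent {β x y : ℝ} (hβ : 0 ≤ β) (hβ1 : β ≤ 1) (hx : 0 < x) (hy : 0 ≤ y) :
    β * (x - y) * x ^ (β - 1) ≤ x ^ β - y ^ β := by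
  have h1 : y ^ β = x ^ β * (y / x) ^ β := by
    rw [← mul_rpow hx.le (by positivity)]; congr 1; field_simp
  have h2 : (y / x) ^ β ≤ 1 + β * (y / x - 1) := by
    have h0 : 0 ≤ y / x := by positivity
    have := _root_.rpow_one_add_le_one_add_mul_self (s := y / x - 1) (by linarith) hβ hβ1
    simpa using this
  have h4 : x ^ (β - 1) = x ^ β / x := by rw [rpow_sub hx, rpow_one]
  have h5 : β * (x - y) * (x ^ β / x) = x ^ β * (- (β * (y / x - 1))) := by
    field_simp; ring
  rw [h1, h4, h5]
  nlinarith [rpow_pos_of_pos hx β]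

theorem abs_integral_le_of_Ioo {f g : ℝ → ℝ} {a b : ℝ} (hab : a ≤ b)
    (hg : IntervalIntegrable g volume a b) (h : ∀ s ∈ Ioo a b, |f s| ≤ g s) :
    |∫ s in a..b, f s| ≤ ∫ s in a..b, g s := by
  rw [← Real.norm_eq_abs]
  refine intervalIntegral.norm_integral_le_of_norm_le hab ?_ hg
  have : ∀ᵐ s : ℝ ∂volume, s ≠ b := by simp [ae_iff]
  filter_upwards [this] with s hs hs'
  exact h s ⟨hs'.1, lt_of_le_of_ne hs'.2 hs⟩

theorem kernel_intervalIntegrable {α : ℝ} (hα1 : α < 1) (t a b : ℝ) :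
    IntervalIntegrable (fun s : ℝ => (t - s) ^ (-α)) volume a b := by
  have := (intervalIntegral.intervalIntegrable_rpow' (a := t - a) (b := t - b)
    (show -1 < -α by linarith)).comp_sub_left t
  simpa using this

theorem kernel_integral {α : ℝ} (hα1 : α < 1) (t a b : ℝ) :
    ∫ s in a..b, (t - s) ^ (-α) = ((t - a) ^ (1 - α) - (t - b) ^ (1 - α)) / (1 - α) := by
  rw [intervalIntegral.integral_comp_sub_left (fun x => x ^ (-α)) t,
    integral_rpow (Or.inl (by linarith))]
  ring_nf

theorem kernel_integral_ge {α t a b : ℝ} (hα0 : 0 < α) (hα1 : α < 1) (hab : a ≤ b) (hbt : b ≤ t) :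
    (b - a) * (t - a) ^ (-α) ≤ ∫ s in a..b, (t - s) ^ (-α) := by
  have h := intervalIntegral.integral_mono_on_of_le_Ioo hab
    (intervalIntegrable_const (c := (t - a) ^ (-α))) (kernel_intervalIntegrable hα1 t a b)
    (fun s hs => rpow_le_rpow_of_nonpos (by linarith [hs.2]) (by linarith [hs.1]) (by linarith))
  simpa using h

theorem kernel_integral_le {α t a b : ℝ} (hα0 : 0 < α) (hα1 : α < 1) (hab : a ≤ b) (hbt : b < t) :
    ∫ s in a..b, (t - s) ^ (-α) ≤ (b - a) * (t - b) ^ (-α) := by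
  have h := intervalIntegral.integral_mono_on_of_le_Ioo hab
    (kernel_intervalIntegrable hα1 t a b) (intervalIntegrable_const (c := (t - b) ^ (-α)))
    (fun s hs => rpow_le_rpow_of_nonpos (by linarith) (by linarith [hs.2]) (by linarith))
  simpa using h

/-- The oscillation of the kernel gains a factor against mean-zero functions. -/
theorem abs_kernel_integral_le_of_mean_zero {α t a b : ℝ} {g : ℝ → ℝ} (hα0 : 0 < α) (hα1 : α < 1)
    (hab : a < b) (hbt : b < t) (hg : IntervalIntegrable g volume a b)
    (hk : IntervalIntegrable (fun s => (t - s) ^ (-α) * g s) volume a b)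
    (h0 : ∫ s in a..b, g s = 0) :
    |∫ s in a..b, (t - s) ^ (-α) * g s| ≤
      (b - a) * (t - b) ^ (-α - 1) * ∫ s in a..b, |g s| := by
  have h1 : ∫ s in a..b, (t - s) ^ (-α) * g s
      = ∫ s in a..b, ((t - s) ^ (-α) - (t - b) ^ (-α)) * g s := by
    have : (fun s => ((t - s) ^ (-α) - (t - b) ^ (-α)) * g s)
        = fun s => (t - s) ^ (-α) * g s - (t - b) ^ (-α) * g s := by ext; ring
    rw [this, intervalIntegral.integral_sub hk (hg.const_mul _),
      intervalIntegral.integral_const_mul, h0]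
    ring
  rw [h1, ← intervalIntegral.integral_const_mul]
  refine abs_integral_le_of_Ioo hab.le (hg.abs.const_mul _) fun s hs => ?_
  rw [abs_mul]
  refine mul_le_mul_of_nonneg_right ?_ (abs_nonneg _)
  have h2 := rpow_neg_tangent (p := α) (x := t - b) (y := t - s) hα0.le (by linarith)
    (by linarith [hs.2])
  have h3 : (t - s) ^ (-α) ≤ (t - b) ^ (-α) :=
    rpow_le_rpow_of_nonpos (by linarith) (by linarith [hs.2]) (by linarith)
  rw [abs_of_nonpos (by linarith)]
  have h4 : α * (b - s) ≤ b - a := by nlinarith [hs.1, hs.2]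
  have h5 : 0 < (t - b) ^ (-α - 1) := rpow_pos_of_pos (by linarith) _
  nlinarith

/-- Local consistency error of the L1 scheme on one mesh interval. -/
theorem local_consistency {α t a b L : ℝ} {w w' w'' : ℝ → ℝ} (hα0 : 0 < α) (hα1 : α < 1)
    (hab : a < b) (hw : ContinuousOn w (Icc a b))
    (h1 : ∀ s ∈ Ioo a b, HasDerivAt w (w' s) s) (h2 : ∀ s ∈ Ioo a b, HasDerivAt w' (w'' s) s)
    (hL : ∀ s ∈ Ioo a b, |w'' s| ≤ L) :
    IntervalIntegrable (fun s => (t - s) ^ (-α) * w' s) volume a b ∧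
    (b < t → |(w b - w a) / (b - a) * (∫ s in a..b, (t - s) ^ (-α))
        - ∫ s in a..b, (t - s) ^ (-α) * w' s| ≤ L * (b - a) ^ 3 * (t - b) ^ (-α - 1)) ∧
    (b = t → |(w b - w a) / (b - a) * (∫ s in a..b, (t - s) ^ (-α))
        - ∫ s in a..b, (t - s) ^ (-α) * w' s| ≤ L * (b - a) ^ (2 - α) / (1 - α)) := by
  obtain ⟨c, hc, hcs⟩ := exists_hasDerivAt_eq_slope w w' hab hw h1
  set σ := (w b - w a) / (b - a) with hσ
  have hL0 : 0 ≤ L := (abs_nonneg _).trans (hL c hc)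
  have hb : ∀ s ∈ Ioo a b, |w' s - σ| ≤ L * (b - a) := by
    intro s hs
    have := Convex.norm_image_sub_le_of_norm_hasDerivWithin_le
      (fun x hx => (h2 x hx).hasDerivWithinAt) hL (convex_Ioo a b) hc hs
    rw [hcs] at this
    refine this.trans (mul_le_mul_of_nonneg_left ?_ hL0)
    rw [Real.norm_eq_abs, abs_le]
    constructor <;> linarith [hs.1, hs.2, hc.1, hc.2]
  have hcont : ContinuousOn (fun s => w' s - σ) (Ioo a b) := fun s hs =>
    ((h2 s hs).continuousAt.sub continuousAt_const).continuousWithinAt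
  have hmeas : AEStronglyMeasurable (fun s => w' s - σ) (volume.restrict (Ioo a b)) :=
    hcont.aestronglyMeasurable measurableSet_Ioo
  have hae : ∀ᵐ s ∂(volume.restrict (Ioo a b)), ‖w' s - σ‖ ≤ L * (b - a) :=
    (ae_restrict_iff' measurableSet_Ioo).2 (Filter.Eventually.of_forall hb)
  have hk := kernel_intervalIntegrable hα1 t a b
  have hkg : IntervalIntegrable (fun s => (t - s) ^ (-α) * (w' s - σ)) volume a b := by
    rw [intervalIntegrable_iff_integrableOn_Ioo_of_le hab.le] at hk ⊢
    simpa [mul_comm, IntegrableOn] using Integrable.bdd_mul hk hmeas hae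
  have hg : IntervalIntegrable (fun s => w' s - σ) volume a b := by
    have h1 : IntervalIntegrable (fun _ : ℝ => (1 : ℝ)) volume a b := intervalIntegrable_const
    rw [intervalIntegrable_iff_integrableOn_Ioo_of_le hab.le] at h1 ⊢
    simpa [IntegrableOn] using Integrable.bdd_mul h1 hmeas hae
  have hkw : IntervalIntegrable (fun s => (t - s) ^ (-α) * w' s) volume a b := by
    have := hkg.add (hk.mul_const σ)
    refine this.congr fun s _ => ?_
    ring
  have hdiff : σ * (∫ s in a..b, (t - s) ^ (-α)) - ∫ s in a..b, (t - s) ^ (-α) * w' s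
      = - ∫ s in a..b, (t - s) ^ (-α) * (w' s - σ) := by
    have : (fun s => (t - s) ^ (-α) * (w' s - σ))
      = fun s => (t - s) ^ (-α) * w' s - (t - s) ^ (-α) * σ := by ext; ring
    rw [this, intervalIntegral.integral_sub hkw (hk.mul_const σ),
      intervalIntegral.integral_mul_const]
    ring
  have hw'i : IntervalIntegrable w' volume a b := by
    have := hg.add (intervalIntegrable_const (c := σ))
    refine this.congr fun s _ => ?_
    simp
  have hmean : ∫ s in a..b, (w' s - σ) = 0 := by
    rw [intervalIntegral.integral_sub hw'i intervalIntegrable_const,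
      intervalIntegral.integral_eq_sub_of_hasDerivAt_of_le hab.le hw h1 hw'i]
    have : b - a ≠ 0 := by linarith
    simp [hσ]; field_simp; ring
  have habs : ∫ s in a..b, |w' s - σ| ≤ (b - a) * (L * (b - a)) := by
    have := intervalIntegral.integral_mono_on_of_le_Ioo hab.le hg.abs
      (intervalIntegrable_const (c := L * (b - a))) hb
    rwa [intervalIntegral.integral_const, smul_eq_mul] at this
  refine ⟨hkw, fun hbt => ?_, fun hbt => ?_⟩
  · rw [hdiff, abs_neg]
    refine (abs_kernel_integral_le_of_mean_zero hα0 hα1 hab hbt hg hkg hmean).trans ?_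
    have h5 : 0 < (t - b) ^ (-α - 1) := rpow_pos_of_pos (by linarith) _
    calc _ ≤ (b - a) * (t - b) ^ (-α - 1) * ((b - a) * (L * (b - a))) := by gcongr
      _ = _ := by ring
  · rw [hdiff, abs_neg]
    subst hbt
    have h6 : |∫ s in a..b, (b - s) ^ (-α) * (w' s - σ)|
        ≤ ∫ s in a..b, (b - s) ^ (-α) * (L * (b - a)) := by
      refine abs_integral_le_of_Ioo hab.le (hk.mul_const _) fun s hs => ?_
      have h7 : 0 ≤ (b - s) ^ (-α) := rpow_nonneg (by linarith [hs.2]) _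
      rw [abs_mul, abs_of_nonneg h7]
      exact mul_le_mul_of_nonneg_left (hb s hs) h7
    refine h6.trans (le_of_eq ?_)
    rw [intervalIntegral.integral_mul_const, kernel_integral hα1, sub_self,
      zero_rpow (by linarith), show (2 - α : ℝ) = 1 - α + 1 by ring,
      rpow_add_one (by linarith)]
    ring

/-- The geometric facts about a quasi-graded mesh used below. -/
structure GradedMesh (r c0 C0 : ℝ) (M : ℕ) (t : ℕ → ℝ) : Prop where
  r_ge : 1 ≤ r
  c0_pos : 0 < c0
  C0_pos : 0 < C0
  M_pos : 1 ≤ M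
  zero : t 0 = 0
  lt_succ : ∀ i, i < M → t i < t (i + 1)
  index_ge : ∀ k : ℕ, 1 ≤ k → k ≤ M → c0 * (t 1 * (k : ℝ) ^ r) ≤ t k
  index_le : ∀ k : ℕ, 1 ≤ k → k ≤ M → t k ≤ C0 * (t 1 * (k : ℝ) ^ r)
  step_ge : ∀ i, i < M → c0 * (t (i + 1) * (t 1 / t (i + 1)) ^ (1 / r)) ≤ t (i + 1) - t i
  step_le : ∀ i, i < M → t (i + 1) - t i ≤ C0 * (t (i + 1) * (t 1 / t (i + 1)) ^ (1 / r))

namespace GradedMesh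

variable {r c0 C0 : ℝ} {M : ℕ} {t : ℕ → ℝ}

theorem le_of_le (h : GradedMesh r c0 C0 M t) {i j : ℕ} (hij : i ≤ j) (hj : j ≤ M) : t i ≤ t j := by
  induction j, hij using Nat.le_induction with
  | base => exact le_rfl
  | succ n _ ih => exact (ih (by omega)).trans (h.lt_succ n (by omega)).le

theorem lt_of_lt (h : GradedMesh r c0 C0 M t) {i j : ℕ} (hij : i < j) (hj : j ≤ M) : t i < t j :=
  (h.lt_succ i (by omega)).trans_le (h.le_of_le hij hj)

theorem pos (h : GradedMesh r c0 C0 M t) {i : ℕ} (hi : 1 ≤ i) (hiM : i ≤ M) : 0 < t i := by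
  rw [← h.zero]; exact h.lt_of_lt hi hiM

theorem tau_pos (h : GradedMesh r c0 C0 M t) : 0 < t 1 := h.pos le_rfl h.M_pos

theorem nonneg (h : GradedMesh r c0 C0 M t) {i : ℕ} (hiM : i ≤ M) : 0 ≤ t i := by
  rw [← h.zero]; exact h.le_of_le (Nat.zero_le _) hiM

theorem ratio (h : GradedMesh r c0 C0 M t) {i : ℕ} (hi : 1 ≤ i) (hiM : i < M) :
    t (i + 1) ≤ 2 ^ r * C0 / c0 * t i := by
  have h1 := h.index_le (i + 1) (by omega) hiM
  have h2 := h.index_ge i hi hiM.le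
  have hr := h.r_ge
  have h3 : ((i + 1 : ℕ) : ℝ) ^ r ≤ 2 ^ r * (i : ℝ) ^ r := by
    rw [← mul_rpow (by norm_num) (by positivity)]
    refine rpow_le_rpow (by positivity) ?_ (by linarith)
    have : (1 : ℝ) ≤ i := by exact_mod_cast hi
    push_cast; linarith
  have hc := h.c0_pos
  have hC := h.C0_pos
  have ht := h.tau_pos
  calc t (i + 1) ≤ C0 * (t 1 * (2 ^ r * (i : ℝ) ^ r)) := h1.trans (by gcongr)
    _ = 2 ^ r * C0 / c0 * (c0 * (t 1 * (i : ℝ) ^ r)) := by field_simp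
    _ ≤ _ := by gcongr

theorem step_le_step (h : GradedMesh r c0 C0 M t) {i j : ℕ} (hij : i ≤ j) (hj : j < M) :
    t (i + 1) - t i ≤ C0 / c0 * (t (j + 1) - t j) := by
  have hr := h.r_ge
  have hc := h.c0_pos
  have hC := h.C0_pos
  have ht := h.tau_pos
  have key : ∀ k, k < M → t (k + 1) * (t 1 / t (k + 1)) ^ (1 / r)
      = t 1 ^ (1 / r) * t (k + 1) ^ (1 - 1 / r) := by
    intro k hk
    have hp := h.pos (show 1 ≤ k + 1 by omega) hk
    rw [div_rpow ht.le hp.le, rpow_sub hp, rpow_one]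
    ring
  have h1 := h.step_le i (by omega)
  have h2 := h.step_ge j hj
  rw [key _ (by omega)] at h1
  rw [key _ (by omega)] at h2
  have h3 : t (i + 1) ^ (1 - 1 / r) ≤ t (j + 1) ^ (1 - 1 / r) := by
    refine rpow_le_rpow (h.nonneg (by omega)) (h.le_of_le (by omega) hj) ?_
    rw [sub_nonneg, div_le_one (by linarith)]; exact hr
  calc _ ≤ C0 * (t 1 ^ (1 / r) * t (j + 1) ^ (1 - 1 / r)) := h1.trans (by gcongr)
    _ = C0 / c0 * (c0 * (t 1 ^ (1 / r) * t (j + 1) ^ (1 - 1 / r))) := by field_simp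
    _ ≤ _ := by gcongr

theorem sub_le_sub_succ (h : GradedMesh r c0 C0 M t) {i n : ℕ} (hin : i < n) (hn : n < M) :
    t (n + 1) - t i ≤ (1 + C0 / c0) * (t (n + 1) - t (i + 1)) := by
  have h1 := h.step_le_step hin.le hn
  have h2 : t (n + 1) - t n ≤ t (n + 1) - t (i + 1) := by
    linarith [h.le_of_le (show i + 1 ≤ n by omega) hn.le]
  have : 0 < C0 / c0 := div_pos h.C0_pos h.c0_pos
  nlinarith

end GradedMesh

theorem sum_Ico_le_sub_of_le {f F : ℕ → ℝ} {k m : ℕ} (hkm : k ≤ m)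
    (h : ∀ i, k ≤ i → i < m → f i ≤ F (i + 1) - F i) :
    ∑ i ∈ Finset.Ico k m, f i ≤ F m - F k := by
  induction m, hkm using Nat.le_induction with
  | base => simp
  | succ n hn ih =>
    rw [Finset.sum_Ico_succ_top hn]
    have := ih fun i hi hi' => h i hi (by omega)
    linarith [h n hn (by omega)]

theorem sum_Ico_sub_eq {F : ℕ → ℝ} {k m : ℕ} (hkm : k ≤ m) :
    ∑ i ∈ Finset.Ico k m, (F (i + 1) - F i) = F m - F k := by
  refine le_antisymm (sum_Ico_le_sub_of_le hkm fun i _ _ => le_rfl) ?_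
  have := sum_Ico_le_sub_of_le (f := fun i => -(F (i + 1) - F i)) (F := fun i => - F i) hkm
    fun i _ _ => by linarith
  rw [Finset.sum_neg_distrib] at this
  linarith

theorem rpow_le_two_rpow_mul {s T p : ℝ} (hT : 0 < T) (h1 : T / 2 ≤ s) (h2 : s ≤ T) :
    s ^ p ≤ 2 ^ |p| * T ^ p := by
  rcases le_total 0 p with hp | hp
  · have h3 : s ^ p ≤ T ^ p := rpow_le_rpow (by linarith) h2 hp
    have h4 : (1 : ℝ) ≤ 2 ^ |p| := one_le_rpow (by norm_num) (abs_nonneg p)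
    nlinarith [rpow_pos_of_pos hT p]
  · have h3 : s ^ p ≤ (T / 2) ^ p := rpow_le_rpow_of_nonpos (by linarith) h1 hp
    rw [abs_of_nonpos hp, rpow_neg (by norm_num)]
    rw [div_rpow hT.le (by norm_num)] at h3
    rwa [mul_comm, ← div_eq_mul_inv]

namespace GradedMesh

variable {r c0 C0 : ℝ} {M : ℕ} {t : ℕ → ℝ}

theorem sum_rpow_le_of_one_lt (h : GradedMesh r c0 C0 M t) {κ : ℝ} (hκ : 1 < κ) {k m : ℕ}
    (hk : 1 ≤ k) (hkm : k ≤ m) (hm : m ≤ M) :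
    ∑ i ∈ Finset.Ico k m, (t (i + 1) - t i) * t (i + 1) ^ (-κ) ≤
      (t k ^ (1 - κ) - t m ^ (1 - κ)) / (κ - 1) := by
  have := sum_Ico_le_sub_of_le (f := fun i => (t (i + 1) - t i) * t (i + 1) ^ (-κ))
    (F := fun i => - (t i ^ (1 - κ) / (κ - 1))) hkm ?_
  · refine this.trans (le_of_eq ?_); ring
  · intro i hi him
    have h1 := rpow_neg_tangent (p := κ - 1) (by linarith)
      (h.pos (show 1 ≤ i + 1 by omega) (by omega)) (h.pos (hk.trans hi) (by omega))
    rw [show -(κ - 1) - 1 = -κ by ring, show -(κ - 1) = 1 - κ by ring] at h1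
    have h2 : 0 < κ - 1 := by linarith
    rw [show -(t (i + 1) ^ (1 - κ) / (κ - 1)) - -(t i ^ (1 - κ) / (κ - 1))
      = (t i ^ (1 - κ) - t (i + 1) ^ (1 - κ)) / (κ - 1) by ring, le_div_iff₀ h2]
    linarith

theorem sum_inv_le_log (h : GradedMesh r c0 C0 M t) {k m : ℕ}
    (hk : 1 ≤ k) (hkm : k ≤ m) (hm : m ≤ M) :
    ∑ i ∈ Finset.Ico k m, (t (i + 1) - t i) * t (i + 1) ^ (-1 : ℝ) ≤
      Real.log (t m / t k) := by
  have := sum_Ico_le_sub_of_le (f := fun i => (t (i + 1) - t i) * t (i + 1) ^ (-1 : ℝ))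
    (F := fun i => Real.log (t i)) hkm ?_
  · rwa [Real.log_div (h.pos (hk.trans hkm) hm).ne' (h.pos hk (hkm.trans hm)).ne']
  · intro i hi him
    have h1 := h.pos (show 1 ≤ i + 1 by omega) (show i + 1 ≤ M by omega)
    have h2 := h.pos (hk.trans hi) (show i ≤ M by omega)
    have h3 := Real.log_le_sub_one_of_pos (div_pos h2 h1)
    rw [Real.log_div h2.ne' h1.ne'] at h3
    rw [rpow_neg_one]
    have : (t (i + 1) - t i) * (t (i + 1))⁻¹ = 1 - t i / t (i + 1) := by field_simp
    linarith

theorem sum_rpow_le_of_lt_one (h : GradedMesh r c0 C0 M t) {κ : ℝ} (hκ : κ < 1) {k m : ℕ}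
    (hkm : k ≤ m) (hm : m ≤ M) :
    ∑ i ∈ Finset.Ico k m, (t (i + 1) - t i) * t (i + 1) ^ (-κ) ≤
      (1 + 1 / (1 - κ)) * t m ^ (1 - κ) := by
  rcases Nat.eq_zero_or_pos m with rfl | hm0
  · simp only [Finset.Ico_eq_empty_of_le (Nat.zero_le k), Finset.sum_empty]
    have := rpow_nonneg h.zero.symm.le (1 - κ)
    have : 0 < 1 - κ := by linarith
    positivity
  have htm := h.pos hm0 hm
  have h1κ : 0 < 1 - κ := by linarith
  have hp := rpow_pos_of_pos htm (1 - κ)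
  rcases le_total 0 κ with h0 | h0
  · have := sum_Ico_le_sub_of_le (f := fun i => (t (i + 1) - t i) * t (i + 1) ^ (-κ))
      (F := fun i => t i ^ (1 - κ) / (1 - κ)) hkm ?_
    · refine this.trans ?_
      have h2 : 0 ≤ t k ^ (1 - κ) / (1 - κ) := div_nonneg
        (rpow_nonneg (h.nonneg (hkm.trans hm)) _) h1κ.le
      rw [add_mul, one_div_mul_eq_div]; linarith
    · intro i hi him
      have h1 := rpow_pos_tangent (β := 1 - κ) (by linarith) (by linarith)
        (h.pos (show 1 ≤ i + 1 by omega) (by omega)) (h.nonneg (show i ≤ M by omega))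
      rw [show 1 - κ - 1 = -κ by ring] at h1
      rw [← sub_div, le_div_iff₀ h1κ]
      linarith
  · have := sum_Ico_le_sub_of_le (f := fun i => (t (i + 1) - t i) * t (i + 1) ^ (-κ))
      (F := fun i => t i * t m ^ (-κ)) hkm ?_
    · refine this.trans ?_
      have h2 : t m * t m ^ (-κ) = t m ^ (1 - κ) := by
        rw [mul_comm, ← rpow_add_one htm.ne']; ring_nf
      have h3 : 0 ≤ t k * t m ^ (-κ) :=
        mul_nonneg (h.nonneg (hkm.trans hm)) (rpow_nonneg htm.le _)
      rw [h2, add_mul]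
      have : 0 < 1 / (1 - κ) * t m ^ (1 - κ) := by positivity
      linarith
    · intro i hi him
      rw [← sub_mul]
      refine mul_le_mul_of_nonneg_left ?_ (by linarith [h.lt_succ i (by omega)])
      exact rpow_le_rpow (h.nonneg (by omega)) (h.le_of_le (by omega) hm) (by linarith)

theorem sum_kernel_le (h : GradedMesh r c0 C0 M t) {α : ℝ} (hα0 : 0 < α) {k n : ℕ}
    (hkn : k ≤ n) (hn : n < M) :
    ∑ i ∈ Finset.Ico k n, (t (i + 1) - t i) * (t (n + 1) - t (i + 1)) ^ (-α - 1) ≤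
      (1 + C0 / c0) ^ (α + 1) / α * (t (n + 1) - t n) ^ (-α) := by
  set D := 1 + C0 / c0 with hD
  have hD0 : 0 < D := by have := div_pos h.C0_pos h.c0_pos; positivity
  have := sum_Ico_le_sub_of_le
    (f := fun i => (t (i + 1) - t i) * (t (n + 1) - t (i + 1)) ^ (-α - 1))
    (F := fun i => D ^ (α + 1) / α * (t (n + 1) - t i) ^ (-α)) hkn ?_
  · refine this.trans ?_
    have h2 : 0 ≤ D ^ (α + 1) / α * (t (n + 1) - t k) ^ (-α) := by
      have := rpow_nonneg (show 0 ≤ t (n + 1) - t k by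
        linarith [h.le_of_le (show k ≤ n + 1 by omega) hn]) (-α)
      positivity
    linarith
  · intro i hi him
    have hy : 0 < t (n + 1) - t (i + 1) := by
      linarith [h.lt_of_lt (show i + 1 < n + 1 by omega) hn]
    have hx : 0 < t (n + 1) - t i := by
      linarith [h.lt_of_lt (show i < n + 1 by omega) hn]
    have h1 := rpow_neg_tangent (p := α) hα0.le hx hy
    have h2 : (t (n + 1) - t (i + 1)) ^ (-α - 1) ≤ D ^ (α + 1) * (t (n + 1) - t i) ^ (-α - 1) := by
      have h3 : ((t (n + 1) - t i) / D) ≤ t (n + 1) - t (i + 1) := by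
        rw [div_le_iff₀ hD0, mul_comm]; exact h.sub_le_sub_succ him hn
      have h4 := rpow_le_rpow_of_nonpos (by positivity) h3 (show -α - 1 ≤ 0 by linarith)
      refine h4.trans (le_of_eq ?_)
      rw [div_rpow hx.le hD0.le, show -α - 1 = -(α + 1) by ring, rpow_neg hD0.le]
      field_simp
    have hstep : 0 < t (i + 1) - t i := by linarith [h.lt_succ i (by omega)]
    calc _ ≤ (t (i + 1) - t i) * (D ^ (α + 1) * (t (n + 1) - t i) ^ (-α - 1)) := by gcongr
      _ = D ^ (α + 1) / α * (α * (t (n + 1) - t i - (t (n + 1) - t (i + 1)))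
          * (t (n + 1) - t i) ^ (-α - 1)) := by field_simp; ring
      _ ≤ D ^ (α + 1) / α * ((t (n + 1) - t (i + 1)) ^ (-α) - (t (n + 1) - t i) ^ (-α)) := by
          gcongr
      _ = _ := by ring

theorem sum_weighted_kernel_le (h : GradedMesh r c0 C0 M t) {α : ℝ} (hα0 : 0 < α) (κ : ℝ)
    {k n : ℕ} (hkn : k ≤ n) (hn : n < M) :
    ∑ i ∈ Finset.Ico k n,
        (t (i + 1) - t i) * t (i + 1) ^ (-κ) * (t (n + 1) - t (i + 1)) ^ (-α - 1) ≤
      2 ^ (α + 1) * (t (n + 1) ^ (-α - 1)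
        * ∑ i ∈ Finset.Ico k n, (t (i + 1) - t i) * t (i + 1) ^ (-κ)) +
      2 ^ |κ| * ((1 + C0 / c0) ^ (α + 1) / α) * (t (n + 1) ^ (-κ) * (t (n + 1) - t n) ^ (-α)) := by
  have hm := h.pos (show 1 ≤ n + 1 by omega) hn
  have key : ∀ i ∈ Finset.Ico k n,
      (t (i + 1) - t i) * t (i + 1) ^ (-κ) * (t (n + 1) - t (i + 1)) ^ (-α - 1) ≤
      2 ^ (α + 1) * t (n + 1) ^ (-α - 1) * ((t (i + 1) - t i) * t (i + 1) ^ (-κ)) +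
      2 ^ |κ| * t (n + 1) ^ (-κ)
        * ((t (i + 1) - t i) * (t (n + 1) - t (i + 1)) ^ (-α - 1)) := by
    intro i hi
    rw [Finset.mem_Ico] at hi
    have h1 : 0 < t (i + 1) - t i := by linarith [h.lt_succ i (by omega)]
    have h2 := h.pos (show 1 ≤ i + 1 by omega) (show i + 1 ≤ M by omega)
    have hy : 0 < t (n + 1) - t (i + 1) := by
      linarith [h.lt_of_lt (show i + 1 < n + 1 by omega) hn]
    have p1 := rpow_pos_of_pos h2 (-κ)
    have p2 := rpow_pos_of_pos hy (-α - 1)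
    have p3 := rpow_pos_of_pos hm (-α - 1)
    have p4 := rpow_pos_of_pos hm (-κ)
    rcases le_total (t (i + 1)) (t (n + 1) / 2) with h3 | h3
    · have h4 : (t (n + 1) - t (i + 1)) ^ (-α - 1) ≤ 2 ^ (α + 1) * t (n + 1) ^ (-α - 1) := by
        have := rpow_le_two_rpow_mul (p := -α - 1) hm
          (show t (n + 1) / 2 ≤ t (n + 1) - t (i + 1) by linarith) (by linarith)
        rwa [abs_of_nonpos (by linarith), show -(-α - 1) = α + 1 by ring] at this
      have h5 : 0 ≤ 2 ^ |κ| * t (n + 1) ^ (-κ)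
        * ((t (i + 1) - t i) * (t (n + 1) - t (i + 1)) ^ (-α - 1)) := by positivity
      have h6 := mul_le_mul_of_nonneg_left h4 (mul_pos h1 p1).le
      linarith
    · have h4 : t (i + 1) ^ (-κ) ≤ 2 ^ |κ| * t (n + 1) ^ (-κ) := by
        have := rpow_le_two_rpow_mul (p := -κ) hm h3 (by linarith)
        rwa [abs_neg] at this
      have h5 : 0 ≤ 2 ^ (α + 1) * t (n + 1) ^ (-α - 1)
        * ((t (i + 1) - t i) * t (i + 1) ^ (-κ)) := by positivity
      have h6 := mul_le_mul_of_nonneg_left h4 (mul_pos h1 p2).le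
      linarith
  refine (Finset.sum_le_sum key).trans ?_
  rw [Finset.sum_add_distrib, ← Finset.mul_sum, ← Finset.mul_sum]
  have := h.sum_kernel_le hα0 hkn hn
  have p4 : 0 < 2 ^ |κ| * t (n + 1) ^ (-κ) := by
    have := rpow_pos_of_pos hm (-κ); positivity
  have := mul_le_mul_of_nonneg_left this p4.le
  linarith

end GradedMesh

/-- The L1 operator without its Gamma factor, indexed by mesh intervals. -/
noncomputable def l1Sum (α : ℝ) (t V : ℕ → ℝ) (m : ℕ) : ℝ :=
  ∑ i ∈ Finset.Ico 0 m, (V (i + 1) - V i) / (t (i + 1) - t i) *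
    ∫ s in (t i)..(t (i + 1)), (t m - s) ^ (-α)

theorem deltaL1_eq (α : ℝ) (t V : ℕ → ℝ) (m : ℕ) :
    deltaL1 α t V m = 1 / Real.Gamma (1 - α) * l1Sum α t V m := by
  have h : Finset.Icc 1 m = Finset.Ico (0 + 1) (m + 1) := by ext; simp
  rw [deltaL1, l1Sum, h, ← Finset.sum_Ico_add' _ 0 m 1]
  simp

theorem l1Sum_sub (α : ℝ) (t V W : ℕ → ℝ) (m : ℕ) :
    l1Sum α t (fun j => V j - W j) m = l1Sum α t V m - l1Sum α t W m := by
  simp only [l1Sum, ← Finset.sum_sub_distrib]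
  exact Finset.sum_congr rfl fun i _ => by ring

theorem l1Sum_add (α : ℝ) (t V W : ℕ → ℝ) (m : ℕ) :
    l1Sum α t (fun j => V j + W j) m = l1Sum α t V m + l1Sum α t W m := by
  simp only [l1Sum, ← Finset.sum_add_distrib]
  exact Finset.sum_congr rfl fun i _ => by ring

theorem l1Sum_const_mul (α c : ℝ) (t V : ℕ → ℝ) (m : ℕ) :
    l1Sum α t (fun j => c * V j) m = c * l1Sum α t V m := by
  simp only [l1Sum, Finset.mul_sum]
  exact Finset.sum_congr rfl fun i _ => by ring

theorem l1Sum_finset_sum {ι : Type*} (S : Finset ι) (c : ι → ℝ) (B : ι → ℕ → ℝ) (α : ℝ)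
    (t : ℕ → ℝ) (m : ℕ) :
    l1Sum α t (fun j => ∑ k ∈ S, c k * B k j) m = ∑ k ∈ S, c k * l1Sum α t (B k) m := by
  simp only [l1Sum, Finset.mul_sum]
  rw [Finset.sum_comm]
  refine Finset.sum_congr rfl fun i _ => ?_
  rw [← Finset.sum_sub_distrib, Finset.sum_div, Finset.sum_mul]
  exact Finset.sum_congr rfl fun k _ => by ring

/-- Abel summation bound behind the discrete maximum principle. -/
theorem sum_sub_mul_le {x a : ℕ → ℝ} {m : ℕ} (hx : ∀ j, j ≤ m → 0 ≤ x j)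
    (ha : ∀ i, i < m → a i ≤ a (i + 1)) (ha0 : 0 ≤ a 0) :
    ∑ i ∈ Finset.Ico 0 (m + 1), (x (i + 1) - x i) * a i ≤ a m * x (m + 1) := by
  induction m with
  | zero => simp; nlinarith [hx 0 le_rfl]
  | succ n ih =>
    rw [Finset.sum_Ico_succ_top (Nat.zero_le _)]
    have h1 := ih (fun j hj => hx j (by omega)) (fun i hi => ha i (by omega))
    nlinarith [hx (n + 1) le_rfl, ha n (by omega)]

namespace GradedMesh

variable {r c0 C0 : ℝ} {M : ℕ} {t : ℕ → ℝ}

/-- Discrete maximum principle. -/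
theorem nonneg_of_l1Sum_nonneg (h : GradedMesh r c0 C0 M t) {α : ℝ} (hα0 : 0 < α) (hα1 : α < 1)
    {x : ℕ → ℝ} (hx0 : 0 ≤ x 0) {m : ℕ} (hm : m ≤ M)
    (hx : ∀ j, 1 ≤ j → j ≤ m → 0 ≤ l1Sum α t x j) : 0 ≤ x m := by
  induction m using Nat.strong_induction_on with
  | _ m ih =>
    obtain rfl | ⟨n, rfl⟩ : m = 0 ∨ ∃ n, m = n + 1 := by
      rcases m with _ | n
      · simp
      · exact Or.inr ⟨n, rfl⟩
    · exact hx0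
    set a : ℕ → ℝ := fun i => (∫ s in (t i)..(t (i + 1)), (t (n + 1) - s) ^ (-α))
      / (t (i + 1) - t i) with ha_def
    have hge : ∀ i, i ≤ n → (t (n + 1) - t i) ^ (-α) ≤ a i := by
      intro i hi
      have h1 := h.lt_succ i (by omega)
      have h2 := kernel_integral_ge hα0 hα1 h1.le (h.le_of_le (show i + 1 ≤ n + 1 by omega) hm)
      rw [ha_def]; simp only
      rw [le_div_iff₀ (by linarith), mul_comm]; exact h2
    have hle : ∀ i, i < n → a i ≤ (t (n + 1) - t (i + 1)) ^ (-α) := by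
      intro i hi
      have h1 := h.lt_succ i (by omega)
      have h2 := kernel_integral_le hα0 hα1 h1.le (h.lt_of_lt (show i + 1 < n + 1 by omega) hm)
      rw [ha_def]; simp only
      rw [div_le_iff₀ (by linarith), mul_comm]; exact h2
    have hpos : ∀ i, i ≤ n → 0 < a i := fun i hi =>
      (rpow_pos_of_pos (by linarith [h.lt_of_lt (show i < n + 1 by omega) hm]) _).trans_le
        (hge i hi)
    have h1 := sum_sub_mul_le (x := x) (a := a) (m := n)
      (fun j hj => ih j (by omega) (by omega) fun k hk hk' => hx k hk (by omega))
      (fun i hi => (hle i hi).trans (hge (i + 1) hi)) (hpos 0 (Nat.zero_le _)).le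
    have h2 := hx (n + 1) (by omega) le_rfl
    have h3 : l1Sum α t x (n + 1) = ∑ i ∈ Finset.Ico 0 (n + 1), (x (i + 1) - x i) * a i :=
      Finset.sum_congr rfl fun i _ => by rw [ha_def]; ring
    rw [h3] at h2
    exact nonneg_of_mul_nonneg_right (h2.trans h1) (hpos n le_rfl)

theorem abs_le_of_abs_l1Sum_le (h : GradedMesh r c0 C0 M t) {α : ℝ} (hα0 : 0 < α) (hα1 : α < 1)
    {e V : ℕ → ℝ} (he : e 0 = 0) (hV : 0 ≤ V 0) {m : ℕ} (hm : m ≤ M)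
    (hle : ∀ j, 1 ≤ j → j ≤ m → |l1Sum α t e j| ≤ l1Sum α t V j) : |e m| ≤ V m := by
  rw [abs_le]
  constructor
  · have := h.nonneg_of_l1Sum_nonneg hα0 hα1 (x := fun j => V j + e j) (by simp [he, hV]) hm
      fun j hj hj' => by
        rw [l1Sum_add]; linarith [neg_le_of_abs_le (hle j hj hj')]
    linarith
  · have := h.nonneg_of_l1Sum_nonneg hα0 hα1 (x := fun j => V j - e j) (by simp [he, hV]) hm
      fun j hj hj' => by
        rw [l1Sum_sub]; linarith [le_of_abs_le (hle j hj hj')]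
    linarith

/-- Nondecreasing sequences have a large discrete derivative. -/
theorem le_l1Sum_of_monotone (h : GradedMesh r c0 C0 M t) {α : ℝ} (hα0 : 0 < α) (hα1 : α < 1)
    {V : ℕ → ℝ} {m : ℕ} (hm : m ≤ M) (hV : ∀ i, i < m → V i ≤ V (i + 1)) :
    t m ^ (-α) * (V m - V 0) ≤ l1Sum α t V m := by
  rw [← sum_Ico_sub_eq (F := V) (Nat.zero_le m), Finset.mul_sum, l1Sum]
  refine Finset.sum_le_sum fun i hi => ?_
  rw [Finset.mem_Ico] at hi
  have h1 := h.lt_succ i (by omega)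
  have h2 := kernel_integral_ge hα0 hα1 h1.le (h.le_of_le (show i + 1 ≤ m by omega) hm)
  have h3 : t m ^ (-α) ≤ (t m - t i) ^ (-α) :=
    rpow_le_rpow_of_nonpos (by linarith [h.lt_of_lt hi.2 hm])
      (by linarith [h.nonneg (show i ≤ M by omega)]) (by linarith)
  have h4 : 0 < t (i + 1) - t i := by linarith
  rw [div_mul_eq_mul_div, le_div_iff₀ h4]
  have h5 : 0 ≤ V (i + 1) - V i := by linarith [hV i hi.2]
  calc _ = (V (i + 1) - V i) * ((t (i + 1) - t i) * t m ^ (-α)) := by ring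
    _ ≤ (V (i + 1) - V i) * ((t (i + 1) - t i) * (t m - t i) ^ (-α)) := by gcongr
    _ ≤ _ := by gcongr

theorem x_pos (h : GradedMesh r c0 C0 M t) {m : ℕ} (hm : 1 ≤ m) (hM : m ≤ M) : 0 < t 1 / t m :=
  div_pos h.tau_pos (h.pos hm hM)

theorem x_le_one (h : GradedMesh r c0 C0 M t) {m : ℕ} (hm : 1 ≤ m) (hM : m ≤ M) :
    t 1 / t m ≤ 1 := (div_le_one (h.pos hm hM)).2 (h.le_of_le hm hM)

end GradedMesh

/-- Consistency error of the L1 scheme accumulated over `(t k, t (n + 1))`. -/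
theorem consistency_tail {α ν r c0 C0 : ℝ} (hα0 : 0 < α) (hα1 : α < 1) (hν : 0 ≤ ν)
    (hc : 0 < c0) (hC : 0 < C0) :
    ∃ C : ℝ, 0 < C ∧ ∀ (M : ℕ) (t : ℕ → ℝ), GradedMesh r c0 C0 M t →
      ∀ (w w' w'' : ℝ → ℝ) (K : ℝ) (k n : ℕ), 0 ≤ K → 1 ≤ k → k ≤ n → n < M →
      ContinuousOn w (Icc (t k) (t (n + 1))) →
      (∀ s ∈ Ioo (t k) (t (n + 1)), HasDerivAt w (w' s) s) →
      (∀ s ∈ Ioo (t k) (t (n + 1)), HasDerivAt w' (w'' s) s) →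
      (∀ s ∈ Ioo (t k) (t (n + 1)), |w'' s| ≤ K * s ^ (-ν)) →
      IntervalIntegrable (fun s => (t (n + 1) - s) ^ (-α) * w' s) volume (t k) (t (n + 1)) ∧
      |∑ i ∈ Finset.Ico k (n + 1), (w (t (i + 1)) - w (t i)) / (t (i + 1) - t i) *
            (∫ s in (t i)..(t (i + 1)), (t (n + 1) - s) ^ (-α))
          - ∫ s in (t k)..(t (n + 1)), (t (n + 1) - s) ^ (-α) * w' s| ≤
        C * K * (t 1 ^ (2 * (1 / r)) * t (n + 1) ^ (-α - 1) *
            ∑ i ∈ Finset.Ico k n, (t (i + 1) - t i) * t (i + 1) ^ (-(ν - 2 + 2 * (1 / r)))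
          + t (n + 1) ^ (2 - ν - α) * (t 1 / t (n + 1)) ^ ((2 - α) * (1 / r))) := by
  set ρ : ℝ := 2 ^ r * C0 / c0 with hρ
  set κ : ℝ := ν - 2 + 2 * (1 / r) with hκ
  set A1 : ℝ := ρ ^ ν * C0 ^ 2 * 2 ^ (α + 1) with hA1
  set A2 : ℝ := ρ ^ ν * C0 ^ 2 * (2 ^ |κ| * ((1 + C0 / c0) ^ (α + 1) / α)) * c0 ^ (-α) with hA2
  set A3 : ℝ := ρ ^ ν * C0 ^ (2 - α) / (1 - α) with hA3
  have h1α : 0 < 1 - α := by linarith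
  have hρ0 : 0 < ρ := by positivity
  have hA1p : 0 < A1 := by positivity
  have hA2p : 0 < A2 := by positivity
  have hA3p : 0 < A3 := by positivity
  refine ⟨A1 + A2 + A3, by positivity, ?_⟩
  intro M t h w w' w'' K k n hK hk hkn hn hw h1 h2 h3
  have hm := h.pos (show 1 ≤ n + 1 by omega) hn
  set m := n + 1 with hmdef
  have hx := h.x_pos (show 1 ≤ m by omega) hn
  have hloc : ∀ i, k ≤ i → i ≤ n → _ := fun i hki hin =>
    local_consistency (α := α) (t := t m) (a := t i) (b := t (i + 1))
      (L := K * (ρ ^ ν * t (i + 1) ^ (-ν))) (w := w) (w' := w') (w'' := w'') hα0 hα1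
      (h.lt_succ i (by omega))
      (hw.mono (Icc_subset_Icc (h.le_of_le hki (by omega)) (h.le_of_le (by omega) hn)))
      (fun s hs => h1 s ⟨(h.le_of_le hki (by omega)).trans_lt hs.1,
        hs.2.trans_le (h.le_of_le (by omega) hn)⟩)
      (fun s hs => h2 s ⟨(h.le_of_le hki (by omega)).trans_lt hs.1,
        hs.2.trans_le (h.le_of_le (by omega) hn)⟩)
      (fun s hs => by
        refine (h3 s ⟨(h.le_of_le hki (by omega)).trans_lt hs.1,
          hs.2.trans_le (h.le_of_le (by omega) hn)⟩).trans (mul_le_mul_of_nonneg_left ?_ hK)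
        have hti := h.pos (show 1 ≤ i by omega) (show i ≤ M by omega)
        have hti' := h.pos (show 1 ≤ i + 1 by omega) (show i + 1 ≤ M by omega)
        have e1 : t (i + 1) / ρ ≤ s := by
          rw [div_le_iff₀ hρ0, mul_comm]
          have := h.ratio (show 1 ≤ i by omega) (show i < M by omega)
          rw [← hρ] at this
          nlinarith [hs.1]
        refine (rpow_le_rpow_of_nonpos (by positivity) e1 (by linarith)).trans (le_of_eq ?_)
        rw [div_rpow hti'.le hρ0.le, rpow_neg hρ0.le, div_inv_eq_mul, mul_comm])
  have hint : ∀ i ∈ Ico k m,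
      IntervalIntegrable (fun s => (t m - s) ^ (-α) * w' s) volume (t i) (t (i + 1)) :=
    fun i hi => (hloc i hi.1 (by have := hi.2; omega)).1
  refine ⟨IntervalIntegrable.trans_iterate_Ico (by omega) hint, ?_⟩
  rw [← intervalIntegral.sum_integral_adjacent_intervals_Ico (show k ≤ m by omega) hint,
    ← Finset.sum_sub_distrib]
  refine (Finset.abs_sum_le_sum_abs _ _).trans ?_
  rw [hmdef, Finset.sum_Ico_succ_top hkn, ← hmdef]
  have hlast := (hloc n hkn le_rfl).2.2 rfl
  have hfar : ∑ i ∈ Finset.Ico k n, |(w (t (i + 1)) - w (t i)) / (t (i + 1) - t i) *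
            (∫ s in (t i)..(t (i + 1)), (t m - s) ^ (-α))
          - ∫ s in (t i)..(t (i + 1)), (t m - s) ^ (-α) * w' s| ≤
      K * ρ ^ ν * C0 ^ 2 * t 1 ^ (2 * (1 / r)) * ∑ i ∈ Finset.Ico k n,
        (t (i + 1) - t i) * t (i + 1) ^ (-κ) * (t m - t (i + 1)) ^ (-α - 1) := by
    rw [Finset.mul_sum]
    refine Finset.sum_le_sum fun i hi => ?_
    rw [Finset.mem_Ico] at hi
    refine ((hloc i hi.1 hi.2.le).2.1 (h.lt_of_lt (by omega) hn)).trans ?_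
    have hti' := h.pos (show 1 ≤ i + 1 by omega) (show i + 1 ≤ M by omega)
    have hst : 0 < t (i + 1) - t i := by linarith [h.lt_succ i (by omega)]
    have hx' := h.x_pos (show 1 ≤ i + 1 by omega) (show i + 1 ≤ M by omega)
    have hsq : (t (i + 1) - t i) ^ 2 ≤ (C0 * (t (i + 1) * (t 1 / t (i + 1)) ^ (1 / r))) ^ 2 :=
      pow_le_pow_left₀ hst.le (h.step_le i (by omega)) 2
    have hsq' : (C0 * (t (i + 1) * (t 1 / t (i + 1)) ^ (1 / r))) ^ 2 * t (i + 1) ^ (-ν)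
        = C0 ^ 2 * t 1 ^ (2 * (1 / r)) * t (i + 1) ^ (-κ) := by
      have e1 : ((t 1 / t (i + 1)) ^ (1 / r)) ^ 2 = t 1 ^ (2 * (1 / r)) / t (i + 1) ^ (2 * (1 / r)) := by
        rw [← rpow_natCast, ← rpow_mul hx'.le, ← div_rpow h.tau_pos.le hti'.le]
        congr 1; push_cast; ring
      have e2 : t (i + 1) ^ (-κ) = t (i + 1) ^ 2 * t (i + 1) ^ (-ν) / t (i + 1) ^ (2 * (1 / r)) := by
        rw [← rpow_natCast, ← rpow_add hti', ← rpow_sub hti']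
        congr 1; rw [hκ]; push_cast; ring
      rw [mul_pow, mul_pow, e1, e2]; ring
    have hker : 0 < (t m - t (i + 1)) ^ (-α - 1) :=
      rpow_pos_of_pos (by linarith [h.lt_of_lt (show i + 1 < m by omega) hn]) _
    have hp := rpow_pos_of_pos hti' (-ν)
    calc K * (ρ ^ ν * t (i + 1) ^ (-ν)) * (t (i + 1) - t i) ^ 3 * (t m - t (i + 1)) ^ (-α - 1)
        = K * ρ ^ ν * (t (i + 1) - t i) * (t m - t (i + 1)) ^ (-α - 1)
            * ((t (i + 1) - t i) ^ 2 * t (i + 1) ^ (-ν)) := by ring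
      _ ≤ K * ρ ^ ν * (t (i + 1) - t i) * (t m - t (i + 1)) ^ (-α - 1)
            * ((C0 * (t (i + 1) * (t 1 / t (i + 1)) ^ (1 / r))) ^ 2 * t (i + 1) ^ (-ν)) := by
          gcongr
      _ = _ := by rw [hsq']; ring
  have hsplit := h.sum_weighted_kernel_le hα0 κ hkn hn
  rw [← hmdef] at hsplit
  set S := ∑ i ∈ Finset.Ico k n, (t (i + 1) - t i) * t (i + 1) ^ (-κ) with hS
  have hS0 : 0 ≤ S := Finset.sum_nonneg fun i hi => by
    rw [Finset.mem_Ico] at hi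
    have := rpow_pos_of_pos (h.pos (show 1 ≤ i + 1 by omega) (show i + 1 ≤ M by omega)) (-κ)
    exact mul_nonneg (by linarith [h.lt_succ i (by omega)]) this.le
  have hstn : 0 < t m - t n := by linarith [h.lt_succ n (by omega)]
  have hθ : (t m - t n) ^ (-α) ≤ c0 ^ (-α) * (t m ^ (-α) * (t 1 / t m) ^ (-(α * (1 / r)))) := by
    have h5 := rpow_le_rpow_of_nonpos (by positivity) (h.step_ge n hn) (show -α ≤ 0 by linarith)
    rw [mul_rpow hc.le (by positivity), mul_rpow hm.le (by positivity), ← rpow_mul hx.le] at h5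
    refine h5.trans (le_of_eq ?_)
    rw [show 1 / r * -α = -(α * (1 / r)) by ring]
  have hθ2 : (t m - t n) ^ (2 - α) ≤
      C0 ^ (2 - α) * (t m ^ (2 - α) * (t 1 / t m) ^ ((2 - α) * (1 / r))) := by
    have h5 := rpow_le_rpow hstn.le (h.step_le n hn) (show 0 ≤ 2 - α by linarith)
    rw [mul_rpow hC.le (by positivity), mul_rpow hm.le (by positivity), ← rpow_mul hx.le] at h5
    refine h5.trans (le_of_eq ?_)
    rw [show 1 / r * (2 - α) = (2 - α) * (1 / r) by ring]
  set X := t m ^ (2 - ν - α) * (t 1 / t m) ^ ((2 - α) * (1 / r)) with hX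
  have hX0 : 0 < X := by positivity
  have hnear : t 1 ^ (2 * (1 / r)) * (t m ^ (-κ) * (t m - t n) ^ (-α)) ≤ c0 ^ (-α) * X := by
    have ht1 := rpow_pos_of_pos h.tau_pos (2 * (1 / r))
    have e1 : t 1 ^ (2 * (1 / r)) = t m ^ (2 * (1 / r)) * (t 1 / t m) ^ (2 * (1 / r)) := by
      rw [← mul_rpow hm.le hx.le]; congr 1; field_simp
    have e2 : X = t m ^ (2 * (1 / r)) * (t 1 / t m) ^ (2 * (1 / r)) *
        (t m ^ (-κ) * (t m ^ (-α) * (t 1 / t m) ^ (-(α * (1 / r))))) := by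
      have e3 : t m ^ (2 - ν - α) = t m ^ (2 * (1 / r)) * t m ^ (-κ) * t m ^ (-α) := by
        rw [← rpow_add hm, ← rpow_add hm]; congr 1; rw [hκ]; ring
      have e4 : (t 1 / t m) ^ ((2 - α) * (1 / r))
          = (t 1 / t m) ^ (2 * (1 / r)) * (t 1 / t m) ^ (-(α * (1 / r))) := by
        rw [← rpow_add hx]; congr 1; ring
      rw [hX, e3, e4]; ring
    calc _ ≤ t 1 ^ (2 * (1 / r)) * (t m ^ (-κ) *
          (c0 ^ (-α) * (t m ^ (-α) * (t 1 / t m) ^ (-(α * (1 / r)))))) := by gcongr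
      _ = c0 ^ (-α) * X := by rw [e2, e1]; ring
  have hlast' : |(w (t (n + 1)) - w (t n)) / (t (n + 1) - t n) *
            (∫ s in (t n)..(t (n + 1)), (t m - s) ^ (-α))
          - ∫ s in (t n)..(t (n + 1)), (t m - s) ^ (-α) * w' s| ≤ K * A3 * X := by
    refine hlast.trans ?_
    rw [← hmdef]
    have e3 : t m ^ (2 - ν - α) = t m ^ (-ν) * t m ^ (2 - α) := by
      rw [← rpow_add hm]; congr 1; ring
    calc _ ≤ K * (ρ ^ ν * t m ^ (-ν)) *
          (C0 ^ (2 - α) * (t m ^ (2 - α) * (t 1 / t m) ^ ((2 - α) * (1 / r)))) / (1 - α) := by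
          gcongr
      _ = K * A3 * X := by rw [hA3, hX, e3]; ring
  have ht1 := rpow_pos_of_pos h.tau_pos (2 * (1 / r))
  set Y := t 1 ^ (2 * (1 / r)) * t m ^ (-α - 1) * S with hY
  have hY0 : 0 ≤ Y := by positivity
  have hfar' : K * ρ ^ ν * C0 ^ 2 * t 1 ^ (2 * (1 / r)) * ∑ i ∈ Finset.Ico k n,
        (t (i + 1) - t i) * t (i + 1) ^ (-κ) * (t m - t (i + 1)) ^ (-α - 1) ≤
      K * (A1 * Y + A2 * X) := by
    calc _ ≤ K * ρ ^ ν * C0 ^ 2 * t 1 ^ (2 * (1 / r)) * _ :=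
          mul_le_mul_of_nonneg_left hsplit (by positivity)
      _ = K * (A1 * Y + ρ ^ ν * C0 ^ 2 * (2 ^ |κ| * ((1 + C0 / c0) ^ (α + 1) / α)) *
          (t 1 ^ (2 * (1 / r)) * (t m ^ (-κ) * (t m - t n) ^ (-α)))) := by
          rw [hA1, hY]; ring
      _ ≤ K * (A1 * Y + ρ ^ ν * C0 ^ 2 * (2 ^ |κ| * ((1 + C0 / c0) ^ (α + 1) / α)) *
          (c0 ^ (-α) * X)) := by gcongr
      _ = _ := by rw [hA2]; ring
  have hfin : (A1 + A2 + A3) * K * (Y + X)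
      = K * (A1 * Y + A2 * X) + K * A3 * X + K * ((A2 + A3) * Y + A1 * X) := by ring
  have : 0 ≤ K * ((A2 + A3) * Y + A1 * X) := by positivity
  linarith

/-- Lower bound for the fractional derivative of `s ↦ min (σ ^ (α - 2) * s) (s ^ (α - 1))`. -/
theorem continuous_barrier_lower {α σ T : ℝ} (hα0 : 0 < α) (hα1 : α < 1) (hσ : 0 < σ)
    (hσT : σ < T) :
    (1 - α) * σ ^ α * T ^ (-α - 1) ≤ σ ^ (α - 2) * (∫ s in (0:ℝ)..σ, (T - s) ^ (-α)) +
      ∫ s in σ..T, (T - s) ^ (-α) * ((α - 1) * s ^ (α - 2)) := by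
  have hT : 0 < T := hσ.trans hσT
  have hβ : 0 < 1 - α := by linarith
  have hint : IntervalIntegrable (fun s => (T - s) ^ (-α) * ((α - 1) * s ^ (α - 2))) volume σ T := by
    refine (kernel_intervalIntegrable hα1 T σ T).mul_continuousOn ?_
    rw [uIcc_of_le hσT.le]
    exact continuousOn_const.mul (continuousOn_id.rpow_const fun s hs =>
      Or.inl (hσ.trans_le hs.1).ne')
  have hsecond : ∫ s in σ..T, (T - s) ^ (-α) * ((α - 1) * s ^ (α - 2))
      = 1 / T * ((T - T) / T) ^ (1 - α) - 1 / T * ((T - σ) / σ) ^ (1 - α) := by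
    refine intervalIntegral.integral_eq_sub_of_hasDerivAt_of_le
      (f := fun s => 1 / T * ((T - s) / s) ^ (1 - α)) hσT.le ?_ ?_ hint
    · refine continuousOn_const.mul (ContinuousOn.rpow_const ?_ fun s hs => Or.inr hβ.le)
      exact (continuousOn_const.sub continuousOn_id).div continuousOn_id
        fun s hs => (hσ.trans_le hs.1).ne'
    · intro s hs
      have hs0 : 0 < s := hσ.trans hs.1
      have hTs : 0 < T - s := by linarith [hs.2]
      have hd : HasDerivAt (fun s : ℝ => (T - s) / s) ((-1 * s - (T - s) * 1) / s ^ 2) s :=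
        ((hasDerivAt_id s).const_sub T).div (hasDerivAt_id s) hs0.ne'
      have := ((hd.rpow_const (p := 1 - α) (Or.inl (by positivity))).const_mul (1 / T))
      refine this.congr_deriv ?_
      rw [show 1 - α - 1 = -α by ring, div_rpow hTs.le hs0.le, rpow_neg hs0.le,
        rpow_sub hs0, rpow_two]
      field_simp
      ring
  rw [hsecond, kernel_integral hα1, sub_self, zero_div, zero_rpow hβ.ne', sub_zero]
  set x := σ / T with hx
  have hx0 : 0 < x := by positivity
  have hx1 : x < 1 := (div_lt_one hT).2 hσT
  set z := (1 - x) ^ (1 - α) with hz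
  have hTσ : (T - σ) ^ (1 - α) = T ^ (1 - α) * z := by
    rw [hz, ← mul_rpow hT.le (by linarith)]; congr 1; rw [hx]; field_simp
  have hzle : z ≤ 1 - (1 - α) * x := by
    have := rpow_pos_tangent (β := 1 - α) (x := 1) (y := 1 - x) hβ.le (by linarith) one_pos
      (by linarith)
    rw [one_rpow, one_rpow] at this
    linarith
  have hz0 : 0 ≤ z := rpow_nonneg (by linarith) _
  rw [div_rpow (by linarith) hσ.le, hTσ]
  have e1 : σ ^ α = σ ^ (α - 2) * σ ^ 2 := by rw [← rpow_natCast, ← rpow_add hσ]; norm_num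
  have e2 : σ ^ (1 - α) = (σ ^ (α - 2) * σ)⁻¹ := by
    rw [← rpow_add_one hσ.ne', ← rpow_neg hσ.le]; congr 1; ring
  have e3 : T ^ (-α - 1) = T ^ (1 - α) / T ^ 2 := by
    rw [← rpow_natCast, ← rpow_sub hT]; congr 1; push_cast; ring
  have p1 := rpow_pos_of_pos hσ (α - 2)
  have p2 := rpow_pos_of_pos hT (1 - α)
  have key : (1 - α) * x ^ 2 ≤ (1 - z) / (1 - α) - x * z := by
    have h1 : x ≤ (1 - z) / (1 - α) := by rw [le_div_iff₀ hβ]; linarith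
    nlinarith
  have e4 : (1 - α) * σ ^ α * T ^ (-α - 1)
      = σ ^ (α - 2) * T ^ (1 - α) * ((1 - α) * x ^ 2) := by
    rw [e1, e3, hx]; field_simp
  have e5 : σ ^ (α - 2) * ((T ^ (1 - α) - T ^ (1 - α) * z) / (1 - α)) +
      (0 - 1 / T * (T ^ (1 - α) * z / σ ^ (1 - α)))
      = σ ^ (α - 2) * T ^ (1 - α) * ((1 - z) / (1 - α) - x * z) := by
    rw [e2, hx]; field_simp; ring
  have := mul_le_mul_of_nonneg_left key (mul_pos p1 p2).le
  rw [mul_zero, e4, e5]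
  exact this

/-- Barrier that grows linearly up to the node `t k` and then decays like `s ^ (α - 1)`. -/
noncomputable def barrier (α : ℝ) (t : ℕ → ℝ) (k j : ℕ) : ℝ :=
  if j ≤ k then t j * t k ^ (α - 2) else t j ^ (α - 1)

theorem barrier_of_le {α : ℝ} {t : ℕ → ℝ} {k j : ℕ} (hjk : j ≤ k) :
    barrier α t k j = t j * t k ^ (α - 2) := if_pos hjk

theorem barrier_of_ge {α : ℝ} {t : ℕ → ℝ} {k j : ℕ} (hkj : k ≤ j) (hk : 0 < t k) :
    barrier α t k j = t j ^ (α - 1) := by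
  rcases hkj.eq_or_lt with rfl | hlt
  · rw [barrier_of_le le_rfl, mul_comm, ← rpow_add_one hk.ne']; congr 1; ring
  · exact if_neg (by omega)

namespace GradedMesh

variable {r c0 C0 : ℝ} {M : ℕ} {t : ℕ → ℝ}

theorem l1Sum_barrier_of_le (h : GradedMesh r c0 C0 M t) {α : ℝ} (hα0 : 0 < α) (hα1 : α < 1)
    {k m : ℕ} (hm : 1 ≤ m) (hmk : m ≤ k) (hk : k ≤ M) :
    t m ^ (1 - α) * t k ^ (α - 2) ≤ l1Sum α t (barrier α t k) m := by
  have htk := h.pos (hm.trans hmk) hk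
  have htm := h.pos hm (hmk.trans hk)
  have hp := rpow_pos_of_pos htk (α - 2)
  have := h.le_l1Sum_of_monotone hα0 hα1 (V := barrier α t k) (hmk.trans hk) fun i hi => by
    rw [barrier_of_le (by omega), barrier_of_le (by omega)]
    exact mul_le_mul_of_nonneg_right (h.lt_succ i (by omega)).le hp.le
  rw [barrier_of_le hmk, barrier_of_le (Nat.zero_le _), h.zero] at this
  refine le_trans (le_of_eq ?_) this
  rw [sub_eq_neg_add 1 α, rpow_add_one htm.ne']; ring

theorem index_ge_linear (h : GradedMesh r c0 C0 M t) {k : ℕ} (hk : 1 ≤ k) (hkM : k ≤ M) :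
    c0 * (t 1 * k) ≤ t k := by
  refine le_trans ?_ (h.index_ge k hk hkM)
  have h1 : (k : ℝ) ≤ (k : ℝ) ^ r := by
    have : (k : ℝ) ^ (1 : ℝ) ≤ (k : ℝ) ^ r :=
      rpow_le_rpow_of_exponent_le (by exact_mod_cast hk) h.r_ge
    rwa [rpow_one] at this
  have := h.c0_pos
  have := h.tau_pos
  gcongr

end GradedMesh

theorem l1Sum_barrier_lower {α r c0 C0 : ℝ} (hα0 : 0 < α) (hα1 : α < 1) (hr : 1 ≤ r)
    (hαr : α ≤ (2 - α) * (1 / r)) (hc : 0 < c0) (hC : 0 < C0) :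
    ∃ N : ℕ, 1 ≤ N ∧ ∀ (M : ℕ) (t : ℕ → ℝ), GradedMesh r c0 C0 M t →
      ∀ k m : ℕ, N ≤ k → k ≤ m → m ≤ M →
      (1 - α) / 2 * (t k ^ α * t m ^ (-α - 1)) ≤ l1Sum α t (barrier α t k) m := by
  obtain ⟨C, hCpos, hcons⟩ := consistency_tail (α := α) (ν := 3 - α) (r := r) hα0 hα1
    (by linarith) hc hC
  have hrinv : 0 < 1 / r := by positivity
  have hδ : 0 < 2 * (1 / r) - α := by nlinarith
  set E := C * 2 * (1 / (2 * (1 / r) - α) + 1) with hE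
  have hE0 : 0 < E := by positivity
  have hβ : 0 < 1 - α := by linarith
  set ε := (1 - α) / 2 / E with hε
  have hε0 : 0 < ε := by positivity
  have hε1 : 0 < ε ^ (1 / α) := by positivity
  obtain ⟨N, hN⟩ := exists_nat_ge (1 / (c0 * ε ^ (1 / α)))
  refine ⟨N + 1, by omega, ?_⟩
  intro M t h k m hk hkm hmM
  have htk := h.pos (show 1 ≤ k by omega) (show k ≤ M by omega)
  have htm := h.pos (show 1 ≤ m by omega) hmM
  rcases hkm.eq_or_lt with rfl | hlt
  · refine le_trans ?_ (h.l1Sum_barrier_of_le hα0 hα1 (by omega) le_rfl hmM)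
    rw [← rpow_add htk, ← rpow_add htk]
    have e1 : α + (-α - 1) = 1 - α + (α - 2) := by ring
    rw [e1]
    have := rpow_pos_of_pos htk (1 - α + (α - 2))
    nlinarith
  obtain ⟨n, rfl⟩ : ∃ n, m = n + 1 := ⟨m - 1, by omega⟩
  have hbase : ∀ s ∈ Ioo (t k) (t (n + 1)), 0 < s := fun s hs => htk.trans hs.1
  obtain ⟨-, herr⟩ := hcons M t h (fun s => s ^ (α - 1)) (fun s => (α - 1) * s ^ (α - 2))
    (fun s => (α - 1) * ((α - 2) * s ^ (α - 3))) 2 k n (by norm_num) (by omega) (by omega)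
    (by omega)
    (continuousOn_id.rpow_const fun s hs => Or.inl (htk.trans_le hs.1).ne')
    (fun s hs => by
      have := hasDerivAt_rpow_const (p := α - 1) (Or.inl (hbase s hs).ne')
      rwa [show α - 1 - 1 = α - 2 by ring] at this)
    (fun s hs => by
      have := (hasDerivAt_rpow_const (p := α - 2) (Or.inl (hbase s hs).ne')).const_mul (α - 1)
      rwa [show α - 2 - 1 = α - 3 by ring] at this)
    (fun s hs => by
      have hp := rpow_pos_of_pos (hbase s hs) (α - 3)
      rw [abs_mul, abs_mul, abs_of_pos hp, abs_of_neg (by linarith), abs_of_neg (by linarith),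
        show -(3 - α) = α - 3 by ring, ← mul_assoc]
      exact mul_le_mul_of_nonneg_right (by nlinarith) hp.le)
  have hmain := continuous_barrier_lower hα0 hα1 htk (h.lt_of_lt hlt hmM)
  have hsplit : l1Sum α t (barrier α t k) (n + 1)
      = t k ^ (α - 2) * (∫ s in (0:ℝ)..(t k), (t (n + 1) - s) ^ (-α)) +
        ∑ i ∈ Finset.Ico k (n + 1), (t (i + 1) ^ (α - 1) - t i ^ (α - 1)) / (t (i + 1) - t i) *
            (∫ s in (t i)..(t (i + 1)), (t (n + 1) - s) ^ (-α)) := by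
    rw [l1Sum, ← Finset.sum_Ico_consecutive _ (Nat.zero_le k) hkm, ← h.zero,
      ← intervalIntegral.sum_integral_adjacent_intervals_Ico (Nat.zero_le k)
        (fun i _ => kernel_intervalIntegrable hα1 _ _ _), Finset.mul_sum]
    congr 1
    · refine Finset.sum_congr rfl fun i hi => ?_
      rw [Finset.mem_Ico] at hi
      have : t (i + 1) - t i ≠ 0 := by linarith [h.lt_succ i (by omega)]
      rw [barrier_of_le (by omega), barrier_of_le (by omega), ← sub_mul,
        mul_div_right_comm, div_self this, one_mul]
    · refine Finset.sum_congr rfl fun i hi => ?_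
      rw [Finset.mem_Ico] at hi
      rw [barrier_of_ge (by omega) htk, barrier_of_ge hi.1 htk]
  have hsum := h.sum_rpow_le_of_one_lt (κ := 3 - α - 2 + 2 * (1 / r)) (by linarith)
    (show 1 ≤ k by omega) (show k ≤ n by omega) (by omega)
  set y := t 1 / t k with hy
  have hy0 : 0 < y := h.x_pos (by omega) (by omega)
  have hy1 : y ≤ 1 := h.x_le_one (by omega) (by omega)
  have hyε : y ^ α ≤ ε := by
    have h1 : y ≤ ε ^ (1 / α) := by
      rw [hy, div_le_iff₀ htk]
      have h2 := h.index_ge_linear (show 1 ≤ k by omega) (show k ≤ M by omega)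
      have h3 : (1 / (c0 * ε ^ (1 / α))) ≤ k := hN.trans (by exact_mod_cast (by omega : N ≤ k))
      rw [div_le_iff₀ (by positivity)] at h3
      have h4 := h.tau_pos
      calc t 1 = t 1 * 1 := by ring
        _ ≤ t 1 * (k * (c0 * ε ^ (1 / α))) := by gcongr
        _ = ε ^ (1 / α) * (c0 * (t 1 * k)) := by ring
        _ ≤ _ := by gcongr
    have h2 := rpow_le_rpow hy0.le h1 hα0.le
    rwa [← rpow_mul hε0.le, one_div_mul_cancel hα0.ne', rpow_one] at h2
  set Z := t k ^ α * t (n + 1) ^ (-α - 1) with hZ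
  have hZ0 : 0 < Z := by positivity
  have hb1 : t 1 ^ (2 * (1 / r)) * t (n + 1) ^ (-α - 1) *
      ∑ i ∈ Finset.Ico k n, (t (i + 1) - t i) * t (i + 1) ^ (-(3 - α - 2 + 2 * (1 / r))) ≤
      1 / (2 * (1 / r) - α) * (y ^ α * Z) := by
    have h1 : t 1 ^ (2 * (1 / r)) * t k ^ (1 - (3 - α - 2 + 2 * (1 / r)))
        = t k ^ α * y ^ (2 * (1 / r)) := by
      rw [hy, div_rpow h.tau_pos.le htk.le,
        show 1 - (3 - α - 2 + 2 * (1 / r)) = α - 2 * (1 / r) by ring, rpow_sub htk]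
      ring
    have h2 : y ^ (2 * (1 / r)) ≤ y ^ α := rpow_le_rpow_of_exponent_ge hy0 hy1 (by linarith)
    have h3 := rpow_pos_of_pos h.tau_pos (2 * (1 / r))
    have h4 : 0 ≤ t n ^ (1 - (3 - α - 2 + 2 * (1 / r))) := rpow_nonneg (h.nonneg (by omega)) _
    rw [show 3 - α - 2 + 2 * (1 / r) - 1 = 2 * (1 / r) - α by ring] at hsum
    calc _ ≤ t 1 ^ (2 * (1 / r)) * t (n + 1) ^ (-α - 1) *
          ((t k ^ (1 - (3 - α - 2 + 2 * (1 / r)))) / (2 * (1 / r) - α)) := by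
          gcongr
          refine hsum.trans ?_
          gcongr
          linarith
      _ = 1 / (2 * (1 / r) - α) * t (n + 1) ^ (-α - 1) *
          (t 1 ^ (2 * (1 / r)) * t k ^ (1 - (3 - α - 2 + 2 * (1 / r)))) := by ring
      _ = 1 / (2 * (1 / r) - α) * (y ^ (2 * (1 / r)) * Z) := by rw [h1, hZ]; ring
      _ ≤ _ := by gcongr
  have hb2 : t (n + 1) ^ (2 - (3 - α) - α) * (t 1 / t (n + 1)) ^ ((2 - α) * (1 / r)) ≤
      y ^ α * Z := by
    have h1 : (t 1 / t (n + 1)) ^ ((2 - α) * (1 / r)) ≤ (t 1 / t (n + 1)) ^ α :=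
      rpow_le_rpow_of_exponent_ge (h.x_pos (by omega) hmM) (h.x_le_one (by omega) hmM) hαr
    refine (mul_le_mul_of_nonneg_left h1 (rpow_nonneg htm.le _)).trans (le_of_eq ?_)
    rw [hZ, hy, div_rpow h.tau_pos.le htm.le, div_rpow h.tau_pos.le htk.le,
      show 2 - (3 - α) - α = (-α - 1) + α by ring, rpow_add htm]
    have := rpow_pos_of_pos htm α
    have := rpow_pos_of_pos htk α
    field_simp
  have herr2 : C * 2 * (t 1 ^ (2 * (1 / r)) * t (n + 1) ^ (-α - 1) *
      ∑ i ∈ Finset.Ico k n, (t (i + 1) - t i) * t (i + 1) ^ (-(3 - α - 2 + 2 * (1 / r)))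
      + t (n + 1) ^ (2 - (3 - α) - α) * (t 1 / t (n + 1)) ^ ((2 - α) * (1 / r))) ≤
      (1 - α) / 2 * Z := by
    calc _ ≤ C * 2 * (1 / (2 * (1 / r) - α) * (y ^ α * Z) + y ^ α * Z) := by gcongr
      _ = E * (y ^ α * Z) := by rw [hE]; ring
      _ ≤ E * (ε * Z) := by gcongr
      _ = _ := by rw [hε]; field_simp
  have h9 := neg_le_of_abs_le (herr.trans herr2)
  rw [hsplit]
  rw [mul_assoc] at hmain
  linarith

namespace GradedMesh

variable {r c0 C0 : ℝ} {M : ℕ} {t : ℕ → ℝ}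

theorem barrier_zero (h : GradedMesh r c0 C0 M t) (α : ℝ) (k : ℕ) : barrier α t k 0 = 0 := by
  rw [barrier_of_le (Nat.zero_le _), h.zero, zero_mul]

theorem barrier_le (h : GradedMesh r c0 C0 M t) {α : ℝ} (hα1 : α < 1) {k m : ℕ} (hk : 1 ≤ k)
    (hm : 1 ≤ m) (hkM : k ≤ M) (hmM : m ≤ M) : barrier α t k m ≤ t m ^ (α - 1) := by
  have htm := h.pos hm hmM
  rcases le_total m k with hmk | hkm
  · rw [barrier_of_le hmk, show α - 1 = 1 + (α - 2) by ring, rpow_add htm, rpow_one]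
    exact mul_le_mul_of_nonneg_left
      (rpow_le_rpow_of_nonpos htm (h.le_of_le hmk hkM) (by linarith)) htm.le
  · exact (barrier_of_ge hkm (h.pos hk hkM)).le

theorem barrier_nonneg (h : GradedMesh r c0 C0 M t) {α : ℝ} {k m : ℕ}
    (hkM : k ≤ M) (hmM : m ≤ M) : 0 ≤ barrier α t k m := by
  have h1 := h.nonneg hmM
  have h2 := h.nonneg hkM
  unfold barrier
  split_ifs <;> positivity

theorem sum_barrier_le (h : GradedMesh r c0 C0 M t) {α q : ℝ} (hα1 : α < 1) (hq : α < q)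
    {N m : ℕ} (hN : 1 ≤ N) (hm : 1 ≤ m) (hmM : m ≤ M) :
    ∑ i ∈ Finset.Ico N M, (t (i + 1) - t i) * t (i + 1) ^ (-q) * barrier α t (i + 1) m ≤
      t m ^ (α - 1) * (∑ i ∈ Finset.Ico 1 m, (t (i + 1) - t i) * t (i + 1) ^ (-q)) +
        1 / (q + 1 - α) * t m ^ (α - q) := by
  have htm := h.pos hm hmM
  have hw : ∀ i, i < M → 0 ≤ (t (i + 1) - t i) * t (i + 1) ^ (-q) := fun i hi =>
    mul_nonneg (by linarith [h.lt_succ i hi]) (rpow_nonneg (h.nonneg hi) _)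
  refine (Finset.sum_le_sum_of_subset_of_nonneg (Finset.Ico_subset_Ico_left hN)
    fun i hi _ => ?_).trans ?_
  · rw [Finset.mem_Ico] at hi
    exact mul_nonneg (hw i hi.2) (h.barrier_nonneg hi.2 hmM)
  rw [← Finset.sum_Ico_consecutive _ hm hmM, Finset.mul_sum]
  refine add_le_add (Finset.sum_le_sum fun i hi => ?_) ?_
  · rw [Finset.mem_Ico] at hi
    rw [mul_comm (t m ^ (α - 1))]
    exact mul_le_mul_of_nonneg_left (h.barrier_le hα1 (by omega) hm (by omega) hmM)
      (hw i (by omega))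
  · have hsum := h.sum_rpow_le_of_one_lt (κ := q + 2 - α) (by linarith) hm hmM le_rfl
    have h1 : ∑ i ∈ Finset.Ico m M, (t (i + 1) - t i) * t (i + 1) ^ (-q) * barrier α t (i + 1) m
        = t m * ∑ i ∈ Finset.Ico m M, (t (i + 1) - t i) * t (i + 1) ^ (-(q + 2 - α)) := by
      rw [Finset.mul_sum]
      refine Finset.sum_congr rfl fun i hi => ?_
      rw [Finset.mem_Ico] at hi
      rw [barrier_of_le (by omega), show -(q + 2 - α) = -q + (α - 2) by ring,
        rpow_add (h.pos (by omega) (by omega))]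
      ring
    have h2 : 0 ≤ t M ^ (1 - (q + 2 - α)) := rpow_nonneg (h.nonneg le_rfl) _
    have h3 : t m * t m ^ (1 - (q + 2 - α)) = t m ^ (α - q) := by
      rw [mul_comm, ← rpow_add_one htm.ne']; congr 1; ring
    rw [h1]
    calc _ ≤ t m * (t m ^ (1 - (q + 2 - α)) / (q + 1 - α)) := by
          refine mul_le_mul_of_nonneg_left (hsum.trans ?_) htm.le
          rw [show q + 2 - α - 1 = q + 1 - α by ring]
          gcongr
          · linarith
          · linarith
      _ = _ := by rw [← h3]; ring

/-- Stability with a nondecreasing weight. -/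
theorem abs_le_of_l1Sum_le_monotone (h : GradedMesh r c0 C0 M t) {α : ℝ} (hα0 : 0 < α)
    (hα1 : α < 1) {e W : ℕ → ℝ} (he : e 0 = 0) {m : ℕ} (hm : 1 ≤ m) (hmM : m ≤ M)
    (hW : 0 ≤ W 1) (hmono : ∀ i, 1 ≤ i → i < m → W i ≤ W (i + 1))
    (hle : ∀ j, 1 ≤ j → j ≤ m → |l1Sum α t e j| ≤ t j ^ (-α) * W j) : |e m| ≤ W m := by
  have := h.abs_le_of_abs_l1Sum_le hα0 hα1 (V := fun j => if j = 0 then 0 else W j) he (by simp)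
    hmM fun j hj hjm => by
      refine (hle j hj hjm).trans ?_
      have := h.le_l1Sum_of_monotone hα0 hα1 (V := fun j => if j = 0 then 0 else W j) (m := j)
        (by omega) fun i hi => by
          rcases Nat.eq_zero_or_pos i with rfl | hi0
          · simpa using hW
          · simpa [hi0.ne'] using hmono i hi0 (by omega)
      simpa [show j ≠ 0 by omega] using this
  simpa [show m ≠ 0 by omega] using this

end GradedMesh

/-- Stability of the L1 scheme for a residual decaying like `(t 1 / t j) ^ q`, `q > α`. -/
theorem abs_le_of_l1Sum_le_rpow {α r c0 C0 q : ℝ} (hα0 : 0 < α) (hα1 : α < 1) (hr : 1 ≤ r)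
    (hαr : α ≤ (2 - α) * (1 / r)) (hc : 0 < c0) (hC : 0 < C0) (hq : α < q) (hq1 : q ≤ α + 1) :
    ∃ C : ℝ, 0 < C ∧ ∀ (M : ℕ) (t : ℕ → ℝ), GradedMesh r c0 C0 M t →
      ∀ (e : ℕ → ℝ) (A : ℝ) (m : ℕ), e 0 = 0 → 0 ≤ A → 1 ≤ m → m ≤ M →
      (∀ j, 1 ≤ j → j ≤ m → |l1Sum α t e j| ≤ A * (t 1 / t j) ^ q) →
      |e m| ≤ C * A * (t 1 ^ q * (t m ^ (α - 1) *
        (∑ i ∈ Finset.Ico 1 m, (t (i + 1) - t i) * t (i + 1) ^ (-q)) + t m ^ (α - q)) +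
        t 1 * t m ^ (α - 1)) := by
  obtain ⟨N, hN, hbar⟩ := l1Sum_barrier_lower hα0 hα1 hr hαr hc hC
  have hβ : 0 < 1 - α := by linarith
  have hq2 : 0 < q + 1 - α := by linarith
  set G : ℝ := 1 + C0 * (N : ℝ) ^ r with hG
  have hG1 : 1 ≤ G := by rw [hG]; linarith [show 0 ≤ C0 * (N : ℝ) ^ r by positivity]
  have hG0 : 0 < G := by linarith
  set c : ℝ := (1 - α) / 2 * G ^ (α - 2) with hcdef
  have hcpos : 0 < c := by positivity
  refine ⟨1 / c * (1 + 1 / (q + 1 - α)), by positivity, ?_⟩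
  intro M t h e A m he hA hm hmM hle
  have hτ := h.tau_pos
  have htm := h.pos hm hmM
  set N' := min N M with hN'
  have hN'1 : 1 ≤ N' := le_min hN h.M_pos
  have hN'M : N' ≤ M := min_le_right _ _
  have htN' : t N' ≤ G * t 1 := by
    have h1 := h.index_le N' hN'1 hN'M
    have h2 : ((N' : ℕ) : ℝ) ^ r ≤ (N : ℝ) ^ r :=
      rpow_le_rpow (by positivity) (by exact_mod_cast min_le_left N M) (by linarith)
    calc t N' ≤ C0 * (t 1 * (N' : ℝ) ^ r) := h1
      _ ≤ C0 * (t 1 * (N : ℝ) ^ r) := by gcongr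
      _ ≤ G * t 1 := by rw [hG]; nlinarith
  have hw : ∀ i, i < M → 0 ≤ (t (i + 1) - t i) * t (i + 1) ^ (-q) := fun i hi =>
    mul_nonneg (by linarith [h.lt_succ i hi]) (rpow_nonneg (h.nonneg hi) _)
  have hlow : ∀ j, 1 ≤ j → j ≤ M → c * t j ^ (-q) ≤
      (∑ i ∈ Finset.Ico N M, (t (i + 1) - t i) * t (i + 1) ^ (-q) *
        l1Sum α t (barrier α t (i + 1)) j) + t 1 ^ (1 - q) * l1Sum α t (barrier α t N') j := by
    intro j hj hjM
    have htj := h.pos hj hjM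
    have hnn : ∀ i ∈ Finset.Ico N M, 0 ≤ (t (i + 1) - t i) * t (i + 1) ^ (-q) *
        l1Sum α t (barrier α t (i + 1)) j := by
      intro i hi
      rw [Finset.mem_Ico] at hi
      refine mul_nonneg (hw i hi.2) ?_
      rcases le_total j (i + 1) with hji | hij
      · exact le_trans (mul_nonneg (rpow_nonneg htj.le _)
          (rpow_nonneg (h.nonneg hi.2) _)) (h.l1Sum_barrier_of_le hα0 hα1 hj hji hi.2)
      · exact le_trans (by have := h.nonneg hi.2; positivity) (hbar M t h (i + 1) j (by omega) hij hjM)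
    rcases le_or_gt j N' with hjN | hNj
    · have h1 := h.l1Sum_barrier_of_le hα0 hα1 hj hjN hN'M
      have h2 : t 1 ^ (1 - α) ≤ t j ^ (1 - α) := rpow_le_rpow hτ.le (h.le_of_le hj hjM) hβ.le
      have h3 : (G * t 1) ^ (α - 2) ≤ t N' ^ (α - 2) :=
        rpow_le_rpow_of_nonpos (h.pos hN'1 hN'M) htN' (by linarith)
      rw [mul_rpow hG0.le hτ.le] at h3
      have h4 : t j ^ (-q) ≤ t 1 ^ (-q) :=
        rpow_le_rpow_of_nonpos hτ (h.le_of_le hj hjM) (by linarith)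
      have h5 : t 1 ^ (-q) = t 1 ^ (1 - q) * (t 1 ^ (1 - α) * t 1 ^ (α - 2)) := by
        rw [← rpow_add hτ, ← rpow_add hτ]; congr 1; ring
      have h6 : c ≤ G ^ (α - 2) := by
        rw [hcdef]; nlinarith [rpow_pos_of_pos hG0 (α - 2)]
      calc c * t j ^ (-q) ≤ G ^ (α - 2) * t 1 ^ (-q) := by gcongr
        _ = t 1 ^ (1 - q) * (t 1 ^ (1 - α) * (G ^ (α - 2) * t 1 ^ (α - 2))) := by rw [h5]; ring
        _ ≤ t 1 ^ (1 - q) * (t j ^ (1 - α) * t N' ^ (α - 2)) := by gcongr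
        _ ≤ t 1 ^ (1 - q) * l1Sum α t (barrier α t N') j := by gcongr
        _ ≤ _ := le_add_of_nonneg_left (Finset.sum_nonneg hnn)
    · have hNN : N' = N := by omega
      rw [hNN] at hNj htN' hN'M ⊢
      have htN := h.pos hN hN'M
      have h1 : (1 - α) / 2 * t j ^ (-α - 1) * ((t j - t N) * t j ^ (α - q)) ≤
          ∑ i ∈ Finset.Ico N M, (t (i + 1) - t i) * t (i + 1) ^ (-q) *
            l1Sum α t (barrier α t (i + 1)) j := by
        refine le_trans ?_ (Finset.sum_le_sum_of_subset_of_nonneg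
          (Finset.Ico_subset_Ico_right hjM) fun i hi _ => hnn i hi)
        rw [← sum_Ico_sub_eq (F := t) hNj.le, Finset.sum_mul, Finset.mul_sum]
        refine Finset.sum_le_sum fun i hi => ?_
        rw [Finset.mem_Ico] at hi
        have hti := h.pos (show 1 ≤ i + 1 by omega) (show i + 1 ≤ M by omega)
        have h2 := hbar M t h (i + 1) j (by omega) (by omega) hjM
        have h3 : t j ^ (α - q) ≤ t (i + 1) ^ (α - q) :=
          rpow_le_rpow_of_nonpos hti (h.le_of_le (by omega) hjM) (by linarith)
        have h4 : t (i + 1) ^ (α - q) = t (i + 1) ^ (-q) * t (i + 1) ^ α := by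
          rw [← rpow_add hti]; congr 1; ring
        have h5 := h.lt_succ i (by omega)
        calc _ ≤ (1 - α) / 2 * t j ^ (-α - 1) * ((t (i + 1) - t i) * t (i + 1) ^ (α - q)) := by
              have : 0 ≤ t (i + 1) - t i := by linarith
              gcongr
          _ = (t (i + 1) - t i) * t (i + 1) ^ (-q) *
              ((1 - α) / 2 * (t (i + 1) ^ α * t j ^ (-α - 1))) := by rw [h4]; ring
          _ ≤ _ := mul_le_mul_of_nonneg_left h2 (hw i (by omega))
      have h2 : (1 - α) / 2 * t j ^ (-α - 1) * (G ^ (α - 2) * (t N * t j ^ (α - q))) ≤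
          t 1 ^ (1 - q) * l1Sum α t (barrier α t N) j := by
        have h3 := hbar M t h N j le_rfl hNj.le hjM
        have h4 : t 1 ^ α ≤ t N ^ α := rpow_le_rpow hτ.le (h.le_of_le hN hN'M) hα0.le
        have h5 : t N ^ (α + 1 - q) ≤ G ^ (α + 1 - q) * t 1 ^ (α + 1 - q) := by
          rw [← mul_rpow hG0.le hτ.le]
          exact rpow_le_rpow htN.le htN' (by linarith)
        have h6 : t N * t j ^ (α - q) ≤ t N ^ (α + 1 - q) := by
          rw [show α + 1 - q = 1 + (α - q) by ring, rpow_add htN, rpow_one]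
          exact mul_le_mul_of_nonneg_left
            (rpow_le_rpow_of_nonpos htN (h.le_of_le hNj.le hjM) (by linarith)) htN.le
        have h7 : G ^ (α - 2) * G ^ (α + 1 - q) ≤ 1 := by
          rw [← rpow_add hG0]
          exact rpow_le_one_of_one_le_of_nonpos hG1 (by linarith)
        have h8 : t 1 ^ (α + 1 - q) = t 1 ^ (1 - q) * t 1 ^ α := by
          rw [← rpow_add hτ]; congr 1; ring
        have h9 : G ^ (α - 2) * (t N * t j ^ (α - q)) ≤ t 1 ^ (1 - q) * t N ^ α := by
          calc _ ≤ G ^ (α - 2) * (G ^ (α + 1 - q) * t 1 ^ (α + 1 - q)) := by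
                exact mul_le_mul_of_nonneg_left (h6.trans h5) (by positivity)
            _ = G ^ (α - 2) * G ^ (α + 1 - q) * t 1 ^ (α + 1 - q) := by ring
            _ ≤ 1 * t 1 ^ (α + 1 - q) := by gcongr
            _ = t 1 ^ (1 - q) * t 1 ^ α := by rw [one_mul, h8]
            _ ≤ _ := by gcongr
        calc _ ≤ (1 - α) / 2 * t j ^ (-α - 1) * (t 1 ^ (1 - q) * t N ^ α) := by gcongr
          _ = t 1 ^ (1 - q) * ((1 - α) / 2 * (t N ^ α * t j ^ (-α - 1))) := by ring
          _ ≤ _ := by gcongr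
      refine le_trans ?_ (add_le_add h1 h2)
      have h3 : t j ^ (-q) = t j ^ (-α - 1) * (t j * t j ^ (α - q)) := by
        rw [mul_comm (t j), ← rpow_add_one htj.ne', ← rpow_add htj]; congr 1; ring
      have h4 : G ^ (α - 2) ≤ 1 := rpow_le_one_of_one_le_of_nonpos hG1 (by linarith)
      have h5 : t N ≤ t j := h.le_of_le hNj.le hjM
      have h6 : G ^ (α - 2) * t j ≤ (t j - t N) + G ^ (α - 2) * t N := by nlinarith
      calc c * t j ^ (-q) = (1 - α) / 2 * t j ^ (-α - 1) * t j ^ (α - q) * (G ^ (α - 2) * t j) := by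
            rw [h3, hcdef]; ring
        _ ≤ (1 - α) / 2 * t j ^ (-α - 1) * t j ^ (α - q) *
            ((t j - t N) + G ^ (α - 2) * t N) := by gcongr
        _ = _ := by ring
  have hstab := h.abs_le_of_abs_l1Sum_le hα0 hα1 (e := e)
    (V := fun j => A * t 1 ^ q / c * ((∑ i ∈ Finset.Ico N M,
      (t (i + 1) - t i) * t (i + 1) ^ (-q) * barrier α t (i + 1) j) +
      t 1 ^ (1 - q) * barrier α t N' j)) he (by simp [h.barrier_zero]) hmM fun j hj hjm => by
    rw [l1Sum_const_mul, l1Sum_add, l1Sum_const_mul,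
      l1Sum_finset_sum _ (fun i => (t (i + 1) - t i) * t (i + 1) ^ (-q))
        (fun i => barrier α t (i + 1))]
    refine (hle j hj hjm).trans ?_
    have htj := h.pos hj (hjm.trans hmM)
    calc A * (t 1 / t j) ^ q = A * t 1 ^ q / c * (c * t j ^ (-q)) := by
          rw [div_rpow hτ.le htj.le, rpow_neg htj.le]; field_simp
      _ ≤ _ := mul_le_mul_of_nonneg_left (hlow j hj (hjm.trans hmM)) (by positivity)
  have hup := h.sum_barrier_le hα1 hq hN hm hmM
  have hup2 := h.barrier_le hα1 hN'1 hm hN'M hmM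
  have hS : 0 ≤ ∑ i ∈ Finset.Ico 1 m, (t (i + 1) - t i) * t (i + 1) ^ (-q) :=
    Finset.sum_nonneg fun i hi => hw i (by rw [Finset.mem_Ico] at hi; omega)
  refine hstab.trans ?_
  set S := ∑ i ∈ Finset.Ico 1 m, (t (i + 1) - t i) * t (i + 1) ^ (-q)
  set d := 1 / (q + 1 - α) with hd
  have hd0 : 0 < d := by positivity
  calc _ ≤ A * t 1 ^ q / c * ((t m ^ (α - 1) * S + d * t m ^ (α - q)) +
        t 1 ^ (1 - q) * t m ^ (α - 1)) := by gcongr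
    _ ≤ A * t 1 ^ q / c * ((1 + d) * (t m ^ (α - 1) * S + t m ^ (α - q) +
        t 1 ^ (1 - q) * t m ^ (α - 1))) := by
      gcongr
      have e1 : 0 ≤ t m ^ (α - 1) * S := by positivity
      have e2 : 0 ≤ t m ^ (α - q) := by positivity
      have e3 : 0 ≤ t 1 ^ (1 - q) * t m ^ (α - 1) := by positivity
      nlinarith
    _ = 1 / c * (1 + d) * A * (t 1 ^ q * (t m ^ (α - 1) * S + t m ^ (α - q)) +
        t 1 ^ q * t 1 ^ (1 - q) * t m ^ (α - 1)) := by ring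
    _ = _ := by rw [← rpow_add hτ, show q + (1 - q) = 1 by ring, rpow_one]

theorem intervalIntegrable_of_abs_le_rpow {α K b : ℝ} {f : ℝ → ℝ} (hα0 : 0 < α)
    (hf : ContinuousOn f (Ioo 0 b)) (hb : 0 ≤ b) (hle : ∀ s ∈ Ioo 0 b, |f s| ≤ K * s ^ (α - 1)) :
    IntervalIntegrable f volume 0 b := by
  have hg : IntervalIntegrable (fun s : ℝ => K * s ^ (α - 1)) volume 0 b :=
    (intervalIntegral.intervalIntegrable_rpow' (by linarith)).const_mul K
  rw [intervalIntegrable_iff_integrableOn_Ioo_of_le hb] at hg ⊢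
  exact Integrable.mono' hg (hf.aestronglyMeasurable measurableSet_Ioo)
    ((ae_restrict_iff' measurableSet_Ioo).2 (Filter.Eventually.of_forall hle))

theorem integral_rpow_sub_one {α : ℝ} (hα0 : 0 < α) (b : ℝ) :
    ∫ s in (0:ℝ)..b, s ^ (α - 1) = b ^ α / α := by
  rw [integral_rpow (Or.inl (by linarith)), sub_add_cancel, zero_rpow hα0.ne', sub_zero]

/-- A weakly singular derivative against the weakly singular kernel. -/
theorem abs_kernel_integral_le_of_abs_le_rpow {α K b : ℝ} {f : ℝ → ℝ} (hα0 : 0 < α) (hα1 : α < 1)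
    (hK : 0 ≤ K) (hb : 0 < b) (hle : ∀ s ∈ Ioo 0 b, |f s| ≤ K * s ^ (α - 1)) :
    |∫ s in (0:ℝ)..b, (b - s) ^ (-α) * f s| ≤ K * (2 ^ (1 - α) / (1 - α) + 2 ^ α / α) := by
  have i1 := (kernel_intervalIntegrable hα1 b 0 b).const_mul ((b / 2) ^ (α - 1))
  have i2 := (intervalIntegral.intervalIntegrable_rpow' (a := 0) (b := b)
    (show -1 < α - 1 by linarith)).const_mul ((b / 2) ^ (-α))
  have hb2 : 0 < b / 2 := by linarith
  refine (abs_integral_le_of_Ioo hb.le ((i1.add i2).const_mul K) fun s hs => ?_).trans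
    (le_of_eq ?_)
  · have hs1 : 0 < s := hs.1
    have hs2 : 0 < b - s := by linarith [hs.2]
    have p1 := rpow_pos_of_pos hs2 (-α)
    have p2 := rpow_pos_of_pos hs1 (α - 1)
    have p3 := rpow_pos_of_pos hb2 (α - 1)
    have p4 := rpow_pos_of_pos hb2 (-α)
    rw [abs_mul, abs_of_pos p1]
    have key : (b - s) ^ (-α) * s ^ (α - 1) ≤
        (b / 2) ^ (α - 1) * (b - s) ^ (-α) + (b / 2) ^ (-α) * s ^ (α - 1) := by
      rcases le_total s (b / 2) with h | h
      · have : (b - s) ^ (-α) ≤ (b / 2) ^ (-α) :=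
          rpow_le_rpow_of_nonpos hb2 (by linarith) (by linarith)
        nlinarith
      · have : s ^ (α - 1) ≤ (b / 2) ^ (α - 1) :=
          rpow_le_rpow_of_nonpos hb2 h (by linarith)
        nlinarith
    calc _ ≤ (b - s) ^ (-α) * (K * s ^ (α - 1)) := by gcongr; exact hle s hs
      _ = K * ((b - s) ^ (-α) * s ^ (α - 1)) := by ring
      _ ≤ _ := by gcongr
  · rw [intervalIntegral.integral_const_mul]
    congr 1
    have : ∫ s in (0:ℝ)..b, ((b / 2) ^ (α - 1) * (b - s) ^ (-α) + (b / 2) ^ (-α) * s ^ (α - 1)) =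
        (b / 2) ^ (α - 1) * (b ^ (1 - α) / (1 - α)) + (b / 2) ^ (-α) * (b ^ α / α) := by
      rw [intervalIntegral.integral_add i1 i2, intervalIntegral.integral_const_mul,
        intervalIntegral.integral_const_mul, kernel_integral hα1, integral_rpow_sub_one hα0,
        sub_self, sub_zero, zero_rpow (by linarith), sub_zero]
    refine this.trans ?_
    have e1 : (b / 2) ^ (α - 1) = 2 ^ (1 - α) / b ^ (1 - α) := by
      rw [show α - 1 = -(1 - α) by ring, rpow_neg hb2.le, div_rpow hb.le (by norm_num), inv_div]
    have e2 : (b / 2) ^ (-α) = 2 ^ α / b ^ α := by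
      rw [rpow_neg hb2.le, div_rpow hb.le (by norm_num), inv_div]
    have := rpow_pos_of_pos hb (1 - α)
    have := rpow_pos_of_pos hb α
    rw [e1, e2]
    field_simp

namespace GradedMesh

theorem sum_rpow_le_min {r c0 C0 : ℝ} {M : ℕ} {t : ℕ → ℝ} (h : GradedMesh r c0 C0 M t)
    {α : ℝ} (hα0 : 0 < α) {n : ℕ} (hn : 1 ≤ n) (hnM : n < M) :
    t 1 ^ (2 * (1 / r)) * t (n + 1) ^ (-α - 1) *
      ∑ i ∈ Finset.Ico 1 n, (t (i + 1) - t i) * t (i + 1) ^ (-(2 - α - 2 + 2 * (1 / r))) ≤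
      (1 + |1 / (1 - ((2 - α) * (1 / r) - α))| + |1 / (2 * (1 / r) - α - 1)|) *
        (t 1 / t (n + 1)) ^ min (α + 1) ((2 - α) * (1 / r)) := by
  have hτ := h.tau_pos
  have htm := h.pos (show 1 ≤ n + 1 by omega) hnM
  have hr0 : 0 < 1 / r := one_div_pos.2 (by linarith [h.r_ge])
  set q := min (α + 1) ((2 - α) * (1 / r)) with hq
  set E : ℝ := 1 + |1 / (1 - ((2 - α) * (1 / r) - α))| + |1 / (2 * (1 / r) - α - 1)| with hE
  have hE0 : 0 < E := by positivity
  set x := t 1 / t (n + 1) with hx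
  have hκ : 2 - α - 2 + 2 * (1 / r) = 2 * (1 / r) - α := by ring
  rw [hκ]
  have htn := h.pos (show 1 ≤ n by omega) (show n ≤ M by omega)
  have htnm : t n ≤ t (n + 1) := (h.lt_succ n (by omega)).le
  rcases lt_or_ge ((2 - α) * (1 / r)) (α + 1) with hlt | hge
  · have hqe : q = (2 - α) * (1 / r) := min_eq_right hlt.le
    have hκ1 : q - α < 1 := by linarith
    have hsum := h.sum_rpow_le_of_lt_one hκ1 (show 1 ≤ n by omega) (show n ≤ M by omega)
    have h1 : t 1 ^ (2 * (1 / r)) * ∑ i ∈ Finset.Ico 1 n,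
        (t (i + 1) - t i) * t (i + 1) ^ (-(2 * (1 / r) - α)) ≤
        t 1 ^ q * ∑ i ∈ Finset.Ico 1 n, (t (i + 1) - t i) * t (i + 1) ^ (-(q - α)) := by
      rw [Finset.mul_sum, Finset.mul_sum]
      refine Finset.sum_le_sum fun i hi => ?_
      rw [Finset.mem_Ico] at hi
      have hti := h.pos (show 1 ≤ i + 1 by omega) (show i + 1 ≤ M by omega)
      have h2 : (t 1 / t (i + 1)) ^ (2 * (1 / r)) ≤ (t 1 / t (i + 1)) ^ q :=
        rpow_le_rpow_of_exponent_ge (h.x_pos (by omega) (by omega))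
          (h.x_le_one (by omega) (by omega)) (by rw [hqe]; nlinarith)
      rw [div_rpow hτ.le hti.le, div_rpow hτ.le hti.le] at h2
      have h3 : 0 ≤ t (i + 1) - t i := by linarith [h.lt_succ i (by omega)]
      have e1 : ∀ p : ℝ, t (i + 1) ^ (-(p - α)) = t (i + 1) ^ α / t (i + 1) ^ p := fun p => by
        rw [← rpow_sub hti]; congr 1; ring
      rw [e1, e1]
      calc _ = (t (i + 1) - t i) * t (i + 1) ^ α *
            (t 1 ^ (2 * (1 / r)) / t (i + 1) ^ (2 * (1 / r))) := by ring
        _ ≤ (t (i + 1) - t i) * t (i + 1) ^ α * (t 1 ^ q / t (i + 1) ^ q) := by gcongr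
        _ = _ := by ring
    have hEle : 1 + 1 / (1 - (q - α)) ≤ E := by
      rw [hE, hqe]
      linarith [le_abs_self (1 / (1 - ((2 - α) * (1 / r) - α))),
        abs_nonneg (1 / (2 * (1 / r) - α - 1))]
    have h4 : t n ^ (1 - (q - α)) ≤ t (n + 1) ^ (1 - (q - α)) :=
      rpow_le_rpow htn.le htnm (by linarith)
    have h5 : x ^ q = t 1 ^ q * (t (n + 1) ^ (-α - 1) * t (n + 1) ^ (1 - (q - α))) := by
      rw [hx, div_rpow hτ.le htm.le, ← rpow_add htm, div_eq_mul_inv, ← rpow_neg htm.le]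
      congr 2; ring
    calc _ = t (n + 1) ^ (-α - 1) * (t 1 ^ (2 * (1 / r)) * ∑ i ∈ Finset.Ico 1 n,
          (t (i + 1) - t i) * t (i + 1) ^ (-(2 * (1 / r) - α))) := by ring
      _ ≤ t (n + 1) ^ (-α - 1) * (t 1 ^ q * (E * t (n + 1) ^ (1 - (q - α)))) := by
        refine mul_le_mul_of_nonneg_left (h1.trans ?_) (by positivity)
        refine mul_le_mul_of_nonneg_left (hsum.trans ?_) (by positivity)
        gcongr
      _ = _ := by rw [h5]; ring
  · have hqe : q = α + 1 := min_eq_left hge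
    have hκ1 : 1 < 2 * (1 / r) - α := by nlinarith only [hge, mul_pos hα0 hr0]
    have hsum := h.sum_rpow_le_of_one_lt hκ1 le_rfl (show 1 ≤ n by omega) (show n ≤ M by omega)
    have hEle : 1 / (2 * (1 / r) - α - 1) ≤ E := by
      rw [hE]
      linarith [le_abs_self (1 / (2 * (1 / r) - α - 1)),
        abs_nonneg (1 / (1 - ((2 - α) * (1 / r) - α)))]
    have h2 := rpow_nonneg htn.le (1 - (2 * (1 / r) - α))
    have h5 : x ^ q = t 1 ^ (2 * (1 / r)) * t (n + 1) ^ (-α - 1) *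
        t 1 ^ (1 - (2 * (1 / r) - α)) := by
      rw [mul_right_comm, ← rpow_add hτ, hqe, hx, div_rpow hτ.le htm.le, div_eq_mul_inv,
        ← rpow_neg htm.le]
      congr 2 <;> ring
    calc _ ≤ t 1 ^ (2 * (1 / r)) * t (n + 1) ^ (-α - 1) *
          (E * t 1 ^ (1 - (2 * (1 / r) - α))) := by
          refine mul_le_mul_of_nonneg_left (hsum.trans ?_) (by positivity)
          calc _ ≤ t 1 ^ (1 - (2 * (1 / r) - α)) / (2 * (1 / r) - α - 1) := by
                have : 0 ≤ 2 * (1 / r) - α - 1 := by linarith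
                gcongr; linarith
            _ = 1 / (2 * (1 / r) - α - 1) * t 1 ^ (1 - (2 * (1 / r) - α)) := by ring
            _ ≤ _ := by gcongr
      _ = _ := by rw [h5]; ring

end GradedMesh

/-- Truncation error of the L1 scheme for functions with an initial singularity. -/
theorem truncation_error {α r c0 C0 : ℝ} (hα0 : 0 < α) (hα1 : α < 1) (hr : 1 ≤ r)
    (hc : 0 < c0) (hC : 0 < C0) :
    ∃ C : ℝ, 0 < C ∧ ∀ (M : ℕ) (t : ℕ → ℝ), GradedMesh r c0 C0 M t →
      ∀ (u u' u'' : ℝ → ℝ) (K : ℝ) (m : ℕ), 0 ≤ K → 1 ≤ m → m ≤ M →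
      ContinuousOn u (Icc 0 (t m)) →
      (∀ s ∈ Ioo 0 (t m), HasDerivAt u (u' s) s) →
      (∀ s ∈ Ioo 0 (t m), HasDerivAt u' (u'' s) s) →
      (∀ s ∈ Ioo 0 (t m), |u' s| ≤ K * s ^ (α - 1)) →
      (∀ s ∈ Ioo 0 (t m), |u'' s| ≤ K * s ^ (α - 2)) →
      |l1Sum α t (fun j => u (t j)) m - ∫ s in (0:ℝ)..(t m), (t m - s) ^ (-α) * u' s| ≤
        C * K * (t 1 / t m) ^ min (α + 1) ((2 - α) * (1 / r)) := by
  obtain ⟨C, hCpos, hcons⟩ := consistency_tail (α := α) (ν := 2 - α) (r := r) hα0 hα1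
    (by linarith) hc hC
  have hβ : 0 < 1 - α := by linarith
  have hr0 : 0 < 1 / r := by positivity
  set q := min (α + 1) ((2 - α) * (1 / r)) with hq
  set B : ℝ := 2 ^ (1 - α) / (1 - α) + 2 ^ α / α with hB
  have hB0 : 0 < B := by positivity
  set D : ℝ := 1 + C0 / c0 with hD
  have hD0 : 0 < D := by positivity
  set E : ℝ := 1 + |1 / (1 - ((2 - α) * (1 / r) - α))| + |1 / (2 * (1 / r) - α - 1)| with hE
  have hE0 : 0 < E := by positivity
  refine ⟨(B + 1 / (α * (1 - α))) + (2 * D ^ (α + 1) / α + C * (E + 1)), by positivity, ?_⟩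
  intro M t h u u' u'' K m hK hm hmM hu hu1 hu2 hb1 hb2
  have hτ := h.tau_pos
  have htm := h.pos hm hmM
  have h1m := h.le_of_le hm hmM
  have hsub : ∀ s ∈ Ioo 0 (t 1), s ∈ Ioo 0 (t m) := fun s hs => ⟨hs.1, hs.2.trans_le h1m⟩
  have hint : IntervalIntegrable u' volume 0 (t 1) :=
    intervalIntegrable_of_abs_le_rpow hα0
      (fun s hs => (hu2 s (hsub s hs)).continuousAt.continuousWithinAt) hτ.le
      fun s hs => hb1 s (hsub s hs)
  have hftc : ∫ s in (0:ℝ)..(t 1), u' s = u (t 1) - u 0 :=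
    intervalIntegral.integral_eq_sub_of_hasDerivAt_of_le hτ.le
      (hu.mono (Icc_subset_Icc_right h1m)) (fun s hs => hu1 s (hsub s hs)) hint
  have hrp : IntervalIntegrable (fun s : ℝ => s ^ (α - 1)) volume 0 (t 1) :=
    intervalIntegral.intervalIntegrable_rpow' (by linarith)
  have hdiff : |u (t 1) - u 0| ≤ K * (t 1 ^ α / α) := by
    rw [← hftc, ← integral_rpow_sub_one hα0, ← intervalIntegral.integral_const_mul]
    exact abs_integral_le_of_Ioo hτ.le (hrp.const_mul K) fun s hs => hb1 s (hsub s hs)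
  rcases hm.eq_or_lt with rfl | hm1
  · rw [div_self hτ.ne', one_rpow, mul_one]
    have h1 := abs_kernel_integral_le_of_abs_le_rpow hα0 hα1 hK hτ hb1
    have h2 : |l1Sum α t (fun j => u (t j)) 1| ≤ 1 / (α * (1 - α)) * K := by
      simp only [l1Sum, Nat.Ico_zero_eq_range, Finset.sum_range_one, zero_add, h.zero]
      rw [kernel_integral hα1, sub_self, sub_zero, zero_rpow hβ.ne', sub_zero, abs_mul, abs_div,
        abs_of_pos hτ, abs_of_pos (show 0 < t 1 ^ (1 - α) / (1 - α) by positivity)]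
      calc _ ≤ K * (t 1 ^ α / α) / t 1 * (t 1 ^ (1 - α) / (1 - α)) := by gcongr
        _ = K * (t 1 ^ α * t 1 ^ (1 - α)) / t 1 / (α * (1 - α)) := by field_simp
        _ = _ := by
          rw [← rpow_add hτ, show α + (1 - α) = 1 by ring, rpow_one]; field_simp
    calc _ ≤ 1 / (α * (1 - α)) * K + K * B := (abs_sub _ _).trans (add_le_add h2 h1)
      _ = (B + 1 / (α * (1 - α))) * K := by ring
      _ ≤ _ := mul_le_mul_of_nonneg_right (le_add_of_nonneg_right (by positivity)) hK
  obtain ⟨n, rfl⟩ : ∃ n, m = n + 1 := ⟨m - 1, by omega⟩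
  have h1lt : t 1 < t (n + 1) := h.lt_of_lt hm1 hmM
  obtain ⟨hi2, htail⟩ := hcons M t h u u' u'' K 1 n hK le_rfl (by omega) (by omega)
    (hu.mono (Icc_subset_Icc_left hτ.le)) (fun s hs => hu1 s ⟨hτ.trans hs.1, hs.2⟩)
    (fun s hs => hu2 s ⟨hτ.trans hs.1, hs.2⟩)
    (fun s hs => by
      rw [show -(2 - α) = α - 2 by ring]; exact hb2 s ⟨hτ.trans hs.1, hs.2⟩)
  set σ := (u (t 1) - u 0) / t 1 with hσ
  have hker : ContinuousOn (fun s : ℝ => (t (n + 1) - s) ^ (-α)) (uIcc 0 (t 1)) := by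
    rw [uIcc_of_le hτ.le]
    exact (continuousOn_const.sub continuousOn_id).rpow_const fun s hs =>
      Or.inl (show t (n + 1) - s ≠ 0 by linarith [hs.2])
  have hi1 : IntervalIntegrable (fun s => (t (n + 1) - s) ^ (-α) * u' s) volume 0 (t 1) :=
    hint.continuousOn_mul hker
  have hσint : IntervalIntegrable (fun s => u' s - σ) volume 0 (t 1) :=
    hint.sub intervalIntegrable_const
  have hσker := hσint.continuousOn_mul hker
  have hfirst := abs_kernel_integral_le_of_mean_zero hα0 hα1 hτ h1lt hσint hσker (by
    rw [intervalIntegral.integral_sub hint intervalIntegrable_const, hftc,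
      intervalIntegral.integral_const, smul_eq_mul, hσ]
    field_simp; ring)
  have habs : ∫ s in (0:ℝ)..(t 1), |u' s - σ| ≤ 2 * (K * (t 1 ^ α / α)) := by
    have h1 : ∫ s in (0:ℝ)..(t 1), |u' s - σ| ≤ ∫ s in (0:ℝ)..(t 1), (K * s ^ (α - 1) + |σ|) :=
      intervalIntegral.integral_mono_on_of_le_Ioo hτ.le hσint.abs
        ((hrp.const_mul K).add intervalIntegrable_const) fun s hs =>
          (abs_sub _ _).trans (add_le_add_left (hb1 s (hsub s hs)) _)
    refine h1.trans ?_
    rw [intervalIntegral.integral_add (hrp.const_mul K) intervalIntegrable_const,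
      intervalIntegral.integral_const_mul, integral_rpow_sub_one hα0,
      intervalIntegral.integral_const, smul_eq_mul, hσ, abs_div, abs_of_pos hτ, sub_zero,
      mul_div_cancel₀ _ hτ.ne']
    linarith
  have hsplit : l1Sum α t (fun j => u (t j)) (n + 1) -
        ∫ s in (0:ℝ)..(t (n + 1)), (t (n + 1) - s) ^ (-α) * u' s =
      -(∫ s in (0:ℝ)..(t 1), (t (n + 1) - s) ^ (-α) * (u' s - σ)) +
      (∑ i ∈ Finset.Ico 1 (n + 1), (u (t (i + 1)) - u (t i)) / (t (i + 1) - t i) *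
            (∫ s in (t i)..(t (i + 1)), (t (n + 1) - s) ^ (-α)) -
        ∫ s in (t 1)..(t (n + 1)), (t (n + 1) - s) ^ (-α) * u' s) := by
    have e1 : ∫ s in (0:ℝ)..(t 1), (t (n + 1) - s) ^ (-α) * (u' s - σ) =
        (∫ s in (0:ℝ)..(t 1), (t (n + 1) - s) ^ (-α) * u' s) -
          σ * ∫ s in (0:ℝ)..(t 1), (t (n + 1) - s) ^ (-α) := by
      rw [← intervalIntegral.integral_const_mul, ← intervalIntegral.integral_sub hi1
        ((kernel_intervalIntegrable hα1 _ _ _).const_mul σ)]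
      congr 1; ext s; ring
    rw [e1, ← intervalIntegral.integral_add_adjacent_intervals hi1 hi2, l1Sum,
      Finset.sum_eq_sum_Ico_succ_bot (Nat.succ_pos n)]
    simp only [zero_add, h.zero, sub_zero]
    rw [hσ]; ring
  set x := t 1 / t (n + 1) with hx
  have hx0 : 0 < x := h.x_pos hm hmM
  have hx1 : x ≤ 1 := h.x_le_one hm hmM
  have hfirst2 : |∫ s in (0:ℝ)..(t 1), (t (n + 1) - s) ^ (-α) * (u' s - σ)| ≤
      2 * D ^ (α + 1) / α * K * x ^ q := by
    have h1 := h.sub_le_sub_succ (show 0 < n by omega) (show n < M by omega)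
    rw [h.zero, sub_zero, zero_add] at h1
    have h2 : (t (n + 1) - t 1) ^ (-α - 1) ≤ D ^ (α + 1) * t (n + 1) ^ (-α - 1) := by
      have h3 : (D * (t (n + 1) - t 1)) ^ (-α - 1) ≤ t (n + 1) ^ (-α - 1) :=
        rpow_le_rpow_of_nonpos htm h1 (by linarith)
      rw [mul_rpow hD0.le (by linarith)] at h3
      calc _ = D ^ (α + 1) * (D ^ (-α - 1) * (t (n + 1) - t 1) ^ (-α - 1)) := by
            rw [← mul_assoc, ← rpow_add hD0, show α + 1 + (-α - 1) = 0 by ring, rpow_zero, one_mul]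
        _ ≤ _ := by gcongr
    have h4 : x ^ (α + 1) ≤ x ^ q := rpow_le_rpow_of_exponent_ge hx0 hx1 (min_le_left _ _)
    have h5 : x ^ (α + 1) = t 1 * t 1 ^ α * t (n + 1) ^ (-α - 1) := by
      rw [hx, div_rpow hτ.le htm.le, show -α - 1 = -(α + 1) by ring, rpow_neg htm.le,
        rpow_add_one hτ.ne']
      ring
    have h6 : 0 ≤ ∫ s in (0:ℝ)..(t 1), |u' s - σ| :=
      intervalIntegral.integral_nonneg hτ.le fun _ _ => abs_nonneg _
    rw [sub_zero] at hfirst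
    calc _ ≤ t 1 * (D ^ (α + 1) * t (n + 1) ^ (-α - 1)) * (2 * (K * (t 1 ^ α / α))) := by
          refine hfirst.trans ?_
          gcongr
      _ = 2 * D ^ (α + 1) / α * K * x ^ (α + 1) := by rw [h5]; ring
      _ ≤ _ := by gcongr
  have hS := h.sum_rpow_le_min hα0 (show 1 ≤ n by omega) (show n < M by omega)
  have hlast : t (n + 1) ^ (2 - (2 - α) - α) * x ^ ((2 - α) * (1 / r)) ≤ x ^ q := by
    rw [show 2 - (2 - α) - α = 0 by ring, rpow_zero, one_mul]
    exact rpow_le_rpow_of_exponent_ge hx0 hx1 (min_le_right _ _)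
  have hxq := rpow_pos_of_pos hx0 q
  rw [hsplit]
  refine (abs_add_le _ _).trans ?_
  rw [abs_neg]
  calc _ ≤ 2 * D ^ (α + 1) / α * K * x ^ q + C * K * (E * x ^ q + x ^ q) := by
        refine add_le_add hfirst2 (htail.trans ?_)
        gcongr
    _ = (2 * D ^ (α + 1) / α + C * (E + 1)) * K * x ^ q := by ring
    _ ≤ _ := mul_le_mul_of_nonneg_right (mul_le_mul_of_nonneg_right
        (le_add_of_nonneg_left (by positivity)) hK) hxq.le

/-- Pointwise-in-time stability of the L1 scheme on quasi-graded meshes. -/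
theorem abs_le_of_l1Sum_le {α r c0 C0 : ℝ} (hα0 : 0 < α) (hα1 : α < 1) (hr : 1 ≤ r)
    (hc : 0 < c0) (hC : 0 < C0) :
    ∃ C : ℝ, 0 < C ∧ ∀ (M : ℕ) (t : ℕ → ℝ), GradedMesh r c0 C0 M t →
      ∀ (e : ℕ → ℝ) (A : ℝ) (m : ℕ), e 0 = 0 → 0 ≤ A → 1 ≤ m → m ≤ M →
      (∀ j, 1 ≤ j → j ≤ m →
        |l1Sum α t e j| ≤ A * (t 1 / t j) ^ min (α + 1) ((2 - α) * (1 / r))) →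
      |e m| ≤ C * A *
        (if r < 2 - α then t 1 * t m ^ (α - 1)
        else if r = 2 - α then t 1 * t m ^ (α - 1) * (1 + Real.log (t m / t 1))
        else t 1 ^ ((2 - α) / r) * t m ^ (α - (2 - α) / r)) := by
  have hr0 : 0 < r := by linarith
  rw [mul_one_div]
  have hαr : ∀ {q}, q ≤ (2 - α) / r → q ≤ (2 - α) * (1 / r) := fun h => by rwa [mul_one_div]
  set p := (2 - α) / r with hp
  rcases lt_trichotomy r (2 - α) with hlt | heq | hgt
  · have hp1 : 1 < p := (one_lt_div hr0).2 hlt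
    have hq1 : 1 < min (α + 1) p := lt_min (by linarith) hp1
    obtain ⟨C, hCpos, hstab⟩ := abs_le_of_l1Sum_le_rpow hα0 hα1 hr (hαr (by linarith)) hc hC
      (hα1.trans hq1) (min_le_left _ _)
    set q := min (α + 1) p
    have hq0 : 0 < q - 1 := by linarith
    refine ⟨C * (1 / (q - 1) + 2), by positivity, ?_⟩
    intro M t h e A m he hA hm hmM hle
    have hτ := h.tau_pos
    have htm := h.pos hm hmM
    rw [if_pos hlt]
    refine (hstab M t h e A m he hA hm hmM hle).trans ?_
    have hS := h.sum_rpow_le_of_one_lt hq1 le_rfl hm hmM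
    have h1 := rpow_nonneg htm.le (1 - q)
    have h2 : t 1 ^ q * t 1 ^ (1 - q) = t 1 := by
      rw [← rpow_add hτ, show q + (1 - q) = 1 by ring, rpow_one]
    have h3 : t m ^ (α - q) ≤ t m ^ (α - 1) * t 1 ^ (1 - q) := by
      rw [show α - q = (α - 1) + (1 - q) by ring, rpow_add htm]
      exact mul_le_mul_of_nonneg_left
        (rpow_le_rpow_of_nonpos hτ (h.le_of_le hm hmM) (by linarith)) (rpow_nonneg htm.le _)
    calc _ ≤ C * A * (t 1 ^ q * (t m ^ (α - 1) * (t 1 ^ (1 - q) / (q - 1)) +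
          t m ^ (α - 1) * t 1 ^ (1 - q)) + t 1 * t m ^ (α - 1)) := by
          gcongr
          refine hS.trans ?_
          gcongr
          linarith
      _ = C * A * (t m ^ (α - 1) * (1 / (q - 1) + 1) * (t 1 ^ q * t 1 ^ (1 - q)) +
          t 1 * t m ^ (α - 1)) := by ring
      _ = _ := by rw [h2]; ring
  · have hp1 : p = 1 := by rw [hp, ← heq, div_self hr0.ne']
    have hq1 : min (α + 1) p = 1 := by rw [hp1]; exact min_eq_right (by linarith)
    obtain ⟨C, hCpos, hstab⟩ := abs_le_of_l1Sum_le_rpow (q := 1) hα0 hα1 hr (hαr (by linarith))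
      hc hC hα1 (by linarith)
    refine ⟨C * 2, by positivity, ?_⟩
    intro M t h e A m he hA hm hmM hle
    have hτ := h.tau_pos
    have htm := h.pos hm hmM
    rw [if_neg (by linarith), if_pos heq]
    rw [hq1] at hle
    refine (hstab M t h e A m he hA hm hmM hle).trans ?_
    have hS := h.sum_inv_le_log le_rfl hm hmM
    have hlog : 0 ≤ Real.log (t m / t 1) :=
      Real.log_nonneg ((one_le_div hτ).2 (h.le_of_le hm hmM))
    have h1 : 0 ≤ t 1 * t m ^ (α - 1) * Real.log (t m / t 1) := by positivity
    rw [rpow_one]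
    calc _ ≤ C * A * (t 1 * (t m ^ (α - 1) * Real.log (t m / t 1) + t m ^ (α - 1)) +
          t 1 * t m ^ (α - 1)) := by gcongr
      _ ≤ C * A * (2 * (t 1 * t m ^ (α - 1) * (1 + Real.log (t m / t 1)))) := by
          gcongr
          linarith
      _ = _ := by ring
  · have hp1 : p < 1 := (div_lt_one hr0).2 hgt
    have hq1 : min (α + 1) p = p := min_eq_right (by linarith)
    rcases le_or_gt p α with hpα | hpα
    · refine ⟨1, one_pos, ?_⟩
      intro M t h e A m he hA hm hmM hle
      have hτ := h.tau_pos
      rw [hq1] at hle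
      rw [if_neg (by linarith), if_neg hgt.ne', one_mul]
      refine h.abs_le_of_l1Sum_le_monotone hα0 hα1 (W := fun j => A * (t 1 ^ p * t j ^ (α - p)))
        he hm hmM (by positivity) (fun i hi him => ?_) fun j hj hjm => ?_
      · have := h.pos hi (by omega)
        have := rpow_le_rpow this.le (h.lt_succ i (by omega)).le (show 0 ≤ α - p by linarith)
        gcongr
      · have htj := h.pos hj (hjm.trans hmM)
        refine (hle j hj hjm).trans (le_of_eq ?_)
        rw [div_rpow hτ.le htj.le, div_eq_mul_inv, ← rpow_neg htj.le,
          show -p = -α + (α - p) by ring, rpow_add htj]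
        ring
    · obtain ⟨C, hCpos, hstab⟩ := abs_le_of_l1Sum_le_rpow (q := p) hα0 hα1 hr (hαr hpα.le)
        hc hC hpα (by linarith)
      have hp0 : 0 < 1 - p := by linarith
      refine ⟨C * (3 + 1 / (1 - p)), by positivity, ?_⟩
      intro M t h e A m he hA hm hmM hle
      have hτ := h.tau_pos
      have htm := h.pos hm hmM
      rw [hq1] at hle
      rw [if_neg (by linarith), if_neg hgt.ne']
      refine (hstab M t h e A m he hA hm hmM hle).trans ?_
      have hS := h.sum_rpow_le_of_lt_one hp1 hm hmM
      have h1 : t m ^ (α - 1) * t m ^ (1 - p) = t m ^ (α - p) := by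
        rw [← rpow_add htm]; congr 1; ring
      have h2 : t 1 * t m ^ (α - 1) ≤ t 1 ^ p * t m ^ (α - p) := by
        have h3 : t 1 ^ (1 - p) ≤ t m ^ (1 - p) := rpow_le_rpow hτ.le (h.le_of_le hm hmM) hp0.le
        calc t 1 * t m ^ (α - 1) = t 1 ^ p * (t m ^ (α - 1) * t 1 ^ (1 - p)) := by
              rw [mul_left_comm, ← rpow_add hτ, show p + (1 - p) = 1 by ring, rpow_one, mul_comm]
          _ ≤ t 1 ^ p * (t m ^ (α - 1) * t m ^ (1 - p)) := by gcongr
          _ = _ := by rw [h1]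
      calc _ ≤ C * A * (t 1 ^ p * (t m ^ (α - 1) * ((1 + 1 / (1 - p)) * t m ^ (1 - p)) +
            t m ^ (α - p)) + t 1 ^ p * t m ^ (α - p)) := by gcongr
        _ = C * A * (t 1 ^ p * ((1 + 1 / (1 - p)) * (t m ^ (α - 1) * t m ^ (1 - p)) +
            t m ^ (α - p)) + t 1 ^ p * t m ^ (α - p)) := by ring
        _ = _ := by rw [h1]; ring

theorem GradedMesh.of_quasiGraded {r c0 C0 T : ℝ} {M : ℕ} {t : ℕ → ℝ} (hr : 1 ≤ r)
    (hc0 : 0 < c0) (hcC : c0 ≤ C0) (hM : IsMesh T M t) (hQ : QuasiGraded r c0 C0 M t) :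
    GradedMesh r c0 C0 M t := by
  obtain ⟨hM2, h0, hlt, -⟩ := hM
  obtain ⟨-, hidx, hstep⟩ := hQ
  have hpos : ∀ i, i < M → 0 < t (i + 1) := by
    intro i
    induction i with
    | zero => intro hi; rw [← h0]; exact hlt 0 hi
    | succ n ih => intro hi; exact (ih (by omega)).trans (hlt (n + 1) hi)
  have hgrade : ∀ i, i < M → t 1 ^ (1 / r) * t (i + 1) ^ (1 - 1 / r)
      = t (i + 1) * (t 1 / t (i + 1)) ^ (1 / r) := by
    intro i hi
    rw [div_rpow (hpos 0 (by omega)).le (hpos i hi).le, rpow_sub (hpos i hi), rpow_one]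
    ring
  exact
    { r_ge := hr
      c0_pos := hc0
      C0_pos := hc0.trans_le hcC
      M_pos := by omega
      zero := h0
      lt_succ := hlt
      index_ge := fun k hk hkM => (hidx k hk hkM).1
      index_le := fun k hk hkM => (hidx k hk hkM).2
      step_ge := fun i hi => by
        rw [← hgrade i hi]; exact (hstep (i + 1) (by omega) hi).1
      step_le := fun i hi => by
        rw [← hgrade i hi]; exact (hstep (i + 1) (by omega) hi).2 }

theorem majorant_le_EcalL1 {α r C0 τ s : ℝ} {M : ℕ} (hα1 : α < 1) (hr : 1 ≤ r)
    (hC0 : 0 < C0) (hτ : 0 < τ) (hτs : τ ≤ s) (hτM : τ ≤ C0 * (M : ℝ) ^ (-r)) :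
    (if r < 2 - α then τ * s ^ (α - 1)
      else if r = 2 - α then τ * s ^ (α - 1) * (1 + Real.log (s / τ))
      else τ ^ ((2 - α) / r) * s ^ (α - (2 - α) / r)) ≤
      (C0 + C0 ^ ((2 - α) / r)) * EcalL1 α r M τ s := by
  have hs : 0 < s := hτ.trans_le hτs
  have hr0 : 0 < r := by linarith
  have hlog : 0 ≤ Real.log (s / τ) := Real.log_nonneg ((one_le_div hτ).2 hτs)
  have hM : (0 : ℝ) ≤ M := Nat.cast_nonneg M
  have hp : 0 < (2 - α) / r := div_pos (by linarith) hr0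
  have hCp := rpow_nonneg hC0.le ((2 - α) / r)
  unfold EcalL1
  split_ifs with h1 h2
  · calc τ * s ^ (α - 1) ≤ C0 * (M : ℝ) ^ (-r) * s ^ (α - 1) := by gcongr
      _ = C0 * ((M : ℝ) ^ (-r) * s ^ (α - 1)) := by ring
      _ ≤ _ := by gcongr; linarith
  · rw [show α - 2 = -r by linarith]
    calc _ ≤ C0 * (M : ℝ) ^ (-r) * s ^ (α - 1) * (1 + Real.log (s / τ)) := by gcongr
      _ = C0 * ((M : ℝ) ^ (-r) * s ^ (α - 1) * (1 + Real.log (s / τ))) := by ring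
      _ ≤ _ := by gcongr; linarith
  · have h3 : τ ^ ((2 - α) / r) ≤ C0 ^ ((2 - α) / r) * (M : ℝ) ^ (α - 2) := by
      refine (rpow_le_rpow hτ.le hτM hp.le).trans (le_of_eq ?_)
      rw [mul_rpow hC0.le (rpow_nonneg hM _), ← rpow_mul hM]
      congr 2; field_simp; ring
    calc _ ≤ C0 ^ ((2 - α) / r) * (M : ℝ) ^ (α - 2) * s ^ (α - (2 - α) / r) := by gcongr
      _ = C0 ^ ((2 - α) / r) * ((M : ℝ) ^ (α - 2) * s ^ (α - (2 - α) / r)) := by ring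
      _ ≤ _ := by gcongr; linarith

/-- Pointwise-in-time error bound for the L1 discretization of the
initial-value problem `D_t^α u = f` (Theorem 3.1). -/
theorem stmt12 (α r T c0 C0 Cu : ℝ)
    (hα0 : 0 < α) (hα1 : α < 1) (hr1 : 1 ≤ r)
    (hT : 0 < T) (hc0 : 0 < c0) (hcC : c0 ≤ C0) (hCu : 0 < Cu) :
    ∃ C : ℝ, 0 < C ∧
      ∀ (M : ℕ) (t : ℕ → ℝ), IsMesh T M t → QuasiGraded r c0 C0 M t →
        ∀ u : ℝ → ℝ, ContinuousOn u (Set.Icc 0 T) → ContDiffOn ℝ 2 u (Set.Ioc 0 T) →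
          (∀ s ∈ Set.Ioc (0:ℝ) T, |deriv u s| ≤ Cu * (1 + s ^ (α - 1))) →
          (∀ s ∈ Set.Ioc (0:ℝ) T, |deriv (deriv u) s| ≤ Cu * (1 + s ^ (α - 2))) →
          ∀ U : ℕ → ℝ, U 0 = u (t 0) →
            (∀ m : ℕ, 1 ≤ m → m ≤ M → deltaL1 α t U m = caputo α u (t m)) →
            ∀ m : ℕ, 1 ≤ m → m ≤ M →
              |u (t m) - U m| ≤ C * EcalL1 α r M (t 1) (t m) := by
  have hC0 : 0 < C0 := hc0.trans_le hcC
  obtain ⟨C1, hC1, htrunc⟩ := truncation_error hα0 hα1 hr1 hc0 hC0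
  obtain ⟨C2, hC2, hstab⟩ := abs_le_of_l1Sum_le hα0 hα1 hr1 hc0 hC0
  set K := Cu * (1 + T ^ (1 - α) + T ^ (2 - α)) with hK
  have hK0 : 0 < K := by positivity
  refine ⟨C2 * (C1 * K) * (C0 + C0 ^ ((2 - α) / r)), by positivity, ?_⟩
  intro M t hM hQ u hu hu2 hb1 hb2 U hU0 hU m hm hmM
  have h := GradedMesh.of_quasiGraded hr1 hc0 hcC hM hQ
  have hT' : ∀ j, j ≤ M → t j ≤ T := fun j hj => by rw [← hM.2.2.2]; exact h.le_of_le hj le_rfl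
  have hopen : ContDiffOn ℝ 2 u (Ioo 0 T) := hu2.mono Ioo_subset_Ioc_self
  have hd1 : ContDiffOn ℝ 1 (deriv u) (Ioo 0 T) :=
    hopen.deriv_of_isOpen isOpen_Ioo (by norm_num)
  have hdu : ∀ s ∈ Ioo 0 T, HasDerivAt u (deriv u s) s := fun s hs =>
    ((hopen.differentiableOn (by norm_num)).differentiableAt (isOpen_Ioo.mem_nhds hs)).hasDerivAt
  have hddu : ∀ s ∈ Ioo 0 T, HasDerivAt (deriv u) (deriv (deriv u) s) s := fun s hs =>
    ((hd1.differentiableOn (by norm_num)).differentiableAt (isOpen_Ioo.mem_nhds hs)).hasDerivAt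
  have hpow : ∀ p : ℝ, p ≤ 0 → ∀ s ∈ Ioo 0 T, 1 ≤ T ^ (-p) * s ^ p := fun p hp s hs => by
    have := rpow_le_rpow_of_nonpos hs.1 hs.2.le hp
    rw [rpow_neg hT.le]
    have hTp := rpow_pos_of_pos hT p
    rw [inv_mul_eq_div, one_le_div hTp]
    exact this
  have hbound1 : ∀ s ∈ Ioo 0 T, |deriv u s| ≤ K * s ^ (α - 1) := fun s hs => by
    have h1 := hpow (α - 1) (by linarith) s hs
    rw [neg_sub] at h1
    have h2 := rpow_pos_of_pos hs.1 (α - 1)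
    have h3 := rpow_pos_of_pos hT (2 - α)
    calc _ ≤ Cu * (1 + s ^ (α - 1)) := hb1 s ⟨hs.1, hs.2.le⟩
      _ ≤ Cu * ((1 + T ^ (1 - α) + T ^ (2 - α)) * s ^ (α - 1)) := by
        gcongr
        nlinarith
      _ = _ := by rw [hK]; ring
  have hbound2 : ∀ s ∈ Ioo 0 T, |deriv (deriv u) s| ≤ K * s ^ (α - 2) := fun s hs => by
    have h1 := hpow (α - 2) (by linarith) s hs
    rw [neg_sub] at h1
    have h2 := rpow_pos_of_pos hs.1 (α - 2)
    have h3 := rpow_pos_of_pos hT (1 - α)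
    calc _ ≤ Cu * (1 + s ^ (α - 2)) := hb2 s ⟨hs.1, hs.2.le⟩
      _ ≤ Cu * ((1 + T ^ (1 - α) + T ^ (2 - α)) * s ^ (α - 2)) := by
        gcongr
        nlinarith
      _ = _ := by rw [hK]; ring
  have hresidual : ∀ j, 1 ≤ j → j ≤ m → |l1Sum α t (fun j => u (t j) - U j) j| ≤
      C1 * K * (t 1 / t j) ^ min (α + 1) ((2 - α) * (1 / r)) := by
    intro j hj hjm
    have hjM := hjm.trans hmM
    have hsub : ∀ s ∈ Ioo 0 (t j), s ∈ Ioo 0 T := fun s hs => ⟨hs.1, hs.2.trans_le (hT' j hjM)⟩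
    have hUj := hU j hj hjM
    rw [deltaL1_eq, caputo] at hUj
    have hΓ : 1 / Real.Gamma (1 - α) ≠ 0 :=
      (one_div_pos.2 (Real.Gamma_pos_of_pos (by linarith))).ne'
    rw [l1Sum_sub, mul_left_cancel₀ hΓ hUj]
    exact htrunc M t h u (deriv u) (deriv (deriv u)) K j hK0.le hj hjM
      (hu.mono (Icc_subset_Icc_right (hT' j hjM)))
      (fun s hs => hdu s (hsub s hs)) (fun s hs => hddu s (hsub s hs))
      (fun s hs => hbound1 s (hsub s hs)) (fun s hs => hbound2 s (hsub s hs))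
  have hmain := hstab M t h (fun j => u (t j) - U j) (C1 * K) m (by simp [hU0])
    (by positivity) hm hmM hresidual
  refine hmain.trans ?_
  rw [mul_assoc (C2 * (C1 * K))]
  exact mul_le_mul_of_nonneg_left (majorant_le_EcalL1 hα1 hr1 hC0 h.tau_pos
    (h.le_of_le hm hmM) hQ.1.2) (by positivity)
end

section
/- Let α ∈ (0,1) and let the temporal mesh be quasi-graded with parameter r ≥ 1 and constants c_0 ≤ C_0. Let u ∈ C([0,T]) ∩ C^2((0,T]) satisfy, for some constant C_u > 0, |u′(t)| ≤ C_u(1 + t^{α−1}) and |u″(t)| ≤ C_u(1 + t^{α−2}) for all t ∈ (0,T]. Let the discrete solution U^0,...,U^M be defined by U^0 = u(0) and δ_t^α U^m = D_t^α u(t_m) for m = 1,...,M. Then there exists a constant C > 0, depending only on α, r, T, c_0, C_0, C_u, such that max_{m=1,...,M} |u(t_m) − U^m| ≤ C M^{−min{α r, 2−α}}. -/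
open Real MeasureTheory Set

/-- Sums over `Finset.Icc 1 m` as sums over `Finset.range m`. -/
theorem sum_Icc_one_eq_sum_range (f : ℕ → ℝ) (m : ℕ) :
    ∑ j ∈ Finset.Icc 1 m, f j = ∑ j ∈ Finset.range m, f (j + 1) := by
  induction m with
  | zero => simp
  | succ n ih => rw [Finset.sum_Icc_succ_top (by omega), Finset.sum_range_succ, ih]

theorem intervalIntegrable_kernel {α : ℝ} (hα1 : α < 1) (a b x : ℝ) :
    IntervalIntegrable (fun s : ℝ => (x - s) ^ (-α)) volume a b := by
  have h : IntervalIntegrable (fun s : ℝ => s ^ (-α)) volume (x - a) (x - b) :=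
    intervalIntegral.intervalIntegrable_rpow' (by linarith)
  simpa using h.comp_sub_left x

theorem integral_kernel {α : ℝ} (hα1 : α < 1) (a x : ℝ) :
    ∫ s in a..x, (x - s) ^ (-α) = (x - a) ^ (1 - α) / (1 - α) := by
  rw [intervalIntegral.integral_comp_sub_left (fun s : ℝ => s ^ (-α)) x,
    integral_rpow (Or.inl (by linarith))]
  rw [sub_self, Real.zero_rpow (by linarith)]
  rw [show -α + 1 = 1 - α by ring, sub_zero]

theorem kernel_antitone {α : ℝ} (hα0 : 0 < α) {a s x : ℝ} (has : a ≤ s) (hsx : s < x) :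
    (x - a) ^ (-α) ≤ (x - s) ^ (-α) :=
  Real.rpow_le_rpow_of_nonpos (by linarith) (by linarith) (by linarith)

theorem le_kernel_average {α : ℝ} (hα0 : 0 < α) (hα1 : α < 1) {a b x : ℝ} (hab : a < b)
    (hbx : b ≤ x) : (x - a) ^ (-α) ≤ (∫ s in a..b, (x - s) ^ (-α)) / (b - a) := by
  rw [le_div_iff₀ (by linarith)]
  have h := intervalIntegral.integral_mono_on_of_le_Ioo (μ := volume) hab.le
    (intervalIntegrable_const (c := (x - a) ^ (-α))) (intervalIntegrable_kernel hα1 a b x)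
    (fun s hs => kernel_antitone hα0 hs.1.le (hs.2.trans_le hbx))
  rw [intervalIntegral.integral_const, smul_eq_mul] at h
  linarith

theorem kernel_average_le {α : ℝ} (hα0 : 0 < α) (hα1 : α < 1) {a b x : ℝ} (hab : a < b)
    (hbx : b < x) : (∫ s in a..b, (x - s) ^ (-α)) / (b - a) ≤ (x - b) ^ (-α) := by
  rw [div_le_iff₀ (by linarith)]
  have h := intervalIntegral.integral_mono_on_of_le_Ioo (μ := volume) hab.le
    (intervalIntegrable_kernel hα1 a b x) (intervalIntegrable_const (c := (x - b) ^ (-α)))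
    (fun s hs => kernel_antitone hα0 hs.2.le hbx)
  rw [intervalIntegral.integral_const, smul_eq_mul] at h
  linarith

/-- Summation by parts against monotone weights. -/
theorem mul_sub_sum_le_of_monotone {V w : ℕ → ℝ} {K : ℝ} (hV0 : V 0 = 0) (n : ℕ)
    (hw : ∀ j < n, w j ≤ w (j + 1)) (hV : ∀ j ≤ n, V j ≤ K) :
    V (n + 1) * w n - ∑ j ∈ Finset.range (n + 1), (V (j + 1) - V j) * w j ≤ K * (w n - w 0) := by
  induction n with
  | zero => simp [hV0]
  | succ n ih =>
    have h := ih (fun j hj => hw j (by omega)) (fun j hj => hV j (by omega))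
    rw [Finset.sum_range_succ]
    have h2 := mul_le_mul_of_nonneg_right (hV (n + 1) le_rfl) (sub_nonneg.2 (hw n (by omega)))
    linarith

theorem le_of_sum_le_of_monotone {V w : ℕ → ℝ} {K : ℝ} (hV0 : V 0 = 0) (n : ℕ)
    (hw : ∀ j < n, w j ≤ w (j + 1)) (hV : ∀ j ≤ n, V j ≤ K) (hpos : 0 < w n)
    (hsum : ∑ j ∈ Finset.range (n + 1), (V (j + 1) - V j) * w j ≤ K * w 0) :
    V (n + 1) ≤ K := by
  have h := mul_sub_sum_le_of_monotone hV0 n hw hV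
  exact le_of_mul_le_mul_right (by linarith) hpos

theorem IsMesh.lt {T : ℝ} {M : ℕ} {t : ℕ → ℝ} (h : IsMesh T M t) {i j : ℕ} (hij : i < j)
    (hj : j ≤ M) : t i < t j := by
  induction j, hij using Nat.le_induction with
  | base => exact h.2.2.1 i (by omega)
  | succ n _ ih => exact (ih (by omega)).trans (h.2.2.1 n (by omega))

theorem IsMesh.le {T : ℝ} {M : ℕ} {t : ℕ → ℝ} (h : IsMesh T M t) {i j : ℕ} (hij : i ≤ j)
    (hj : j ≤ M) : t i ≤ t j := by
  rcases hij.eq_or_lt with rfl | hlt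
  · exact le_rfl
  · exact (h.lt hlt hj).le

theorem gamma_mul_deltaL1 {α : ℝ} (hα1 : α < 1) (t V : ℕ → ℝ) (m : ℕ) :
    Real.Gamma (1 - α) * deltaL1 α t V m =
      ∑ j ∈ Finset.range m, (V (j + 1) - V j) *
        ((∫ s in (t j)..(t (j + 1)), (t m - s) ^ (-α)) / (t (j + 1) - t j)) := by
  have hG : Real.Gamma (1 - α) ≠ 0 := (Real.Gamma_pos_of_pos (by linarith)).ne'
  rw [deltaL1, sum_Icc_one_eq_sum_range, ← mul_assoc, mul_one_div_cancel hG, one_mul]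
  refine Finset.sum_congr rfl fun j _ => ?_
  rw [Nat.add_sub_cancel]
  ring

/-- Stability of the L1 operator: a right-hand side of size `K t_m^{-α}` produces a solution
bounded by a multiple of `K`. -/
theorem abs_le_of_abs_deltaL1_le {α T K : ℝ} (hα0 : 0 < α) (hα1 : α < 1) {M : ℕ} {t : ℕ → ℝ}
    (hmesh : IsMesh T M t) (hK : 0 ≤ K) {V : ℕ → ℝ} (hV0 : V 0 = 0)
    (hV : ∀ m, 1 ≤ m → m ≤ M →
      |Real.Gamma (1 - α) * deltaL1 α t V m| ≤ K * t m ^ (-α)) :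
    ∀ m ≤ M, |V m| ≤ K := by
  intro m
  induction m using Nat.strong_induction_on with
  | _ m ih =>
    intro hm
    rcases m with _ | n
    · simpa [hV0] using hK
    have h := hV (n + 1) (by omega) hm
    set w : ℕ → ℝ := fun j =>
      (∫ s in (t j)..(t (j + 1)), (t (n + 1) - s) ^ (-α)) / (t (j + 1) - t j) with hwdef
    have hlow : ∀ j ≤ n, (t (n + 1) - t j) ^ (-α) ≤ w j := fun j hj =>
      le_kernel_average hα0 hα1 (hmesh.lt (by omega) (by omega)) (hmesh.le (by omega) hm)
    have hmono : ∀ j < n, w j ≤ w (j + 1) := fun j hj =>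
      (kernel_average_le hα0 hα1 (hmesh.lt (by omega) (by omega))
        (hmesh.lt (by omega) hm)).trans (hlow (j + 1) (by omega))
    have hpos : 0 < w n :=
      (Real.rpow_pos_of_pos (sub_pos.2 (hmesh.lt (by omega) hm)) _).trans_le (hlow n le_rfl)
    have h0 : t (n + 1) ^ (-α) ≤ w 0 := by
      simpa [hmesh.2.1] using hlow 0 (by omega)
    have hsum := h.trans (mul_le_mul_of_nonneg_left h0 hK)
    rw [gamma_mul_deltaL1 hα1] at hsum
    obtain ⟨hs1, hs2⟩ := abs_le.1 hsum
    have hb : ∀ j ≤ n, |V j| ≤ K := fun j hj => ih j (by omega) (by omega)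
    refine abs_le'.2 ⟨le_of_sum_le_of_monotone hV0 n hmono
      (fun j hj => (abs_le'.1 (hb j hj)).1) hpos hs2, ?_⟩
    refine le_of_sum_le_of_monotone (V := fun j => -V j) (by simp [hV0]) n hmono
      (fun j hj => (abs_le'.1 (hb j hj)).2) hpos ?_
    have : ∑ j ∈ Finset.range (n + 1), (-V (j + 1) - -V j) * w j =
        -∑ j ∈ Finset.range (n + 1), (V (j + 1) - V j) * w j := by
      rw [← Finset.sum_neg_distrib]
      exact Finset.sum_congr rfl fun j _ => by ring
    rw [this]
    linarith

theorem intervalIntegrable_of_abs_le_Ioo {f g : ℝ → ℝ} {a b : ℝ} (hab : a ≤ b)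
    (hf : Measurable f) (hg : IntervalIntegrable g volume a b)
    (h : ∀ s ∈ Ioo a b, |f s| ≤ g s) : IntervalIntegrable f volume a b := by
  rw [intervalIntegrable_iff_integrableOn_Ioo_of_le hab] at hg ⊢
  refine Integrable.mono' hg hf.aestronglyMeasurable ?_
  exact (ae_restrict_iff' measurableSet_Ioo).2 (Filter.Eventually.of_forall h)

theorem abs_integral_le_of_abs_le_Ioo {f g : ℝ → ℝ} {a b : ℝ} (hab : a ≤ b)
    (hf : IntervalIntegrable f volume a b) (hg : IntervalIntegrable g volume a b)
    (h : ∀ s ∈ Ioo a b, |f s| ≤ g s) : |∫ s in a..b, f s| ≤ ∫ s in a..b, g s :=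
  (intervalIntegral.abs_integral_le_integral_abs hab).trans
    (intervalIntegral.integral_mono_on_of_le_Ioo hab hf.abs hg h)

/-- Functions on `[0, T]` whose first two derivatives behave like those of `t ^ α` near `0`. -/
structure WeaklySingular (α K T : ℝ) (u : ℝ → ℝ) : Prop where
  nonneg : 0 ≤ K
  continuousOn : ContinuousOn u (Icc 0 T)
  hasDerivAt : ∀ s ∈ Ioo 0 T, HasDerivAt u (deriv u s) s
  hasDerivAt_deriv : ∀ s ∈ Ioo 0 T, HasDerivAt (deriv u) (deriv (deriv u) s) s
  abs_deriv_le : ∀ s ∈ Ioo 0 T, |deriv u s| ≤ K * s ^ (α - 1)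
  abs_deriv_deriv_le : ∀ s ∈ Ioo 0 T, |deriv (deriv u) s| ≤ K * s ^ (α - 2)

theorem one_add_rpow_le {T s p : ℝ} (hp : p ≤ 0) (hs : s ∈ Ioo 0 T) :
    1 + s ^ p ≤ (1 + T ^ (-p)) * s ^ p := by
  have h1 : 0 < s ^ p := Real.rpow_pos_of_pos hs.1 _
  have h2 : s ^ (-p) ≤ T ^ (-p) := Real.rpow_le_rpow hs.1.le hs.2.le (by linarith)
  have h3 : s ^ (-p) * s ^ p = 1 := by
    rw [← Real.rpow_add hs.1, neg_add_cancel, Real.rpow_zero]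
  nlinarith [mul_le_mul_of_nonneg_right h2 h1.le]

theorem weaklySingular_of_contDiffOn {α T Cu : ℝ} (hα1 : α < 1) (hT : 0 < T) (hCu : 0 < Cu)
    {u : ℝ → ℝ} (hc : ContinuousOn u (Icc 0 T)) (hd : ContDiffOn ℝ 2 u (Ioc 0 T))
    (h1 : ∀ s ∈ Ioc (0 : ℝ) T, |deriv u s| ≤ Cu * (1 + s ^ (α - 1)))
    (h2 : ∀ s ∈ Ioc (0 : ℝ) T, |deriv (deriv u) s| ≤ Cu * (1 + s ^ (α - 2))) :
    WeaklySingular α (Cu * ((1 + T ^ (1 - α)) + (1 + T ^ (2 - α)))) T u := by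
  have hp1 : 0 < T ^ (1 - α) := Real.rpow_pos_of_pos hT _
  have hp2 : 0 < T ^ (2 - α) := Real.rpow_pos_of_pos hT _
  have hd' : ContDiffOn ℝ 2 u (Ioo 0 T) := hd.mono Ioo_subset_Ioc_self
  have hd1 : ContDiffOn ℝ 1 (deriv u) (Ioo 0 T) :=
    hd'.deriv_of_isOpen isOpen_Ioo (by norm_num)
  refine ⟨by positivity, hc, fun s hs => ?_, fun s hs => ?_, fun s hs => ?_, fun s hs => ?_⟩
  · exact ((hd'.differentiableOn (by norm_num)).differentiableAt
      (isOpen_Ioo.mem_nhds hs)).hasDerivAt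
  · exact ((hd1.differentiableOn (by norm_num)).differentiableAt
      (isOpen_Ioo.mem_nhds hs)).hasDerivAt
  · have h3 := one_add_rpow_le (p := α - 1) (by linarith) hs
    rw [neg_sub] at h3
    have h4 : 0 < s ^ (α - 1) := Real.rpow_pos_of_pos hs.1 _
    refine (h1 s ⟨hs.1, hs.2.le⟩).trans ?_
    rw [mul_assoc]
    refine mul_le_mul_of_nonneg_left (h3.trans ?_) hCu.le
    exact mul_le_mul_of_nonneg_right (by linarith) h4.le
  · have h3 := one_add_rpow_le (p := α - 2) (by linarith) hs
    rw [neg_sub] at h3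
    have h4 : 0 < s ^ (α - 2) := Real.rpow_pos_of_pos hs.1 _
    refine (h2 s ⟨hs.1, hs.2.le⟩).trans ?_
    rw [mul_assoc]
    refine mul_le_mul_of_nonneg_left (h3.trans ?_) hCu.le
    exact mul_le_mul_of_nonneg_right (by linarith) h4.le

namespace WeaklySingular

variable {α K T : ℝ} {u : ℝ → ℝ}

theorem intervalIntegrable_deriv (hu : WeaklySingular α K T u) (hα0 : 0 < α) {a b : ℝ}
    (ha : 0 ≤ a) (hab : a ≤ b) (hb : b ≤ T) : IntervalIntegrable (deriv u) volume a b :=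
  intervalIntegrable_of_abs_le_Ioo hab (measurable_deriv u)
    ((intervalIntegral.intervalIntegrable_rpow' (by linarith)).const_mul K)
    fun s hs => hu.abs_deriv_le s ⟨ha.trans_lt hs.1, hs.2.trans_le hb⟩

theorem integral_deriv (hu : WeaklySingular α K T u) (hα0 : 0 < α) {a b : ℝ}
    (ha : 0 ≤ a) (hab : a ≤ b) (hb : b ≤ T) : ∫ s in a..b, deriv u s = u b - u a :=
  intervalIntegral.integral_eq_sub_of_hasDerivAt_of_le hab
    (hu.continuousOn.mono (Icc_subset_Icc ha hb))
    (fun s hs => hu.hasDerivAt s ⟨ha.trans_lt hs.1, hs.2.trans_le hb⟩)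
    (hu.intervalIntegrable_deriv hα0 ha hab hb)

theorem integral_abs_deriv_le (hu : WeaklySingular α K T u) (hα0 : 0 < α) {b : ℝ}
    (hb0 : 0 ≤ b) (hb : b ≤ T) : ∫ s in (0 : ℝ)..b, |deriv u s| ≤ K * (b ^ α / α) := by
  have hI := hu.intervalIntegrable_deriv hα0 le_rfl hb0 hb
  have hg : IntervalIntegrable (fun s : ℝ => K * s ^ (α - 1)) volume 0 b :=
    (intervalIntegral.intervalIntegrable_rpow' (by linarith)).const_mul K
  have h := intervalIntegral.integral_mono_on_of_le_Ioo hb0 hI.abs hg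
    fun s hs => hu.abs_deriv_le s ⟨hs.1, hs.2.trans_le hb⟩
  rw [intervalIntegral.integral_const_mul, integral_rpow (Or.inl (by linarith)),
    sub_add_cancel, Real.zero_rpow hα0.ne', sub_zero] at h
  exact h

theorem abs_sub_zero_le (hu : WeaklySingular α K T u) (hα0 : 0 < α) {b : ℝ}
    (hb0 : 0 ≤ b) (hb : b ≤ T) : |u b - u 0| ≤ K * (b ^ α / α) := by
  rw [← hu.integral_deriv hα0 le_rfl hb0 hb]
  exact (intervalIntegral.abs_integral_le_integral_abs hb0).trans
    (hu.integral_abs_deriv_le hα0 hb0 hb)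

/-- On a cell away from the origin the derivative is close to the difference quotient. -/
theorem abs_deriv_sub_slope_le (hu : WeaklySingular α K T u) (hα1 : α < 1) {a b s : ℝ}
    (ha : 0 < a) (hb : b ≤ T) (hs : s ∈ Ioo a b) :
    |deriv u s - (u b - u a) / (b - a)| ≤ K * a ^ (α - 2) * (b - a) := by
  have hsub : ∀ x ∈ Ioo a b, x ∈ Ioo 0 T := fun x hx => ⟨ha.trans hx.1, hx.2.trans_le hb⟩
  obtain ⟨ξ, hξ, hξe⟩ := exists_hasDerivAt_eq_slope u (deriv u) (hs.1.trans hs.2)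
    (hu.continuousOn.mono (Icc_subset_Icc ha.le hb)) (fun x hx => hu.hasDerivAt x (hsub x hx))
  have hbound : ∀ x ∈ Ioo a b, ‖deriv (deriv u) x‖ ≤ K * a ^ (α - 2) := fun x hx =>
    (hu.abs_deriv_deriv_le x (hsub x hx)).trans (mul_le_mul_of_nonneg_left
      (Real.rpow_le_rpow_of_nonpos ha hx.1.le (by linarith)) hu.nonneg)
  have h := (convex_Ioo a b).norm_image_sub_le_of_norm_hasDerivWithin_le
    (fun x hx => (hu.hasDerivAt_deriv x (hsub x hx)).hasDerivWithinAt) hbound hξ hs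
  rw [Real.norm_eq_abs, Real.norm_eq_abs, hξe] at h
  refine h.trans (mul_le_mul_of_nonneg_left ?_
    (mul_nonneg hu.nonneg (Real.rpow_nonneg ha.le _)))
  exact abs_le.2 ⟨by linarith [hs.1, hξ.2], by linarith [hs.2, hξ.1]⟩

theorem integral_abs_deriv_sub_slope_le (hu : WeaklySingular α K T u) (hα0 : 0 < α)
    (hα1 : α < 1) {a b : ℝ} (ha : 0 < a) (hab : a < b) (hb : b ≤ T) :
    ∫ s in a..b, |deriv u s - (u b - u a) / (b - a)| ≤ K * a ^ (α - 2) * (b - a) ^ 2 := by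
  have h := intervalIntegral.integral_mono_on_of_le_Ioo hab.le
    ((hu.intervalIntegrable_deriv hα0 ha.le hab.le hb).sub
      (intervalIntegrable_const (c := (u b - u a) / (b - a)))).abs
    (intervalIntegrable_const (c := K * a ^ (α - 2) * (b - a)))
    fun s hs => hu.abs_deriv_sub_slope_le hα1 ha hb hs
  rw [intervalIntegral.integral_const, smul_eq_mul] at h
  refine h.trans_eq (by ring)

theorem integral_abs_deriv_sub_slope_zero_le (hu : WeaklySingular α K T u) (hα0 : 0 < α)
    {b : ℝ} (hb0 : 0 < b) (hb : b ≤ T) :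
    ∫ s in (0 : ℝ)..b, |deriv u s - (u b - u 0) / (b - 0)| ≤ 2 * K / α * b ^ α := by
  have hI := (hu.intervalIntegrable_deriv hα0 le_rfl hb0.le hb)
  have hc : IntervalIntegrable (fun _ : ℝ => |(u b - u 0) / (b - 0)|) volume 0 b :=
    intervalIntegrable_const
  have h := intervalIntegral.integral_mono_on_of_le_Ioo hb0.le
    (hI.sub (intervalIntegrable_const (c := (u b - u 0) / (b - 0)))).abs
    (hI.abs.add hc) fun s _ => abs_sub (deriv u s) _
  have he : ∫ s in (0 : ℝ)..b, (|deriv u s| + |(u b - u 0) / (b - 0)|) =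
      (∫ s in (0 : ℝ)..b, |deriv u s|) + |u b - u 0| := by
    rw [intervalIntegral.integral_add hI.abs hc, intervalIntegral.integral_const, smul_eq_mul,
      sub_zero, abs_div, abs_of_pos hb0, mul_div_cancel₀ _ hb0.ne']
  refine (h.trans_eq he).trans ?_
  have h1 := hu.integral_abs_deriv_le hα0 hb0.le hb
  have h2 := hu.abs_sub_zero_le hα0 hb0.le hb
  calc _ ≤ K * (b ^ α / α) + K * (b ^ α / α) := add_le_add h1 h2
    _ = _ := by ring

end WeaklySingular

theorem kernel_mul_rpow_le {α : ℝ} (hα0 : 0 < α) (hα1 : α < 1) {x s : ℝ} (hs : s ∈ Ioo 0 x) :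
    (x - s) ^ (-α) * s ^ (α - 1) ≤
      (x / 2) ^ (-α) * s ^ (α - 1) + (x / 2) ^ (α - 1) * (x - s) ^ (-α) := by
  have hx : 0 < x := hs.1.trans hs.2
  have h1 : 0 < s ^ (α - 1) := Real.rpow_pos_of_pos hs.1 _
  have h2 : 0 < (x - s) ^ (-α) := Real.rpow_pos_of_pos (sub_pos.2 hs.2) _
  have h3 : 0 < (x / 2) ^ (-α) := Real.rpow_pos_of_pos (by linarith) _
  have h4 : 0 < (x / 2) ^ (α - 1) := Real.rpow_pos_of_pos (by linarith) _
  rcases le_total s (x / 2) with h | h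
  · have h5 : (x - s) ^ (-α) ≤ (x / 2) ^ (-α) :=
      Real.rpow_le_rpow_of_nonpos (by linarith) (by linarith) (by linarith)
    nlinarith [mul_le_mul_of_nonneg_right h5 h1.le, mul_pos h4 h2]
  · have h5 : s ^ (α - 1) ≤ (x / 2) ^ (α - 1) :=
      Real.rpow_le_rpow_of_nonpos (by linarith) (by linarith) (by linarith)
    nlinarith [mul_le_mul_of_nonneg_right h5 h2.le, mul_pos h3 h1]

theorem integral_kernel_majorant {α : ℝ} (hα0 : 0 < α) (hα1 : α < 1) {x : ℝ} (hx : 0 < x) :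
    ∫ s in (0 : ℝ)..x, ((x / 2) ^ (-α) * s ^ (α - 1) + (x / 2) ^ (α - 1) * (x - s) ^ (-α)) =
      2 ^ α / α + 2 ^ (1 - α) / (1 - α) := by
  rw [intervalIntegral.integral_add
      ((intervalIntegral.intervalIntegrable_rpow' (by linarith)).const_mul _)
      ((intervalIntegrable_kernel hα1 0 x x).const_mul _),
    intervalIntegral.integral_const_mul, intervalIntegral.integral_const_mul,
    integral_kernel hα1, integral_rpow (Or.inl (by linarith)), sub_add_cancel,
    Real.zero_rpow hα0.ne', sub_zero, sub_zero]
  have e1 : (x / 2) ^ (-α) * x ^ α = 2 ^ α := by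
    rw [Real.rpow_neg (by linarith), Real.div_rpow hx.le zero_le_two]
    have := Real.rpow_pos_of_pos hx α
    field_simp
  have e2 : (x / 2) ^ (α - 1) * x ^ (1 - α) = 2 ^ (1 - α) := by
    rw [show α - 1 = -(1 - α) by ring, Real.rpow_neg (by linarith),
      Real.div_rpow hx.le zero_le_two]
    have := Real.rpow_pos_of_pos hx (1 - α)
    field_simp
  rw [← e1, ← e2]
  ring

namespace WeaklySingular

variable {α K T : ℝ} {u : ℝ → ℝ}

theorem measurable_kernel_mul_deriv (α x : ℝ) (u : ℝ → ℝ) :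
    Measurable fun s : ℝ => (x - s) ^ (-α) * deriv u s :=
  ((measurable_const.sub measurable_id).pow_const _).mul (measurable_deriv u)

theorem abs_kernel_mul_deriv_le (hu : WeaklySingular α K T u) (hα0 : 0 < α) (hα1 : α < 1)
    {x s : ℝ} (hx : x ≤ T) (hs : s ∈ Ioo 0 x) :
    |(x - s) ^ (-α) * deriv u s| ≤
      K * ((x / 2) ^ (-α) * s ^ (α - 1) + (x / 2) ^ (α - 1) * (x - s) ^ (-α)) := by
  have h2 : 0 < (x - s) ^ (-α) := Real.rpow_pos_of_pos (sub_pos.2 hs.2) _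
  rw [abs_mul, abs_of_pos h2]
  calc _ ≤ (x - s) ^ (-α) * (K * s ^ (α - 1)) :=
        mul_le_mul_of_nonneg_left (hu.abs_deriv_le s ⟨hs.1, hs.2.trans_le hx⟩) h2.le
    _ = K * ((x - s) ^ (-α) * s ^ (α - 1)) := by ring
    _ ≤ _ := mul_le_mul_of_nonneg_left (kernel_mul_rpow_le hα0 hα1 hs) hu.nonneg

theorem intervalIntegrable_majorant (hα0 : 0 < α) (hα1 : α < 1) (x : ℝ) :
    IntervalIntegrable (fun s : ℝ =>
      K * ((x / 2) ^ (-α) * s ^ (α - 1) + (x / 2) ^ (α - 1) * (x - s) ^ (-α))) volume 0 x :=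
  (((intervalIntegral.intervalIntegrable_rpow' (by linarith)).const_mul _).add
      ((intervalIntegrable_kernel hα1 0 x x).const_mul _)).const_mul K

theorem intervalIntegrable_kernel_mul_deriv (hu : WeaklySingular α K T u) (hα0 : 0 < α)
    (hα1 : α < 1) {a b x : ℝ} (ha : 0 ≤ a) (hab : a ≤ b) (hbx : b ≤ x) (hx : x ≤ T) :
    IntervalIntegrable (fun s : ℝ => (x - s) ^ (-α) * deriv u s) volume a b := by
  have hx0 : 0 ≤ x := ha.trans (hab.trans hbx)
  have h : IntervalIntegrable (fun s : ℝ => (x - s) ^ (-α) * deriv u s) volume 0 x :=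
    intervalIntegrable_of_abs_le_Ioo hx0 (measurable_kernel_mul_deriv α x u)
      (intervalIntegrable_majorant hα0 hα1 x)
      fun s hs => hu.abs_kernel_mul_deriv_le hα0 hα1 hx hs
  refine h.mono_set ?_
  rw [uIcc_of_le hab, uIcc_of_le hx0]
  exact Icc_subset_Icc ha hbx

end WeaklySingular

/-- Contribution of the cell `[a, b]` to the L1 truncation error at `x`. -/
noncomputable def cellError (α : ℝ) (u : ℝ → ℝ) (a b x : ℝ) : ℝ :=
  (∫ s in a..b, (x - s) ^ (-α) * deriv u s) -
    (u b - u a) / (b - a) * ∫ s in a..b, (x - s) ^ (-α)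

namespace WeaklySingular

variable {α K T : ℝ} {u : ℝ → ℝ}

theorem cellError_eq (hu : WeaklySingular α K T u) (hα0 : 0 < α) (hα1 : α < 1) {a b x : ℝ}
    (ha : 0 ≤ a) (hab : a < b) (hbx : b ≤ x) (hx : x ≤ T) (c : ℝ) :
    IntervalIntegrable
      (fun s => ((x - s) ^ (-α) - c) * (deriv u s - (u b - u a) / (b - a))) volume a b ∧
    cellError α u a b x =
      ∫ s in a..b, ((x - s) ^ (-α) - c) * (deriv u s - (u b - u a) / (b - a)) := by
  have hba : b - a ≠ 0 := (sub_pos.2 hab).ne'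
  set d := (u b - u a) / (b - a) with hd
  have hk := intervalIntegrable_kernel hα1 a b x
  have hf := hu.intervalIntegrable_deriv hα0 ha hab.le (hbx.trans hx)
  have hkf := hu.intervalIntegrable_kernel_mul_deriv hα0 hα1 ha hab.le hbx hx
  have h1 := hkf.sub (hk.const_mul d)
  have h2 := (hf.sub (intervalIntegrable_const (c := d))).const_mul c
  have he : (fun s => ((x - s) ^ (-α) - c) * (deriv u s - d)) =
      fun s => ((x - s) ^ (-α) * deriv u s - d * (x - s) ^ (-α)) - c * (deriv u s - d) := by
    funext s; ring
  refine ⟨by rw [he]; exact h1.sub h2, ?_⟩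
  rw [he, intervalIntegral.integral_sub h1 h2, intervalIntegral.integral_sub hkf (hk.const_mul d),
    intervalIntegral.integral_const_mul, intervalIntegral.integral_const_mul,
    intervalIntegral.integral_sub hf intervalIntegrable_const,
    intervalIntegral.integral_const, hu.integral_deriv hα0 ha hab.le (hbx.trans hx), smul_eq_mul,
    hd, mul_div_cancel₀ _ hba, sub_self, mul_zero, sub_zero, cellError]

theorem abs_cellError_le (hu : WeaklySingular α K T u) (hα0 : 0 < α) (hα1 : α < 1)
    {a b x : ℝ} (ha : 0 ≤ a) (hab : a < b) (hbx : b < x) (hx : x ≤ T) :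
    |cellError α u a b x| ≤ ((x - b) ^ (-α) - (x - a) ^ (-α)) *
      ∫ s in a..b, |deriv u s - (u b - u a) / (b - a)| := by
  obtain ⟨hI, he⟩ := hu.cellError_eq hα0 hα1 ha hab hbx.le hx ((x - a) ^ (-α))
  rw [he, ← intervalIntegral.integral_const_mul]
  refine abs_integral_le_of_abs_le_Ioo hab.le hI
    ((((hu.intervalIntegrable_deriv hα0 ha hab.le (hbx.le.trans hx)).sub
      intervalIntegrable_const).abs).const_mul _) fun s hs => ?_
  have h1 := kernel_antitone hα0 hs.1.le (hs.2.trans hbx)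
  have h2 := kernel_antitone hα0 hs.2.le hbx
  rw [abs_mul, abs_of_nonneg (sub_nonneg.2 h1)]
  exact mul_le_mul_of_nonneg_right (by linarith) (abs_nonneg _)

theorem abs_cellError_self_le (hu : WeaklySingular α K T u) (hα0 : 0 < α) (hα1 : α < 1)
    {a x : ℝ} (ha : 0 < a) (hax : a < x) (hx : x ≤ T) :
    |cellError α u a x x| ≤ K * a ^ (α - 2) * (x - a) * ((x - a) ^ (1 - α) / (1 - α)) := by
  obtain ⟨hI, he⟩ := hu.cellError_eq hα0 hα1 ha.le hax le_rfl hx 0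
  rw [he, ← integral_kernel hα1, ← intervalIntegral.integral_const_mul]
  refine abs_integral_le_of_abs_le_Ioo hax.le hI
    ((intervalIntegrable_kernel hα1 a x x).const_mul _) fun s hs => ?_
  have h1 : 0 < (x - s) ^ (-α) := Real.rpow_pos_of_pos (sub_pos.2 hs.2) _
  rw [sub_zero, abs_mul, abs_of_pos h1, mul_comm]
  exact mul_le_mul_of_nonneg_right (hu.abs_deriv_sub_slope_le hα1 ha hx hs) h1.le

theorem abs_cellError_zero_self_le (hu : WeaklySingular α K T u) (hα0 : 0 < α) (hα1 : α < 1)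
    {x : ℝ} (hx0 : 0 < x) (hx : x ≤ T) :
    |cellError α u 0 x x| ≤
      K * (2 ^ α / α + 2 ^ (1 - α) / (1 - α)) + K * (1 / (α * (1 - α))) := by
  refine (abs_sub _ _).trans (add_le_add ?_ ?_)
  · rw [← integral_kernel_majorant hα0 hα1 hx0, ← intervalIntegral.integral_const_mul]
    exact abs_integral_le_of_abs_le_Ioo hx0.le
      (hu.intervalIntegrable_kernel_mul_deriv hα0 hα1 le_rfl hx0.le le_rfl hx)
      (intervalIntegrable_majorant hα0 hα1 x)
      fun s hs => hu.abs_kernel_mul_deriv_le hα0 hα1 hx hs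
  · have h1 : 0 ≤ x ^ (1 - α) / (1 - α) :=
      div_nonneg (Real.rpow_nonneg hx0.le _) (by linarith)
    rw [integral_kernel hα1, sub_zero, abs_mul, abs_div, abs_of_pos hx0, abs_of_nonneg h1]
    have h2 := mul_le_mul_of_nonneg_right
      (div_le_div_of_nonneg_right (hu.abs_sub_zero_le hα0 hx0.le hx) hx0.le) h1
    refine h2.trans_eq ?_
    have h3 : x ^ α * x ^ (1 - α) = x := by
      rw [← Real.rpow_add hx0, add_sub_cancel, Real.rpow_one]
    have h4 : 1 - α ≠ 0 := by linarith
    calc K * (x ^ α / α) / x * (x ^ (1 - α) / (1 - α))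
        = K * (x ^ α * x ^ (1 - α)) / (x * (α * (1 - α))) := by
          field_simp
      _ = _ := by rw [h3]; field_simp

end WeaklySingular

/-- The truncation error is the sum of the cell contributions. -/
theorem gamma_mul_caputo_sub_deltaL1 {α K T : ℝ} (hα0 : 0 < α) (hα1 : α < 1) {u : ℝ → ℝ}
    (hu : WeaklySingular α K T u) {M : ℕ} {t : ℕ → ℝ} (hmesh : IsMesh T M t) {m : ℕ}
    (hm : m ≤ M) :
    Real.Gamma (1 - α) * (caputo α u (t m) - deltaL1 α t (fun j => u (t j)) m) =
      ∑ j ∈ Finset.range m, cellError α u (t j) (t (j + 1)) (t m) := by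
  have hG : Real.Gamma (1 - α) ≠ 0 := (Real.Gamma_pos_of_pos (by linarith)).ne'
  have hmT : t m ≤ T := hmesh.2.2.2 ▸ hmesh.le hm le_rfl
  rw [mul_sub, gamma_mul_deltaL1 hα1, caputo, ← mul_assoc, mul_one_div_cancel hG, one_mul]
  simp only [cellError]
  rw [Finset.sum_sub_distrib, intervalIntegral.sum_integral_adjacent_intervals, hmesh.2.1]
  · congr 1
    exact Finset.sum_congr rfl fun j _ => by ring
  · intro j hj
    exact hu.intervalIntegrable_kernel_mul_deriv hα0 hα1
      (hmesh.2.1 ▸ hmesh.le (Nat.zero_le j) (by omega)) (hmesh.le (by omega) (by omega))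
      (hmesh.le hj hm) hmT

theorem rpow_mul_rpow_one_sub {τ x : ℝ} (hτ : 0 < τ) (hx : 0 < x) (q : ℝ) :
    τ ^ q * x ^ (1 - q) = x * (τ / x) ^ q := by
  rw [Real.div_rpow hτ.le hx.le, Real.rpow_sub hx, Real.rpow_one]
  ring

theorem kernel_sub_le {α : ℝ} (hα1 : α < 1) {a b z : ℝ} (hab : a < b) (hbz : b < z) :
    (z - b) ^ (-α) - (z - a) ^ (-α) ≤ (z - b) ^ (-α) * ((b - a) / (z - a)) := by
  have hb : 0 < z - b := by linarith
  have ha : 0 < z - a := by linarith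
  have h1 : (z - a) ^ (-α) = (z - b) ^ (-α) * ((z - b) / (z - a)) ^ α := by
    rw [Real.div_rpow hb.le ha.le, Real.rpow_neg hb.le, Real.rpow_neg ha.le]
    have := Real.rpow_pos_of_pos hb α
    have := Real.rpow_pos_of_pos ha α
    field_simp
  have h2 : (z - b) / (z - a) ≤ ((z - b) / (z - a)) ^ α := by
    have := Real.rpow_le_rpow_of_exponent_ge (div_pos hb ha)
      ((div_le_one ha).2 (by linarith)) hα1.le
    rwa [Real.rpow_one] at this
  have h3 : (b - a) / (z - a) = 1 - (z - b) / (z - a) := by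
    field_simp; ring
  rw [h1, h3]
  nlinarith [mul_le_mul_of_nonneg_left h2 (Real.rpow_nonneg hb.le (-α))]

/-- Splitting of a weighted kernel increment into a part that telescopes with the kernel and a part
proportional to the cell length. -/
theorem weight_mul_kernel_sub_le {α β q τ a b z : ℝ} (hα0 : 0 < α) (hα1 : α < 1)
    (hq1 : q ≤ 1) (hq0 : 0 < q) (hβα : β ≤ α) (hβq : β ≤ 2 * q) (hτ : 0 < τ) (hτb : τ ≤ b)
    (hab : a < b) (hbz : b < z) :
    b ^ α * (τ / b) ^ (2 * q) * ((z - b) ^ (-α) - (z - a) ^ (-α)) ≤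
      4 * (z ^ α * (τ / z) ^ (2 * q)) * ((z - b) ^ (-α) - (z - a) ^ (-α)) +
        4 * (τ / z) ^ β / z * (b - a) := by
  have hb : 0 < b := hτ.trans_le hτb
  have hz : 0 < z := hb.trans hbz
  have hG : 0 ≤ (z - b) ^ (-α) - (z - a) ^ (-α) :=
    sub_nonneg.2 (kernel_antitone hα0 hab.le hbz)
  have hzα := Real.rpow_pos_of_pos hz α
  have hρ := Real.rpow_pos_of_pos (div_pos hτ hz) (2 * q)
  have hρβ := Real.rpow_pos_of_pos (div_pos hτ hz) β
  have hba : 0 < b - a := sub_pos.2 hab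
  have hbα := Real.rpow_pos_of_pos hb α
  rcases le_total b (z / 2) with h | h
  · have h1 : b ^ α * (τ / b) ^ (2 * q) ≤ z ^ α * (τ / z) ^ β := by
      calc b ^ α * (τ / b) ^ (2 * q) ≤ b ^ α * (τ / b) ^ β :=
            mul_le_mul_of_nonneg_left (Real.rpow_le_rpow_of_exponent_ge (div_pos hτ hb)
              ((div_le_one hb).2 hτb) hβq) hbα.le
        _ = τ ^ β * b ^ (α - β) := by
            rw [Real.div_rpow hτ.le hb.le, Real.rpow_sub hb]; ring
        _ ≤ τ ^ β * z ^ (α - β) :=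
            mul_le_mul_of_nonneg_left (Real.rpow_le_rpow hb.le hbz.le (by linarith))
              (Real.rpow_nonneg hτ.le _)
        _ = z ^ α * (τ / z) ^ β := by
            rw [Real.div_rpow hτ.le hz.le, Real.rpow_sub hz]; ring
    have h2 : (z - b) ^ (-α) ≤ 2 * z ^ (-α) := by
      calc (z - b) ^ (-α) ≤ (z / 2) ^ (-α) :=
            Real.rpow_le_rpow_of_nonpos (by linarith) (by linarith) (by linarith)
        _ = 2 ^ α * z ^ (-α) := by
            rw [Real.div_rpow hz.le zero_le_two, Real.rpow_neg zero_le_two]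
            field_simp
        _ ≤ 2 ^ (1 : ℝ) * z ^ (-α) :=
            mul_le_mul_of_nonneg_right
              (Real.rpow_le_rpow_of_exponent_le one_le_two hα1.le) (Real.rpow_nonneg hz.le _)
        _ = 2 * z ^ (-α) := by rw [Real.rpow_one]
    have h3 : (b - a) / (z - a) ≤ 2 * (b - a) / z := by
      rw [div_le_div_iff₀ (by linarith) hz]
      nlinarith
    have h4 : (z - b) ^ (-α) - (z - a) ^ (-α) ≤ 2 * z ^ (-α) * (2 * (b - a) / z) :=
      (kernel_sub_le hα1 hab hbz).trans (mul_le_mul h2 h3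
        (div_nonneg hba.le (by linarith)) (mul_nonneg zero_le_two (Real.rpow_nonneg hz.le _)))
    have h5 : z ^ α * z ^ (-α) = 1 := by
      rw [← Real.rpow_add hz, add_neg_cancel, Real.rpow_zero]
    have h6 := mul_le_mul h1 h4 hG (mul_nonneg hzα.le hρβ.le)
    have h7 : z ^ α * (τ / z) ^ β * (2 * z ^ (-α) * (2 * (b - a) / z)) =
        4 * (τ / z) ^ β / z * (b - a) := by
      calc _ = (z ^ α * z ^ (-α)) * (4 * (τ / z) ^ β / z * (b - a)) := by ring
        _ = _ := by rw [h5, one_mul]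
    have h8 : 0 ≤ 4 * (z ^ α * (τ / z) ^ (2 * q)) * ((z - b) ^ (-α) - (z - a) ^ (-α)) := by
      positivity
    linarith
  · have h1 : (τ / b) ^ (2 * q) ≤ 4 * (τ / z) ^ (2 * q) := by
      calc (τ / b) ^ (2 * q) ≤ (2 * (τ / z)) ^ (2 * q) := by
            refine Real.rpow_le_rpow (div_pos hτ hb).le ?_ (by linarith)
            rw [← mul_div_assoc, div_le_div_iff₀ hb hz]
            nlinarith
        _ = 2 ^ (2 * q) * (τ / z) ^ (2 * q) :=
            Real.mul_rpow zero_le_two (div_pos hτ hz).le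
        _ ≤ 2 ^ (2 : ℝ) * (τ / z) ^ (2 * q) :=
            mul_le_mul_of_nonneg_right
              (Real.rpow_le_rpow_of_exponent_le one_le_two (by linarith)) hρ.le
        _ = 4 * (τ / z) ^ (2 * q) := by norm_num
    have h2 : b ^ α ≤ z ^ α := Real.rpow_le_rpow hb.le hbz.le hα0.le
    have h3 : b ^ α * (τ / b) ^ (2 * q) ≤ 4 * (z ^ α * (τ / z) ^ (2 * q)) := by
      refine (mul_le_mul h2 h1 (Real.rpow_nonneg (div_pos hτ hb).le _) hzα.le).trans_eq (by ring)
    have h4 : 0 ≤ 4 * (τ / z) ^ β / z * (b - a) := by positivity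
    linarith [mul_le_mul_of_nonneg_right h3 hG]

section Mesh

variable {α r T c0 C0 : ℝ} {M : ℕ} {t : ℕ → ℝ}

theorem IsMesh.pos (hmesh : IsMesh T M t) {j : ℕ} (hj0 : 0 < j) (hj : j ≤ M) : 0 < t j :=
  hmesh.2.1 ▸ hmesh.lt hj0 hj

theorem IsMesh.le_end (hmesh : IsMesh T M t) {j : ℕ} (hj : j ≤ M) : t j ≤ T :=
  hmesh.2.2.2 ▸ hmesh.le hj le_rfl

theorem QuasiGraded.step_bounds (hq : QuasiGraded r c0 C0 M t) (hmesh : IsMesh T M t) {j : ℕ}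
    (hj : j < M) :
    c0 * (t (j + 1) * (t 1 / t (j + 1)) ^ (1 / r)) ≤ t (j + 1) - t j ∧
      t (j + 1) - t j ≤ C0 * (t (j + 1) * (t 1 / t (j + 1)) ^ (1 / r)) := by
  have h := hq.2.2 (j + 1) (by omega) hj
  rwa [Nat.add_sub_cancel, rpow_mul_rpow_one_sub (hmesh.pos one_pos (by omega))
    (hmesh.pos (by omega) hj)] at h

theorem QuasiGraded.succ_le (hq : QuasiGraded r c0 C0 M t) (hmesh : IsMesh T M t)
    (hr : 0 ≤ r) (hc0 : 0 < c0) (hC0 : 0 < C0) {j : ℕ} (hj0 : 1 ≤ j) (hj : j < M) :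
    t (j + 1) ≤ C0 / c0 * 2 ^ r * t j := by
  have hτ : 0 < t 1 := hmesh.pos one_pos (by omega)
  have h1 := (hq.2.1 (j + 1) (by omega) hj).2
  have h2 := (hq.2.1 j hj0 hj.le).1
  have hj1 : (1 : ℝ) ≤ j := by exact_mod_cast hj0
  have h3 : ((j + 1 : ℕ) : ℝ) ^ r ≤ 2 ^ r * (j : ℝ) ^ r := by
    rw [← Real.mul_rpow zero_le_two (by linarith)]
    refine Real.rpow_le_rpow (by positivity) ?_ hr
    push_cast
    linarith
  have h4 : t 1 * (j : ℝ) ^ r ≤ t j / c0 := by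
    rw [le_div_iff₀ hc0]; linarith
  calc t (j + 1) ≤ C0 * (t 1 * ((j + 1 : ℕ) : ℝ) ^ r) := h1
    _ ≤ C0 * (t 1 * (2 ^ r * (j : ℝ) ^ r)) := by gcongr
    _ = C0 * 2 ^ r * (t 1 * (j : ℝ) ^ r) := by ring
    _ ≤ C0 * 2 ^ r * (t j / c0) := by gcongr
    _ = _ := by ring

theorem QuasiGraded.rpow_mul_step_sq_le (hq : QuasiGraded r c0 C0 M t) (hmesh : IsMesh T M t)
    (hα1 : α < 1) (hr : 0 ≤ r) (hc0 : 0 < c0) (hC0 : 0 < C0) {j : ℕ} (hj0 : 1 ≤ j) (hj : j < M) :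
    t j ^ (α - 2) * (t (j + 1) - t j) ^ 2 ≤
      (C0 / c0 * 2 ^ r) ^ (2 - α) * C0 ^ 2 *
        (t (j + 1) ^ α * (t 1 / t (j + 1)) ^ (2 * (1 / r))) := by
  have hτ : 0 < t 1 := hmesh.pos one_pos (by omega)
  have ha : 0 < t j := hmesh.pos hj0 hj.le
  have hb : 0 < t (j + 1) := hmesh.pos (by omega) hj
  have hstep : 0 ≤ t (j + 1) - t j := sub_nonneg.2 (hmesh.le (by omega) hj)
  have hC1 : 0 < C0 / c0 * 2 ^ r := by positivity
  set C1 := C0 / c0 * 2 ^ r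
  have hρ : 0 < t 1 / t (j + 1) := div_pos hτ hb
  have h1 : t j ^ (α - 2) ≤ C1 ^ (2 - α) * t (j + 1) ^ (α - 2) := by
    have h := Real.rpow_le_rpow_of_nonpos (z := α - 2) (div_pos hb hC1)
      ((div_le_iff₀' hC1).2 (hq.succ_le hmesh hr hc0 hC0 hj0 hj)) (by linarith)
    rwa [Real.div_rpow hb.le hC1.le, div_eq_mul_inv, ← Real.rpow_neg hC1.le, neg_sub,
      mul_comm] at h
  have h2 : (t (j + 1) - t j) ^ 2 ≤ (C0 * (t (j + 1) * (t 1 / t (j + 1)) ^ (1 / r))) ^ 2 :=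
    pow_le_pow_left₀ hstep (hq.step_bounds hmesh hj).2 2
  have h3 : ((t 1 / t (j + 1)) ^ (1 / r)) ^ 2 = (t 1 / t (j + 1)) ^ (2 * (1 / r)) := by
    rw [← Real.rpow_natCast, ← Real.rpow_mul hρ.le]
    congr 1
    push_cast
    ring
  have h4 : t (j + 1) ^ (α - 2) * t (j + 1) ^ 2 = t (j + 1) ^ α := by
    rw [← Real.rpow_natCast (t (j + 1)) 2, ← Real.rpow_add hb]
    congr 1
    push_cast
    ring
  refine (mul_le_mul h1 h2 (sq_nonneg _) (by positivity)).trans_eq ?_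
  rw [← h3, ← h4]
  ring

theorem QuasiGraded.weight_mul_step_rpow_le {β : ℝ} (hq : QuasiGraded r c0 C0 M t)
    (hmesh : IsMesh T M t) (hα0 : 0 < α) (hβ : β ≤ (2 - α) * (1 / r)) (hc0 : 0 < c0) {j : ℕ}
    (hj : j < M) :
    t (j + 1) ^ α * (t 1 / t (j + 1)) ^ (2 * (1 / r)) * (t (j + 1) - t j) ^ (-α) ≤
      c0 ^ (-α) * (t 1 / t (j + 1)) ^ β := by
  have hτ : 0 < t 1 := hmesh.pos one_pos (by omega)
  have hb : 0 < t (j + 1) := hmesh.pos (by omega) hj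
  have hρ : 0 < t 1 / t (j + 1) := div_pos hτ hb
  have hρ1 : t 1 / t (j + 1) ≤ 1 := (div_le_one hb).2 (hmesh.le (by omega) hj)
  have hstep : 0 < t (j + 1) - t j := sub_pos.2 (hmesh.lt (by omega) hj)
  have hlow := (hq.step_bounds hmesh hj).1
  set ρ := t 1 / t (j + 1)
  set z := t (j + 1)
  have hρq := Real.rpow_pos_of_pos hρ (1 / r)
  have h1 : (z - t j) ^ (-α) ≤ c0 ^ (-α) * (z ^ (-α) * ρ ^ (-(α * (1 / r)))) := by
    have h := Real.rpow_le_rpow_of_nonpos (z := -α) (by positivity) hlow (by linarith)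
    rwa [Real.mul_rpow hc0.le (by positivity), Real.mul_rpow hb.le hρq.le,
      ← Real.rpow_mul hρ.le, show 1 / r * -α = -(α * (1 / r)) by ring] at h
  have h2 : z ^ α * z ^ (-α) = 1 := by
    rw [← Real.rpow_add hb, add_neg_cancel, Real.rpow_zero]
  calc z ^ α * ρ ^ (2 * (1 / r)) * (z - t j) ^ (-α)
      ≤ z ^ α * ρ ^ (2 * (1 / r)) * (c0 ^ (-α) * (z ^ (-α) * ρ ^ (-(α * (1 / r))))) := by
        gcongr
    _ = c0 ^ (-α) * (z ^ α * z ^ (-α)) * (ρ ^ (2 * (1 / r)) * ρ ^ (-(α * (1 / r)))) := by ring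
    _ = c0 ^ (-α) * ρ ^ ((2 - α) * (1 / r)) := by
        rw [h2, mul_one, ← Real.rpow_add hρ]
        congr 2
        ring
    _ ≤ c0 ^ (-α) * ρ ^ β := by
        have := Real.rpow_le_rpow_of_exponent_ge hρ hρ1 hβ
        gcongr

theorem WeaklySingular.integral_abs_deriv_sub_slope_mesh_le {K : ℝ} {u : ℝ → ℝ}
    (hu : WeaklySingular α K T u) (hq : QuasiGraded r c0 C0 M t) (hmesh : IsMesh T M t)
    (hα0 : 0 < α) (hα1 : α < 1) (hr : 0 ≤ r) (hc0 : 0 < c0) (hC0 : 0 < C0) {j : ℕ} (hj : j < M) :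
    ∫ s in (t j)..(t (j + 1)), |deriv u s - (u (t (j + 1)) - u (t j)) / (t (j + 1) - t j)| ≤
      (2 * K / α + K * ((C0 / c0 * 2 ^ r) ^ (2 - α) * C0 ^ 2)) *
        (t (j + 1) ^ α * (t 1 / t (j + 1)) ^ (2 * (1 / r))) := by
  have hK := hu.nonneg
  have hb : 0 < t (j + 1) := hmesh.pos (by omega) hj
  have hτ : 0 < t 1 := hmesh.pos one_pos (by omega)
  have hC2 : 0 ≤ K * ((C0 / c0 * 2 ^ r) ^ (2 - α) * C0 ^ 2) := by positivity
  have hw : 0 ≤ t (j + 1) ^ α * (t 1 / t (j + 1)) ^ (2 * (1 / r)) := by positivity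
  rcases Nat.eq_zero_or_pos j with rfl | hj0
  · have h := hu.integral_abs_deriv_sub_slope_zero_le hα0 hb (hmesh.le_end hj)
    rw [hmesh.2.1]
    simp only [zero_add] at h hw ⊢
    rw [div_self hτ.ne', Real.one_rpow, mul_one] at hw ⊢
    refine h.trans ?_
    rw [add_mul]
    exact le_add_of_nonneg_right (mul_nonneg hC2 hw)
  · have h := hu.integral_abs_deriv_sub_slope_le hα0 hα1 (hmesh.pos hj0 hj.le)
      (hmesh.lt (Nat.lt_succ_self j) hj) (hmesh.le_end hj)
    refine h.trans ?_
    rw [mul_assoc, add_mul]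
    have h1 := mul_le_mul_of_nonneg_left
      (hq.rpow_mul_step_sq_le hmesh hα1 hr hc0 hC0 hj0 hj) hK
    have h2 : 0 ≤ 2 * K / α * (t (j + 1) ^ α * (t 1 / t (j + 1)) ^ (2 * (1 / r))) := by
      positivity
    rw [← mul_assoc] at h1
    linarith

theorem WeaklySingular.sum_abs_cellError_le {K β : ℝ} {u : ℝ → ℝ}
    (hu : WeaklySingular α K T u) (hq : QuasiGraded r c0 C0 M t) (hmesh : IsMesh T M t)
    (hα0 : 0 < α) (hα1 : α < 1) (hr : 1 ≤ r) (hc0 : 0 < c0) (hC0 : 0 < C0)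
    (hβα : β ≤ α) (hβ : β ≤ (2 - α) * (1 / r)) {n : ℕ} (hn : n < M) :
    ∑ j ∈ Finset.range n, |cellError α u (t j) (t (j + 1)) (t (n + 1))| ≤
      (2 * K / α + K * ((C0 / c0 * 2 ^ r) ^ (2 - α) * C0 ^ 2)) *
        (4 * c0 ^ (-α) + 4) * (t 1 / t (n + 1)) ^ β := by
  have hK := hu.nonneg
  have hτ : 0 < t 1 := hmesh.pos one_pos (by omega)
  have hz : 0 < t (n + 1) := hmesh.pos (by omega) hn
  have hr0 : 0 < r := by linarith
  have hq1 : 1 / r ≤ 1 := (div_le_one hr0).2 hr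
  have hq0 : 0 < 1 / r := by positivity
  set A := 2 * K / α + K * ((C0 / c0 * 2 ^ r) ^ (2 - α) * C0 ^ 2) with hA
  have hA0 : 0 ≤ A := by positivity
  have hstep := hq.weight_mul_step_rpow_le hmesh hα0 hβ hc0 hn
  set z := t (n + 1) with hzdef
  set W := z ^ α * (t 1 / z) ^ (2 * (1 / r)) with hW
  have hW0 : 0 ≤ W := by positivity
  have hρ : 0 ≤ (t 1 / z) ^ β := by positivity
  have hcell : ∀ j ∈ Finset.range n, |cellError α u (t j) (t (j + 1)) z| ≤
      A * (4 * W * ((z - t (j + 1)) ^ (-α) - (z - t j) ^ (-α)) +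
        4 * (t 1 / z) ^ β / z * (t (j + 1) - t j)) := by
    intro j hj
    have hjn := Finset.mem_range.1 hj
    have ha : 0 ≤ t j := hmesh.2.1 ▸ hmesh.le (Nat.zero_le j) (by omega)
    have hab : t j < t (j + 1) := hmesh.lt (by omega) (by omega)
    have hbz : t (j + 1) < z := hmesh.lt (by omega) hn
    have hG : 0 ≤ (z - t (j + 1)) ^ (-α) - (z - t j) ^ (-α) :=
      sub_nonneg.2 (kernel_antitone hα0 hab.le hbz)
    have h1 := hu.abs_cellError_le hα0 hα1 ha hab hbz (hmesh.le_end hn)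
    have h2 := mul_le_mul_of_nonneg_left (hu.integral_abs_deriv_sub_slope_mesh_le hq hmesh
      hα0 hα1 hr0.le hc0 hC0 (j := j) (by omega)) hG
    have h3 := mul_le_mul_of_nonneg_left (weight_mul_kernel_sub_le hα0 hα1 hq1 hq0 hβα
      (hβ.trans (by gcongr; linarith)) hτ (hmesh.le (by omega) (by omega)) hab hbz) hA0
    refine h1.trans (h2.trans (le_trans (le_of_eq ?_) h3))
    ring
  refine (Finset.sum_le_sum hcell).trans ?_
  rw [← Finset.mul_sum, Finset.sum_add_distrib, ← Finset.mul_sum, ← Finset.mul_sum,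
    Finset.sum_range_sub (fun j => (z - t j) ^ (-α)), Finset.sum_range_sub, hmesh.2.1,
    sub_zero, sub_zero, mul_assoc A]
  refine mul_le_mul_of_nonneg_left ?_ hA0
  have h1 : 4 * W * ((z - t n) ^ (-α) - z ^ (-α)) ≤ 4 * (c0 ^ (-α) * (t 1 / z) ^ β) := by
    have : 0 ≤ W * z ^ (-α) := by positivity
    linarith
  have h2 : 4 * (t 1 / z) ^ β / z * t n ≤ 4 * (t 1 / z) ^ β := by
    rw [div_mul_eq_mul_div, div_le_iff₀ hz]
    exact mul_le_mul_of_nonneg_left (hmesh.le (by omega) hn) (by positivity)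
  linarith

theorem WeaklySingular.abs_cellError_last_le {K β : ℝ} {u : ℝ → ℝ}
    (hu : WeaklySingular α K T u) (hq : QuasiGraded r c0 C0 M t) (hmesh : IsMesh T M t)
    (hα0 : 0 < α) (hα1 : α < 1) (hr : 0 ≤ r) (hc0 : 0 < c0) (hC0 : 0 < C0)
    (hβ : β ≤ (2 - α) * (1 / r)) {n : ℕ} (hn : n < M) :
    |cellError α u (t n) (t (n + 1)) (t (n + 1))| ≤
      (K * (2 ^ α / α + 2 ^ (1 - α) / (1 - α)) + K * (1 / (α * (1 - α))) +
        K * ((C0 / c0 * 2 ^ r) ^ (2 - α) * C0 ^ 2) * c0 ^ (-α) / (1 - α)) *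
        (t 1 / t (n + 1)) ^ β := by
  have hK := hu.nonneg
  have hα1' : 0 < 1 - α := by linarith
  have hz : 0 < t (n + 1) := hmesh.pos (by omega) hn
  have hτ : 0 < t 1 := hmesh.pos one_pos (by omega)
  have hP : 0 ≤ K * (2 ^ α / α + 2 ^ (1 - α) / (1 - α)) + K * (1 / (α * (1 - α))) := by
    positivity
  set B := (C0 / c0 * 2 ^ r) ^ (2 - α) * C0 ^ 2 with hB
  have hB0 : 0 ≤ B := by positivity
  have hQ : 0 ≤ K * B * c0 ^ (-α) / (1 - α) := by positivity
  rcases Nat.eq_zero_or_pos n with rfl | hn0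
  · have h := hu.abs_cellError_zero_self_le hα0 hα1 hz (hmesh.le_end hn)
    rw [hmesh.2.1]
    simp only [zero_add] at h ⊢
    rw [div_self hτ.ne', Real.one_rpow, mul_one]
    linarith
  · have ha := hmesh.pos hn0 hn.le
    have hs : 0 < t (n + 1) - t n := sub_pos.2 (hmesh.lt (by omega) hn)
    have h1 := hu.abs_cellError_self_le hα0 hα1 ha (sub_pos.1 hs) (hmesh.le_end hn)
    have h2 := hq.rpow_mul_step_sq_le hmesh hα1 hr hc0 hC0 hn0 hn
    have h3 := hq.weight_mul_step_rpow_le hmesh hα0 hβ hc0 hn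
    set δ := t (n + 1) - t n
    have h4 : δ ^ (1 - α) = δ * δ ^ (-α) := by
      rw [sub_eq_add_neg, Real.rpow_add hs, Real.rpow_one]
    calc |cellError α u (t n) (t (n + 1)) (t (n + 1))|
        ≤ K / (1 - α) * (t n ^ (α - 2) * δ ^ 2) * δ ^ (-α) := by
          refine h1.trans_eq ?_
          rw [h4]; ring
      _ ≤ K / (1 - α) * (B * (t (n + 1) ^ α * (t 1 / t (n + 1)) ^ (2 * (1 / r)))) *
            δ ^ (-α) := by gcongr
      _ = K / (1 - α) * B *
            (t (n + 1) ^ α * (t 1 / t (n + 1)) ^ (2 * (1 / r)) * δ ^ (-α)) := by ring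
      _ ≤ K / (1 - α) * B * (c0 ^ (-α) * (t 1 / t (n + 1)) ^ β) := by gcongr
      _ = K * B * c0 ^ (-α) / (1 - α) * (t 1 / t (n + 1)) ^ β := by ring
      _ ≤ _ := by
          refine mul_le_mul_of_nonneg_right ?_ (by positivity)
          linarith

theorem QuasiGraded.ratio_rpow_le {β : ℝ} (hq : QuasiGraded r c0 C0 M t)
    (hmesh : IsMesh T M t) (hC0 : 0 < C0) (hβ0 : 0 ≤ β) (hβα : β ≤ α) {j : ℕ} (hj0 : 0 < j)
    (hj : j ≤ M) :
    (t 1 / t j) ^ β ≤ C0 ^ β * T ^ (α - β) * (M : ℝ) ^ (-(r * β)) * t j ^ (-α) := by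
  have hτ : 0 < t 1 := hmesh.pos one_pos (by omega)
  have hz : 0 < t j := hmesh.pos hj0 hj
  have hT : 0 < T := hz.trans_le (hmesh.le_end hj)
  have hM : (0 : ℝ) ≤ M := Nat.cast_nonneg M
  have h1 : t 1 ^ β ≤ C0 ^ β * (M : ℝ) ^ (-(r * β)) := by
    have h := Real.rpow_le_rpow hτ.le hq.1.2 hβ0
    rwa [Real.mul_rpow hC0.le (Real.rpow_nonneg hM _), ← Real.rpow_mul hM, neg_mul] at h
  have h2 : t j ^ (-β) ≤ T ^ (α - β) * t j ^ (-α) := by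
    rw [show -β = (α - β) + -α by ring, Real.rpow_add hz]
    exact mul_le_mul_of_nonneg_right
      (Real.rpow_le_rpow hz.le (hmesh.le_end hj) (by linarith)) (Real.rpow_nonneg hz.le _)
  rw [Real.div_rpow hτ.le hz.le, div_eq_mul_inv, ← Real.rpow_neg hz.le]
  refine (mul_le_mul h1 h2 (Real.rpow_nonneg hz.le _) (by positivity)).trans_eq (by ring)

end Mesh

theorem deltaL1_sub (α : ℝ) (t V W : ℕ → ℝ) (m : ℕ) :
    deltaL1 α t (fun j => V j - W j) m = deltaL1 α t V m - deltaL1 α t W m := by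
  rw [deltaL1, deltaL1, deltaL1, ← mul_sub, ← Finset.sum_sub_distrib]
  congr 1
  exact Finset.sum_congr rfl fun j _ => by ring

/-- Global error bound `max_m |u(t_m) - U^m| ≲ M^{-min{αr, 2-α}}` for the L1
discretization of the initial-value problem (Remark 3.2). -/
theorem stmt13 (α r T c0 C0 Cu : ℝ)
    (hα0 : 0 < α) (hα1 : α < 1) (hr1 : 1 ≤ r)
    (hT : 0 < T) (hc0 : 0 < c0) (hcC : c0 ≤ C0) (hCu : 0 < Cu) :
    ∃ C : ℝ, 0 < C ∧
      ∀ (M : ℕ) (t : ℕ → ℝ), IsMesh T M t → QuasiGraded r c0 C0 M t →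
        ∀ u : ℝ → ℝ, ContinuousOn u (Set.Icc 0 T) → ContDiffOn ℝ 2 u (Set.Ioc 0 T) →
          (∀ s ∈ Set.Ioc (0:ℝ) T, |deriv u s| ≤ Cu * (1 + s ^ (α - 1))) →
          (∀ s ∈ Set.Ioc (0:ℝ) T, |deriv (deriv u) s| ≤ Cu * (1 + s ^ (α - 2))) →
          ∀ U : ℕ → ℝ, U 0 = u (t 0) →
            (∀ m : ℕ, 1 ≤ m → m ≤ M → deltaL1 α t U m = caputo α u (t m)) →
            ∀ m : ℕ, 1 ≤ m → m ≤ M →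
              |u (t m) - U m| ≤ C * (M : ℝ) ^ (-(min (α * r) (2 - α))) := by
  have hC0 : 0 < C0 := hc0.trans_le hcC
  have hr0 : 0 < r := by linarith
  have hα1' : 0 < 1 - α := by linarith
  set β := min α ((2 - α) * (1 / r)) with hβdef
  have hβα : β ≤ α := min_le_left _ _
  have hβr : β ≤ (2 - α) * (1 / r) := min_le_right _ _
  have hβ0 : 0 ≤ β := le_min hα0.le (mul_nonneg (by linarith) (by positivity))
  have hrβ : r * β = min (α * r) (2 - α) := by
    rw [hβdef, mul_min_of_nonneg _ _ hr0.le]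
    congr 1
    · ring
    · field_simp
  set K := Cu * ((1 + T ^ (1 - α)) + (1 + T ^ (2 - α)))
  have hK : 0 < K := by positivity
  set A := (2 * K / α + K * ((C0 / c0 * 2 ^ r) ^ (2 - α) * C0 ^ 2)) * (4 * c0 ^ (-α) + 4)
  set B := K * (2 ^ α / α + 2 ^ (1 - α) / (1 - α)) + K * (1 / (α * (1 - α))) +
    K * ((C0 / c0 * 2 ^ r) ^ (2 - α) * C0 ^ 2) * c0 ^ (-α) / (1 - α)
  have hA : 0 < A := by positivity
  have hB : 0 < B := by positivity
  refine ⟨(A + B) * (C0 ^ β * T ^ (α - β)), by positivity, ?_⟩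
  intro M t hmesh hq u hcont hdiff hd1 hd2 U hU0 hU m _ hm
  have hu := weaklySingular_of_contDiffOn hα1 hT hCu hcont hdiff hd1 hd2
  refine abs_le_of_abs_deltaL1_le (V := fun j => u (t j) - U j) hα0 hα1 hmesh (by positivity)
    (by simp [hU0]) (fun i hi hiM => ?_) m hm
  obtain ⟨n, rfl⟩ : ∃ n, i = n + 1 := ⟨i - 1, by omega⟩
  rw [deltaL1_sub, hU _ hi hiM, ← abs_neg, ← mul_neg, neg_sub,
    gamma_mul_caputo_sub_deltaL1 hα0 hα1 hu hmesh hiM, Finset.sum_range_succ]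
  have h1 := hu.sum_abs_cellError_le hq hmesh hα0 hα1 hr1 hc0 hC0 hβα hβr hiM
  have h2 := hu.abs_cellError_last_le hq hmesh hα0 hα1 hr0.le hc0 hC0 hβr hiM
  have h3 := hq.ratio_rpow_le hmesh hC0 hβ0 hβα (Nat.succ_pos n) hiM
  rw [hrβ] at h3
  calc _ ≤ _ := (abs_add_le _ _).trans (add_le_add ((Finset.abs_sum_le_sum_abs _ _).trans h1) h2)
    _ = (A + B) * (t 1 / t (n + 1)) ^ β := by ring
    _ ≤ (A + B) * _ := mul_le_mul_of_nonneg_left h3 (by positivity)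
    _ = _ := by ring
end

section
/- Let α ∈ (0,1), γ > −1, T > 0 and 0 < τ < T. Define F(t) := min{1, (τ/t)^{γ+1}} for t > 0 and v(t) := (1/Γ(α)) ∫_0^t (t−s)^{α−1} F(s) ds (the Riemann–Liouville fractional integral of F of order α). Then there exist constants c, C > 0, depending only on α, γ and T, such that for all t ∈ [τ, T]: c 𝒱(t) ≤ v(t) ≤ C 𝒱(t), where 𝒱(t) := τ t^{α−1} if γ > 0, 𝒱(t) := τ t^{α−1}(1 + ln(t/τ)) if γ = 0, and 𝒱(t) := τ t^{α−1}(τ/t)^γ if γ < 0. -/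
open Real MeasureTheory Set

lemma antitoneOn_min_one_div_rpow {γ τ : ℝ} (hγ : -1 < γ) (hτ : 0 < τ) :
    AntitoneOn (fun s : ℝ => min 1 ((τ / s) ^ (γ + 1))) (Ioi 0) := by
  intro a ha b hb hab
  have ha' : 0 < a := ha
  have hb' : 0 < b := hb
  have : 0 ≤ γ + 1 := by linarith
  dsimp only
  gcongr

lemma intervalIntegrable_sub_rpow {α : ℝ} (hα : 0 < α) (t : ℝ) :
    IntervalIntegrable (fun s : ℝ => (t - s) ^ (α - 1)) volume 0 t := by
  have h := (intervalIntegral.intervalIntegrable_rpow' (a := 0) (b := t)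
    (show -1 < α - 1 by linarith)).comp_sub_left t
  simpa using h.symm

lemma integral_sub_rpow {α : ℝ} (hα : 0 < α) (t : ℝ) :
    ∫ s in (0 : ℝ)..t, (t - s) ^ (α - 1) = t ^ α / α := by
  rw [intervalIntegral.integral_comp_sub_left (fun s : ℝ => s ^ (α - 1)) t,
    integral_rpow (Or.inl (by linarith))]
  simp [Real.zero_rpow hα.ne']

lemma intervalIntegrable_mul_min_one_div_rpow {g : ℝ → ℝ} {τ t : ℝ} (p : ℝ)
    (hτ : 0 < τ) (ht : 0 ≤ t) (hg : IntervalIntegrable g volume 0 t) :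
    IntervalIntegrable (fun s => g s * min 1 ((τ / s) ^ p)) volume 0 t := by
  refine hg.mono_fun ?_ ?_
  · exact hg.def'.aestronglyMeasurable.mul
      (Measurable.aestronglyMeasurable (by fun_prop))
  · filter_upwards [ae_restrict_mem measurableSet_uIoc] with s hs
    rw [uIoc_of_le ht] at hs
    have h0 : 0 ≤ min 1 ((τ / s) ^ p) :=
      le_min zero_le_one (rpow_nonneg (div_nonneg hτ.le hs.1.le) _)
    rw [norm_mul, Real.norm_of_nonneg h0]
    exact mul_le_of_le_one_right (norm_nonneg _) (min_le_left _ _)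

lemma intervalIntegrable_min_one_div_rpow {τ t : ℝ} (p : ℝ) (hτ : 0 < τ) (ht : 0 ≤ t) :
    IntervalIntegrable (fun s => min 1 ((τ / s) ^ p)) volume 0 t := by
  simpa using intervalIntegrable_mul_min_one_div_rpow (g := fun _ => 1) p hτ ht
    intervalIntegrable_const

lemma rpow_mul_integral_le_fractional_integral {α τ t : ℝ} (p : ℝ) (hα : 0 < α) (hα1 : α < 1)
    (hτ : 0 < τ) (ht : 0 < t) :
    t ^ (α - 1) * ∫ s in (0 : ℝ)..t, min 1 ((τ / s) ^ p) ≤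
      ∫ s in (0 : ℝ)..t, (t - s) ^ (α - 1) * min 1 ((τ / s) ^ p) := by
  rw [← intervalIntegral.integral_const_mul]
  refine intervalIntegral.integral_mono_on_of_le_Ioo ht.le
    ((intervalIntegrable_min_one_div_rpow p hτ ht.le).const_mul _)
    (intervalIntegrable_mul_min_one_div_rpow p hτ ht.le (intervalIntegrable_sub_rpow hα t)) ?_
  intro s hs
  have h0 : 0 ≤ min 1 ((τ / s) ^ p) :=
    le_min zero_le_one (rpow_nonneg (div_nonneg hτ.le hs.1.le) _)
  refine mul_le_mul_of_nonneg_right ?_ h0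
  exact rpow_le_rpow_of_nonpos (by linarith [hs.2]) (by linarith [hs.1]) (by linarith)

/-- A case of Chebyshev's integral inequality: the increasing kernel is replaced by its mean. -/
lemma fractional_integral_le_rpow_mul_integral {α γ τ t : ℝ} (hα : 0 < α) (hα1 : α < 1)
    (hγ : -1 < γ) (hτ : 0 < τ) (ht : 0 < t) :
    ∫ s in (0 : ℝ)..t, (t - s) ^ (α - 1) * min 1 ((τ / s) ^ (γ + 1)) ≤
      t ^ (α - 1) / α * ∫ s in (0 : ℝ)..t, min 1 ((τ / s) ^ (γ + 1)) := by
  set F : ℝ → ℝ := fun s => min 1 ((τ / s) ^ (γ + 1)) with hF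
  set m := t ^ (α - 1) / α with hm
  set r := α ^ (1 / (1 - α)) with hr
  have hr0 : 0 < r := by positivity
  have hr1 : r < 1 := rpow_lt_one hα.le hα1 (by apply div_pos <;> linarith)
  have hrm : (t * r) ^ (α - 1) = m := by
    rw [mul_rpow ht.le hr0.le, hr, ← rpow_mul hα.le,
      show 1 / (1 - α) * (α - 1) = -1 by
        have : 1 - α ≠ 0 := by linarith
        field_simp; ring, rpow_neg_one, hm, div_eq_mul_inv]
  have hs₀ : 0 < t - t * r := by nlinarith
  have hFi : IntervalIntegrable F volume 0 t :=
    intervalIntegrable_min_one_div_rpow _ hτ ht.le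
  have hk := intervalIntegrable_sub_rpow hα t
  have hsub : IntervalIntegrable (fun s => F (t - t * r) * ((t - s) ^ (α - 1) - m)) volume 0 t :=
    (hk.sub intervalIntegrable_const).const_mul _
  have hmean : ∫ s in (0 : ℝ)..t, F (t - t * r) * ((t - s) ^ (α - 1) - m) = 0 := by
    rw [intervalIntegral.integral_const_mul,
      intervalIntegral.integral_sub hk intervalIntegrable_const, integral_sub_rpow hα,
      intervalIntegral.integral_const, hm, rpow_sub_one ht.ne']
    simp only [sub_zero, smul_eq_mul]
    field_simp
    ring
  calc ∫ s in (0 : ℝ)..t, (t - s) ^ (α - 1) * F s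
      ≤ ∫ s in (0 : ℝ)..t, (m * F s + F (t - t * r) * ((t - s) ^ (α - 1) - m)) := by
        refine intervalIntegral.integral_mono_on_of_le_Ioo ht.le
          (intervalIntegrable_mul_min_one_div_rpow _ hτ ht.le hk)
          ((hFi.const_mul _).add hsub) ?_
        intro s hs
        have hanti := antitoneOn_min_one_div_rpow hγ hτ
        suffices h : ((t - s) ^ (α - 1) - m) * (F s - F (t - t * r)) ≤ 0 by linarith
        rcases le_total s (t - t * r) with h | h
        · refine mul_nonpos_of_nonpos_of_nonneg ?_ (sub_nonneg.2 (hanti hs.1 hs₀ h))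
          rw [← hrm, sub_nonpos]
          exact rpow_le_rpow_of_nonpos (by positivity) (by linarith) (by linarith)
        · refine mul_nonpos_of_nonneg_of_nonpos ?_ (sub_nonpos.2 (hanti hs₀ hs.1 h))
          rw [← hrm, sub_nonneg]
          exact rpow_le_rpow_of_nonpos (by linarith [hs.2]) (by linarith) (by linarith)
    _ = m * ∫ s in (0 : ℝ)..t, F s := by
        rw [intervalIntegral.integral_add (hFi.const_mul _) hsub, hmean, add_zero,
          intervalIntegral.integral_const_mul]

lemma integral_min_one_div_rpow {γ τ t : ℝ} (hγ : -1 < γ) (hτ : 0 < τ) (ht : τ ≤ t) :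
    ∫ s in (0 : ℝ)..t, min 1 ((τ / s) ^ (γ + 1)) =
      τ + ∫ s in τ..t, τ ^ (γ + 1) * s ^ (-(γ + 1)) := by
  have hi := intervalIntegrable_min_one_div_rpow (γ + 1) hτ (hτ.le.trans ht)
  have hiτ := intervalIntegrable_min_one_div_rpow (γ + 1) hτ hτ.le
  rw [← intervalIntegral.integral_add_adjacent_intervals hiτ (hiτ.symm.trans hi)]
  congr 1
  · have : ∫ s in (0 : ℝ)..τ, min 1 ((τ / s) ^ (γ + 1)) = ∫ s in (0 : ℝ)..τ, (1 : ℝ) := by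
      refine intervalIntegral.integral_congr_ae (Filter.Eventually.of_forall fun s hs => ?_)
      rw [uIoc_of_le hτ.le] at hs
      exact min_eq_left (one_le_rpow ((one_le_div hs.1).2 hs.2) (by linarith))
    simpa using this
  · refine intervalIntegral.integral_congr fun s hs => ?_
    rw [uIcc_of_le ht] at hs
    have hs0 : 0 < s := hτ.trans_le hs.1
    rw [min_eq_right (rpow_le_one (by positivity) ((div_le_one hs0).2 hs.1) (by linarith)),
      div_rpow hτ.le hs0.le, rpow_neg hs0.le, div_eq_mul_inv]

lemma integral_min_one_div_rpow_of_ne_zero {γ τ t : ℝ} (hγ : -1 < γ) (hγ0 : γ ≠ 0) (hτ : 0 < τ)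
    (ht : τ ≤ t) :
    ∫ s in (0 : ℝ)..t, min 1 ((τ / s) ^ (γ + 1)) = τ * (1 + (1 - (τ / t) ^ γ) / γ) := by
  have ht0 : 0 < t := hτ.trans_le ht
  have hmem : (0 : ℝ) ∉ uIcc τ t := by
    rw [uIcc_of_le ht]
    exact fun h => absurd h.1 (not_le.2 hτ)
  have hne : -(γ + 1) ≠ -1 := fun h => hγ0 (by linarith)
  rw [integral_min_one_div_rpow hγ hτ ht, intervalIntegral.integral_const_mul,
    integral_rpow (Or.inr ⟨hne, hmem⟩), show -(γ + 1) + 1 = -γ by ring,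
    rpow_neg hτ.le, rpow_neg ht0.le, rpow_add_one hτ.ne', div_rpow hτ.le ht0.le]
  have h1 : τ ^ γ ≠ 0 := by positivity
  have h2 : t ^ γ ≠ 0 := by positivity
  field_simp
  ring

lemma integral_min_one_div {τ t : ℝ} (hτ : 0 < τ) (ht : τ ≤ t) :
    ∫ s in (0 : ℝ)..t, min 1 ((τ / s) ^ ((0 : ℝ) + 1)) = τ * (1 + Real.log (t / τ)) := by
  rw [integral_min_one_div_rpow (by norm_num) hτ ht, intervalIntegral.integral_const_mul]
  simp only [zero_add, rpow_one, rpow_neg_one]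
  rw [integral_inv_of_pos hτ (hτ.trans_le ht)]
  ring

lemma Vcal_le_and_le_Vcal (α : ℝ) {γ τ t : ℝ} (hγ : -1 < γ) (hτ : 0 < τ) (ht : τ ≤ t) :
    Vcal α γ τ t ≤ t ^ (α - 1) * ∫ s in (0 : ℝ)..t, min 1 ((τ / s) ^ (γ + 1)) ∧
      t ^ (α - 1) * ∫ s in (0 : ℝ)..t, min 1 ((τ / s) ^ (γ + 1)) ≤
        (1 + 1 / |γ|) * Vcal α γ τ t := by
  have ht0 : 0 < t := hτ.trans_le ht
  have hP : 0 < τ * t ^ (α - 1) := by positivity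
  have hx0 : 0 < (τ / t) ^ γ := by positivity
  have hτt : τ / t ≤ 1 := (div_le_one ht0).2 ht
  rcases lt_trichotomy γ 0 with h | rfl | h
  · rw [integral_min_one_div_rpow_of_ne_zero hγ h.ne hτ ht, Vcal, if_neg h.not_gt, if_neg h.ne,
      abs_of_neg h]
    have hx : 1 ≤ (τ / t) ^ γ := one_le_rpow_of_pos_of_le_one_of_nonpos (by positivity) hτt h.le
    set x := (τ / t) ^ γ
    have hβ : 1 ≤ 1 / (-γ) := (one_le_div (by linarith)).2 (by linarith)
    have he : (1 - x) / γ = (x - 1) * (1 / -γ) := by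
      field_simp
      ring
    rw [he]
    set b := 1 / -γ
    constructor
    · have : x ≤ 1 + (x - 1) * b := by nlinarith
      nlinarith [mul_le_mul_of_nonneg_left this hP.le]
    · have : 1 + (x - 1) * b ≤ (1 + b) * x := by nlinarith
      nlinarith [mul_le_mul_of_nonneg_left this hP.le]
  · rw [integral_min_one_div hτ ht, Vcal, if_neg (lt_irrefl _), if_pos rfl]
    constructor
    · exact le_of_eq (by ring)
    · exact le_of_eq (by simp; ring)
  · rw [integral_min_one_div_rpow_of_ne_zero hγ h.ne' hτ ht, Vcal, if_pos h, abs_of_pos h]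
    have hx : (τ / t) ^ γ ≤ 1 := rpow_le_one (by positivity) hτt h.le
    set x := (τ / t) ^ γ
    have h1 : 0 ≤ (1 - x) / γ := div_nonneg (by linarith) h.le
    have h2 : (1 - x) / γ ≤ 1 / γ := by
      gcongr
      linarith
    constructor
    · nlinarith [mul_le_mul_of_nonneg_left h1 hP.le]
    · nlinarith [mul_le_mul_of_nonneg_left h2 hP.le]

/-- Sharpness of the stability bound (Remark 1.1): the Riemann–Liouville
fractional integral `v = J^α F` of `F(t) = min{1, (τ/t)^{γ+1}}` satisfies
`v(t) ≃ 𝒱(t)` for `t ∈ [τ, T]`. -/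
theorem stmt14 (α γ T : ℝ) (hα0 : 0 < α) (hα1 : α < 1) (hγ : -1 < γ) (hT : 0 < T) :
    ∃ c C : ℝ, 0 < c ∧ 0 < C ∧
      ∀ τ : ℝ, 0 < τ → τ < T →
        ∀ t ∈ Set.Icc τ T,
          c * Vcal α γ τ t ≤
            (1 / Real.Gamma α) *
              (∫ s in (0:ℝ)..t, (t - s) ^ (α - 1) * min 1 ((τ / s) ^ (γ + 1))) ∧
          (1 / Real.Gamma α) *
              (∫ s in (0:ℝ)..t, (t - s) ^ (α - 1) * min 1 ((τ / s) ^ (γ + 1))) ≤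
            C * Vcal α γ τ t := by
  have hΓ : 0 < 1 / Real.Gamma α := one_div_pos.2 (Real.Gamma_pos_of_pos hα0)
  refine ⟨1 / Real.Gamma α, 1 / Real.Gamma α * (1 / α * (1 + 1 / |γ|)), hΓ, by positivity, ?_⟩
  intro τ hτ _ t ht
  have ht0 : 0 < t := hτ.trans_le ht.1
  obtain ⟨hl, hu⟩ := Vcal_le_and_le_Vcal α hγ hτ ht.1
  constructor
  · exact mul_le_mul_of_nonneg_left
      (hl.trans (rpow_mul_integral_le_fractional_integral _ hα0 hα1 hτ ht0)) hΓ.le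
  · rw [mul_assoc, mul_assoc (1 / α)]
    refine mul_le_mul_of_nonneg_left
      ((fractional_integral_le_rpow_mul_integral hα0 hα1 hγ hτ ht0).trans ?_) hΓ.le
    rw [div_eq_mul_one_div, mul_comm (t ^ (α - 1)), mul_assoc]
    exact mul_le_mul_of_nonneg_left hu (by positivity)
end

section
/- Let α ∈ (0,1) and let a < b be real numbers. Set τ := b − a, t* := b − (α/2)τ, and P(s) := (s − a)(b − s). Then ∫_a^{t*} P′(s) (t* − s)^{−α} ds = 0. Consequently, if Π₁v is the linear Lagrange interpolant of a function v at the points {a, b} and Π₂*v is the quadratic Lagrange interpolant of v at the points {a, t*, b}, then ∫_a^{t*} (Π₁v − Π₂*v)′(s) (t* − s)^{−α} ds = 0 for every function v (since Π₁v − Π₂*v is a constant multiple of P). -/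
open Real MeasureTheory Set

/-- Linear Lagrange interpolant with data `(a, ya)`, `(b, yb)`. -/
noncomputable def lagLin (a b ya yb s : ℝ) : ℝ := ya + (yb - ya) / (b - a) * (s - a)

/-- Quadratic Lagrange interpolant with data `(x0, y0)`, `(x1, y1)`, `(x2, y2)`. -/
noncomputable def lagQuad (x0 x1 x2 y0 y1 y2 s : ℝ) : ℝ :=
  y0 * ((s - x1) * (s - x2)) / ((x0 - x1) * (x0 - x2)) +
  y1 * ((s - x0) * (s - x2)) / ((x1 - x0) * (x1 - x2)) +
  y2 * ((s - x0) * (s - x1)) / ((x2 - x0) * (x2 - x1))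

/-- The linear interpolant minus the quadratic one with an extra node `t` is the second divided
difference times `(x - a) * (b - x)`. -/
theorem lagLin_sub_lagQuad {a t b : ℝ} (hat : a ≠ t) (htb : t ≠ b) (hab : a ≠ b) (ya yt yb x : ℝ) :
    lagLin a b ya yb x - lagQuad a t b ya yt yb x =
      (ya / ((a - t) * (a - b)) + yt / ((t - a) * (t - b)) + yb / ((b - a) * (b - t))) *
        ((x - a) * (b - x)) := by
  have h1 : a - t ≠ 0 := sub_ne_zero.2 hat
  have h2 : t - b ≠ 0 := sub_ne_zero.2 htb
  have h3 : b - a ≠ 0 := sub_ne_zero.2 hab.symm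
  rw [lagLin, lagQuad, ← neg_sub a t, ← neg_sub b a, ← neg_sub t b]
  field_simp
  ring

/-- Integral of an affine function against the weakly singular kernel `u ^ (-α)`. -/
theorem integral_affine_mul_rpow_neg {α L : ℝ} (hα : α < 1) (hL : 0 ≤ L) (c d : ℝ) :
    ∫ u in (0 : ℝ)..L, (c + d * u) * u ^ (-α) =
      c * (L ^ (1 - α) / (1 - α)) + d * (L ^ (2 - α) / (2 - α)) := by
  have hsplit : EqOn (fun u : ℝ => (c + d * u) * u ^ (-α))
      (fun u => c * u ^ (-α) + d * u ^ (1 - α)) (uIcc 0 L) := by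
    intro u hu
    rw [uIcc_of_le hL] at hu
    have : u ^ (1 - α) = u * u ^ (-α) := by
      rw [sub_eq_add_neg, rpow_add' hu.1 (by linarith), rpow_one]
    simp only [this]
    ring
  rw [intervalIntegral.integral_congr hsplit, intervalIntegral.integral_add
      ((intervalIntegral.intervalIntegrable_rpow' (by linarith)).const_mul c)
      ((intervalIntegral.intervalIntegrable_rpow' (by linarith)).const_mul d),
    intervalIntegral.integral_const_mul, intervalIntegral.integral_const_mul,
    integral_rpow (.inl (by linarith)), integral_rpow (.inl (by linarith)),
    zero_rpow (by linarith), zero_rpow (by linarith), sub_zero, sub_zero,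
    show -α + 1 = 1 - α by ring, show 1 - α + 1 = 2 - α by ring]

/-- The derivative of `(s - a) * (b - s)` is orthogonal to the kernel `(t - s) ^ (-α)` on `[a, t]`
for `t = b - α / 2 * (b - a)`. -/
theorem integral_deriv_mul_kernel_eq_zero {α a b : ℝ} (hα : α < 1) (hab : a < b) :
    (∫ s in a..(b - α / 2 * (b - a)),
        (a + b - 2 * s) * ((b - α / 2 * (b - a)) - s) ^ (-α)) = 0 := by
  set t := b - α / 2 * (b - a) with ht
  have hL : t - a = (2 - α) / 2 * (b - a) := by rw [ht]; ring
  have hLpos : 0 < t - a := by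
    rw [hL]
    exact mul_pos (by linarith) (by linarith)
  have hsub := intervalIntegral.integral_comp_sub_left (a := a) (b := t)
    (fun u : ℝ => (a + b - 2 * t + 2 * u) * u ^ (-α)) t
  have hint : ∀ s, a + b - 2 * t + 2 * (t - s) = a + b - 2 * s := fun s => by ring
  simp only [hint, sub_self] at hsub
  rw [hsub, integral_affine_mul_rpow_neg hα hLpos.le,
    show 2 - α = 1 + (1 - α) by ring, rpow_add hLpos, rpow_one,
    show a + b - 2 * t = -((1 - α) * (b - a)) by rw [ht]; ring]
  have h1 : 1 - α ≠ 0 := by linarith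
  have h2 : 1 + (1 - α) ≠ 0 := by linarith
  generalize (t - a) ^ (1 - α) = y
  rw [hL]
  field_simp
  ring

/-- The orthogonality property (4.3) of the Alikhanov collocation point
`t* = b - (α/2)(b - a)`: `∫_a^{t*} P'(s) (t* - s)^{-α} ds = 0` for
`P(s) = (s-a)(b-s)` (so `P'(s) = a + b - 2s`); consequently, for every `v`,
`∫_a^{t*} (Π₁v - Π₂*v)'(s) (t* - s)^{-α} ds = 0`, where `Π₁v` interpolates `v`
at `{a, b}` and `Π₂*v` interpolates `v` at `{a, t*, b}`. -/
theorem stmt15 (α a b : ℝ) (hα0 : 0 < α) (hα1 : α < 1) (hab : a < b) :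
    (∫ s in a..(b - α / 2 * (b - a)),
        (a + b - 2 * s) * ((b - α / 2 * (b - a)) - s) ^ (-α)) = 0 ∧
    ∀ v : ℝ → ℝ,
      (∫ s in a..(b - α / 2 * (b - a)),
          deriv (fun x =>
            lagLin a b (v a) (v b) x -
              lagQuad a (b - α / 2 * (b - a)) b
                (v a) (v (b - α / 2 * (b - a))) (v b) x) s *
            ((b - α / 2 * (b - a)) - s) ^ (-α)) = 0 := by
  refine ⟨integral_deriv_mul_kernel_eq_zero hα1 hab, fun v => ?_⟩
  set t := b - α / 2 * (b - a) with ht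
  have hτ : 0 < b - a := sub_pos.2 hab
  have hat : a ≠ t := by
    have : 0 < (2 - α) / 2 * (b - a) := mul_pos (by linarith) hτ
    exact ne_of_lt (by linarith)
  have htb : t ≠ b := by
    have : 0 < α / 2 * (b - a) := mul_pos (by linarith) hτ
    exact ne_of_lt (by linarith)
  have hderiv (c s : ℝ) :
      deriv (fun x => c * ((x - a) * (b - x))) s = c * (a + b - 2 * s) := by
    have h := (((hasDerivAt_id s).sub_const a).mul ((hasDerivAt_id s).const_sub b)).const_mul c
    refine (h.congr_deriv ?_).deriv
    simp only [id]
    ring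
  simp only [lagLin_sub_lagQuad hat htb hab.ne, hderiv, mul_assoc,
    intervalIntegral.integral_const_mul]
  rw [integral_deriv_mul_kernel_eq_zero hα1 hab, mul_zero]
end
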